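/- Let n ≥ 3 and let q > 1 satisfy 1/(q−1) < n−1. Let u be a positive bounded classical solution of the half-space problem ∂ₜu = Δu in ℝⁿ₊×ℝ, −∂u/∂x₁ = u^q on ∂ℝⁿ₊×ℝ, which is axially symmetric and such that |∇u| is bounded on closure(ℝⁿ₊)×ℝ. Then there exists C > 0 such that |∇u(x,t)| ≤ C|x|^{−q/(q−1)} for all x ∈ closure(ℝⁿ₊)∖{0} and t ∈ ℝ. -/

import Mathlib

open scoped BigOperators
open Set

/-- The Laplacian of `f : ℝⁿ → ℝ` at `x`, as the sum of the second partial
derivatives in the coordinate directions. -/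
noncomputable def lap {n : ℕ} (f : EuclideanSpace ℝ (Fin n) → ℝ)
    (x : EuclideanSpace ℝ (Fin n)) : ℝ :=
  ∑ i : Fin n,
    fderiv ℝ (fun y => fderiv ℝ f y (EuclideanSpace.single i 1)) x
      (EuclideanSpace.single i 1)

/-- The open half-space `ℝⁿ₊ = {x : x₁ > 0}`. -/
def openHalf (n : ℕ) (hn : 0 < n) : Set (EuclideanSpace ℝ (Fin n)) :=
  {x | 0 < x ⟨0, hn⟩}

/-- The closed half-space `{x : x₁ ≥ 0}` (the closure of `ℝⁿ₊`). -/
def closedHalf (n : ℕ) (hn : 0 < n) : Set (EuclideanSpace ℝ (Fin n)) :=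
  {x | 0 ≤ x ⟨0, hn⟩}

/-- `u` is a positive classical solution of the half-space problem
`∂ₜu = Δu` in `ℝⁿ₊ × ℝ`, `-∂u/∂x₁ = u^q` on `∂ℝⁿ₊ × ℝ`: it is continuous together
with its spatial gradient up to the boundary, `C²` in `x` and `C¹` in `t` in the
open half-space, satisfies the heat equation inside and the nonlinear boundary
condition on the boundary, and is everywhere positive. -/
def IsHalfSpaceSol (n : ℕ) (hn : 0 < n) (q : ℝ)
    (u : EuclideanSpace ℝ (Fin n) × ℝ → ℝ) : Prop :=
  ContinuousOn u (closedHalf n hn ×ˢ (univ : Set ℝ)) ∧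
  (∀ t, ContDiffOn ℝ 1 (fun x => u (x, t)) (closedHalf n hn)) ∧
  (∀ t, ContinuousOn
    (fun x => fderivWithin ℝ (fun y => u (y, t)) (closedHalf n hn) x)
    (closedHalf n hn)) ∧
  (∀ t, ContDiffOn ℝ 2 (fun x => u (x, t)) (openHalf n hn)) ∧
  (∀ x ∈ openHalf n hn, ContDiff ℝ 1 fun s => u (x, s)) ∧
  (∀ x ∈ openHalf n hn, ∀ t : ℝ,
    deriv (fun s => u (x, s)) t = lap (fun y => u (y, t)) x) ∧
  (∀ x : EuclideanSpace ℝ (Fin n), x ⟨0, hn⟩ = 0 → ∀ t : ℝ,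
    -(fderivWithin ℝ (fun y => u (y, t)) (closedHalf n hn) x
        (EuclideanSpace.single ⟨0, hn⟩ 1)) = u (x, t) ^ q) ∧
  (∀ x ∈ closedHalf n hn, ∀ t : ℝ, 0 < u (x, t))

/-- `u` is axially symmetric: `u(x₁, x̃, t)` depends on `x̃ = (x₂,…,xₙ)` only
through `|x̃|`. -/
def AxiallySymmetric (n : ℕ) (hn : 0 < n)
    (u : EuclideanSpace ℝ (Fin n) × ℝ → ℝ) : Prop :=
  ∀ x y : EuclideanSpace ℝ (Fin n), x ⟨0, hn⟩ = y ⟨0, hn⟩ →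
    (∑ i ∈ Finset.univ.erase ⟨0, hn⟩, (x i) ^ 2)
      = (∑ i ∈ Finset.univ.erase ⟨0, hn⟩, (y i) ^ 2) →
    ∀ t : ℝ, u (x, t) = u (y, t)

open Set Filter Topology Function

/-- `g` is differentiable near `x` and its derivative has derivative `c` at `x`. -/
def HasD2 (g : ℝ → ℝ) (x c : ℝ) : Prop :=
  ∃ g' : ℝ → ℝ, (∀ᶠ s in 𝓝 x, HasDerivAt g (g' s) s) ∧ HasDerivAt g' c x

theorem HasD2.of_hasDerivAt {g g' : ℝ → ℝ} {x c : ℝ} (h : ∀ s, HasDerivAt g (g' s) s)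
    (h' : HasDerivAt g' c x) : HasD2 g x c :=
  ⟨g', Eventually.of_forall h, h'⟩

theorem HasD2.sub {f g : ℝ → ℝ} {x c d : ℝ} (hf : HasD2 f x c) (hg : HasD2 g x d) :
    HasD2 (fun s => f s - g s) x (c - d) := by
  obtain ⟨f', hf, hf'⟩ := hf
  obtain ⟨g', hg, hg'⟩ := hg
  refine ⟨fun s => f' s - g' s, ?_, hf'.sub hg'⟩
  filter_upwards [hf, hg] with s h1 h2 using h1.sub h2

theorem HasD2.mul_const {f : ℝ → ℝ} {x c : ℝ} (hf : HasD2 f x c) (k : ℝ) :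
    HasD2 (fun s => f s * k) x (c * k) := by
  obtain ⟨f', hf, hf'⟩ := hf
  refine ⟨fun s => f' s * k, ?_, hf'.mul_const k⟩
  filter_upwards [hf] with s h1 using h1.mul_const k

theorem HasD2.quadratic (A B C x : ℝ) : HasD2 (fun s => A + B * s + C * s ^ 2) x (2 * C) := by
  refine HasD2.of_hasDerivAt (g' := fun s => B + 2 * C * s) (fun s => ?_) ?_
  · have h := (((hasDerivAt_id s).const_mul B).const_add A).add
      (((hasDerivAt_id s).pow 2).const_mul C)
    exact h.congr_deriv (by simp; ring)
  · simpa using ((hasDerivAt_id x).const_mul (2 * C)).const_add B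

theorem HasD2.congr {f g : ℝ → ℝ} {x c : ℝ} (hf : HasD2 f x c) (h : ∀ s, g s = f s) :
    HasD2 g x c := by
  obtain rfl : g = f := funext h
  exact hf

theorem HasD2.nonpos_of_isLocalMax {g : ℝ → ℝ} {x c : ℝ} (h : HasD2 g x c)
    (hm : IsLocalMax g x) : c ≤ 0 := by
  obtain ⟨g', hg, hg'⟩ := h
  by_contra! hc
  have e : deriv g =ᶠ[𝓝 x] g' := hg.mono fun s hs => hs.deriv
  have h1 : deriv (deriv g) x = c := by rw [e.deriv_eq]; exact hg'.deriv
  have hmin : IsLocalMin g x := isLocalMin_of_deriv_deriv_pos (by rw [h1]; exact hc)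
    hm.deriv_eq_zero hg.self_of_nhds.continuousAt
  have hconst : g =ᶠ[𝓝 x] fun _ => g x := by
    filter_upwards [hm, hmin] with s h1 h2 using le_antisymm h1 h2
  have h2 : deriv g =ᶠ[𝓝 x] fun _ => 0 := by
    filter_upwards [hconst.eventuallyEq_nhds] with s hs
    rw [hs.deriv_eq]; simp
  rw [h2.deriv_eq] at h1
  simp at h1
  exact hc.ne h1

theorem nonneg_of_hasDerivWithinAt_of_max_left {g : ℝ → ℝ} {x c : ℝ}
    (h : HasDerivWithinAt g c (Iic x) x) (hm : ∀ᶠ s in 𝓝 x, s ≤ x → g s ≤ g x) : 0 ≤ c := by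
  have h' := (hasDerivWithinAt_iff_tendsto_slope.1 h)
  have e : Iic x \ {x} = Iio x := by ext; simp [lt_iff_le_and_ne]
  rw [e] at h'
  refine ge_of_tendsto h' ?_
  filter_upwards [self_mem_nhdsWithin, mem_nhdsWithin_of_mem_nhds hm] with s hs hs'
  have hs : s < x := hs
  rw [slope_def_field]
  exact div_nonneg_of_nonpos (by linarith [hs' hs.le]) (by linarith)

theorem nonpos_of_hasDerivWithinAt_of_max_right {g : ℝ → ℝ} {x c : ℝ}
    (h : HasDerivWithinAt g c (Ici x) x) (hm : ∀ᶠ s in 𝓝 x, x ≤ s → g s ≤ g x) : c ≤ 0 := by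
  have h' := (hasDerivWithinAt_iff_tendsto_slope.1 h)
  have e : Ici x \ {x} = Ioi x := by ext; simp [lt_iff_le_and_ne]
  rw [e] at h'
  refine le_of_tendsto h' ?_
  filter_upwards [self_mem_nhdsWithin, mem_nhdsWithin_of_mem_nhds hm] with s hs hs'
  have hs : x < s := hs
  rw [slope_def_field]
  exact div_nonpos_of_nonpos_of_nonneg (by linarith [hs' hs.le]) (by linarith)

theorem continuous_update_right {n : ℕ} (x : Fin n → ℝ) (j : Fin n) :
    Continuous fun s : ℝ => update x j s :=
  Continuous.update (f := fun _ => x) continuous_const j continuous_id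

theorem sum_sq_sub_update {n : ℕ} (x x₀ : Fin n → ℝ) (j : Fin n) (s : ℝ) :
    ∑ k, (update x j s k - x₀ k) ^ 2
      = ∑ k, (x k - x₀ k) ^ 2 - (x j - x₀ j) ^ 2 + (s - x₀ j) ^ 2 := by
  classical
  rw [← Finset.add_sum_erase _ _ (Finset.mem_univ j),
    ← Finset.add_sum_erase _ (fun k => (x k - x₀ k) ^ 2) (Finset.mem_univ j)]
  have : ∑ k ∈ Finset.univ.erase j, (update x j s k - x₀ k) ^ 2
      = ∑ k ∈ Finset.univ.erase j, (x k - x₀ k) ^ 2 :=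
    Finset.sum_congr rfl fun k hk => by
      rw [update_of_ne (Finset.ne_of_mem_erase hk)]
  rw [this, update_self]; ring

/-- The part of a sup-norm ball lying in the closed half-space. -/
def hbox {n : ℕ} (o : Fin n) (x₀ : Fin n → ℝ) (ρ : ℝ) : Set (Fin n → ℝ) :=
  {x | (∀ j, |x j - x₀ j| ≤ ρ) ∧ 0 ≤ x o}

/-- `f` satisfies the heat equation on `B` at the points with positive `o`-coordinate. -/
def HeatOn {n : ℕ} (o : Fin n) (f : (Fin n → ℝ) → ℝ → ℝ) (B : Set (Fin n → ℝ)) (I : Set ℝ) :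
    Prop :=
  ∀ x ∈ B, 0 < x o → ∀ t ∈ I, ∃ c : Fin n → ℝ,
    (∀ j, HasD2 (fun s => f (update x j s) t) (x j) (c j)) ∧ HasDerivAt (f x) (∑ j, c j) t

/-- The barrier of the doubling argument. -/
def barrier {n : ℕ} (o i : Fin n) (x₀ : Fin n → ℝ) (t₀ ρ c α β l : ℝ)
    (x : Fin n → ℝ) (y t : ℝ) : ℝ :=
  c * (∑ k, (x k - x₀ k) ^ 2 + (y - x₀ i) ^ 2 + (t₀ - t)) + α * (x i - y) - β * (x i - y) ^ 2
    + l * (x i - y) * (x₀ o + 2 * ρ - x o)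

section Doubling
variable {n : ℕ} (o i : Fin n) (x₀ : Fin n → ℝ) (t₀ ρ c α β l : ℝ)

theorem continuous_barrier : Continuous fun p : (Fin n → ℝ) × ℝ × ℝ =>
    barrier o i x₀ t₀ ρ c α β l p.1 p.2.1 p.2.2 := by
  unfold barrier; fun_prop

theorem barrier_d2_of_ne {j : Fin n} (hj : j ≠ i) (x : Fin n → ℝ) (y t : ℝ) :
    HasD2 (fun s => barrier o i x₀ t₀ ρ c α β l (update x j s) y t) (x j) (2 * c) := by
  by_cases hjo : o = j
  · subst hjo
    refine (HasD2.quadratic (c * (∑ k, (x k - x₀ k) ^ 2 - (x o - x₀ o) ^ 2 + x₀ o ^ 2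
      + (y - x₀ i) ^ 2 + (t₀ - t)) + α * (x i - y) - β * (x i - y) ^ 2
      + l * (x i - y) * (x₀ o + 2 * ρ))
      (-2 * c * x₀ o - l * (x i - y)) c (x o)).congr fun s => ?_
    simp only [barrier, sum_sq_sub_update, update_of_ne hj.symm, update_self]; ring
  · refine (HasD2.quadratic (c * (∑ k, (x k - x₀ k) ^ 2 - (x j - x₀ j) ^ 2 + x₀ j ^ 2
      + (y - x₀ i) ^ 2 + (t₀ - t)) + α * (x i - y) - β * (x i - y) ^ 2
      + l * (x i - y) * (x₀ o + 2 * ρ - x o))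
      (-2 * c * x₀ j) c (x j)).congr fun s => ?_
    simp only [barrier, sum_sq_sub_update, update_of_ne hj.symm, update_of_ne hjo]; ring

theorem barrier_deriv_o (hi : o ≠ i) (x : Fin n → ℝ) (hx : x o = 0) (y t : ℝ) :
    HasDerivAt (fun s => barrier o i x₀ t₀ ρ c α β l (update x o s) y t)
      (-2 * c * x₀ o - l * (x i - y)) 0 := by
  have h : (fun s => barrier o i x₀ t₀ ρ c α β l (update x o s) y t) =
    fun s => barrier o i x₀ t₀ ρ c α β l x y t + (-2 * c * x₀ o - l * (x i - y)) * s
      + c * s ^ 2 := by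
    funext s
    simp only [barrier, sum_sq_sub_update, update_of_ne hi.symm, update_self, hx]; ring
  rw [h]
  have h := ((hasDerivAt_id (0:ℝ)).const_mul (-2 * c * x₀ o - l * (x i - y))).const_add
    (barrier o i x₀ t₀ ρ c α β l x y t)
  have h' := h.add (((hasDerivAt_id (0:ℝ)).pow 2).const_mul c)
  exact h'.congr_deriv (by simp)

theorem barrier_d2_self (hl : i = o → l = 0) (x : Fin n → ℝ) (y t : ℝ) :
    HasD2 (fun s => barrier o i x₀ t₀ ρ c α β l (update x i s) y t) (x i) (2 * (c - β)) := by
  have hl' : ∀ s, l * (s - y) * (x₀ o + 2 * ρ - update x i s o)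
      = l * (s - y) * (x₀ o + 2 * ρ - x o) := fun s => by
    by_cases h : i = o
    · simp [hl h]
    · rw [update_of_ne (Ne.symm h)]
  refine (HasD2.quadratic (c * (∑ k, (x k - x₀ k) ^ 2 - (x i - x₀ i) ^ 2 + x₀ i ^ 2
      + (y - x₀ i) ^ 2 + (t₀ - t)) - α * y - β * y ^ 2
      - l * y * (x₀ o + 2 * ρ - x o))
      (-2 * c * x₀ i + α + 2 * β * y + l * (x₀ o + 2 * ρ - x o)) (c - β) (x i)).congr
      fun s => ?_
  simp only [barrier, sum_sq_sub_update, update_self, hl']; ring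

theorem barrier_eq_quadratic (x : Fin n → ℝ) (y t : ℝ) :
    barrier o i x₀ t₀ ρ c α β l x y t =
    (c * (∑ k, (x k - x₀ k) ^ 2 + x₀ i ^ 2 + (t₀ - t)) + α * x i - β * x i ^ 2
      + l * x i * (x₀ o + 2 * ρ - x o)) +
      (-2 * c * x₀ i - α + 2 * β * x i - l * (x₀ o + 2 * ρ - x o)) * y + (c - β) * y ^ 2 := by
  simp only [barrier]; ring

theorem barrier_d2_snd (x : Fin n → ℝ) (y t : ℝ) :
    HasD2 (fun s => barrier o i x₀ t₀ ρ c α β l x s t) y (2 * (c - β)) :=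
  (HasD2.quadratic _ _ _ _).congr fun s => barrier_eq_quadratic o i x₀ t₀ ρ c α β l x s t

theorem barrier_deriv_snd (x : Fin n → ℝ) (t : ℝ) :
    HasDerivAt (fun s => barrier o i x₀ t₀ ρ c α β l x s t)
      (-2 * c * x₀ i - α + 2 * β * x i - l * (x₀ o + 2 * ρ - x o)) 0 := by
  simp only [barrier_eq_quadratic]
  have h := ((hasDerivAt_id (0:ℝ)).const_mul
    (-2 * c * x₀ i - α + 2 * β * x i - l * (x₀ o + 2 * ρ - x o))).const_add
    (c * (∑ k, (x k - x₀ k) ^ 2 + x₀ i ^ 2 + (t₀ - t)) + α * x i - β * x i ^ 2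
      + l * x i * (x₀ o + 2 * ρ - x o))
  have h' := h.add (((hasDerivAt_id (0:ℝ)).pow 2).const_mul (c - β))
  exact h'.congr_deriv (by simp)

theorem barrier_deriv_time (x : Fin n → ℝ) (y t : ℝ) :
    HasDerivAt (fun s => barrier o i x₀ t₀ ρ c α β l x y s) (-c) t := by
  simp only [barrier]
  have h := ((hasDerivAt_id t).const_sub t₀).const_add (∑ k, (x k - x₀ k) ^ 2 + (y - x₀ i) ^ 2)
  have h' := (((h.const_mul c).add_const (α * (x i - y))).sub_const
    (β * (x i - y) ^ 2)).add_const (l * (x i - y) * (x₀ o + 2 * ρ - x o))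
  exact h'.congr_deriv (by ring)

/-- Compact set over which the doubled function is maximised. -/
def doubleSet : Set ((Fin n → ℝ) × ℝ × ℝ) :=
  {p | (∀ j, |p.1 j - x₀ j| ≤ ρ) ∧ |p.2.1 - x₀ i| ≤ ρ ∧ p.2.2 ∈ Icc (t₀ - ρ ^ 2) t₀ ∧
    0 ≤ p.1 o ∧ 0 ≤ update p.1 i p.2.1 o ∧ p.2.1 ≤ p.1 i}

theorem isCompact_doubleSet : IsCompact (doubleSet o i x₀ t₀ ρ) := by
  have hK : IsCompact ((Set.univ.pi fun j => Icc (x₀ j - ρ) (x₀ j + ρ)) ×ˢ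
      (Icc (x₀ i - ρ) (x₀ i + ρ) ×ˢ Icc (t₀ - ρ ^ 2) t₀)) :=
    (isCompact_univ_pi fun j => isCompact_Icc).prod (isCompact_Icc.prod isCompact_Icc)
  have hu : Continuous fun p : (Fin n → ℝ) × ℝ × ℝ => update p.1 i p.2.1 o := by
    have : Continuous fun p : (Fin n → ℝ) × ℝ × ℝ => update p.1 i p.2.1 :=
      continuous_fst.update i (continuous_fst.comp continuous_snd)
    exact (continuous_apply o).comp this
  refine hK.of_isClosed_subset ?_ ?_
  · simp only [doubleSet, ofPred_and, Icc, ofPred_forall]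
    refine IsClosed.inter (isClosed_iInter fun j => isClosed_le (by fun_prop) (by fun_prop)) ?_
    refine IsClosed.inter (isClosed_le (by fun_prop) (by fun_prop)) ?_
    refine IsClosed.inter (IsClosed.inter (isClosed_le (by fun_prop) (by fun_prop))
      (isClosed_le (by fun_prop) (by fun_prop))) ?_
    refine IsClosed.inter (isClosed_le (by fun_prop) (by fun_prop)) ?_
    exact IsClosed.inter (isClosed_le continuous_const hu) (isClosed_le (by fun_prop) (by fun_prop))
  · rintro p ⟨h1, h2, h3, -⟩
    refine ⟨fun j _ => ?_, ?_, h3⟩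
    · have := abs_le.1 (h1 j); constructor <;> linarith
    · have := abs_le.1 h2; constructor <;> linarith

end Doubling

set_option maxHeartbeats 2000000 in
theorem box_increment_le {n : ℕ} (o i : Fin n) {f : (Fin n → ℝ) → ℝ → ℝ} {x₀ : Fin n → ℝ}
    {t₀ ρ S G L : ℝ} (hρ : 0 < ρ) (hS : 0 < S) (hG : 0 ≤ G) (hL : 0 ≤ L) (hx₀ : 0 ≤ x₀ o)
    (hc : ContinuousOn (fun p : (Fin n → ℝ) × ℝ => f p.1 p.2)
      (hbox o x₀ ρ ×ˢ Icc (t₀ - ρ ^ 2) t₀))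
    (hb : ∀ x ∈ hbox o x₀ ρ, ∀ t ∈ Icc (t₀ - ρ ^ 2) t₀, |f x t| ≤ S)
    (hh : HeatOn o f (hbox o x₀ ρ) (Icc (t₀ - ρ ^ 2) t₀))
    (d : (Fin n → ℝ) → ℝ → ℝ)
    (hd : ∀ x ∈ hbox o x₀ ρ, x o = 0 → ∀ t ∈ Icc (t₀ - ρ ^ 2) t₀,
      HasDerivWithinAt (fun s => f (update x o s) t) (d x t) (Ici 0) 0)
    (hdo : i = o → ∀ x ∈ hbox o x₀ ρ, x o = 0 → ∀ t ∈ Icc (t₀ - ρ ^ 2) t₀, d x t ≤ G)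
    (hdi : i ≠ o → ∀ x ∈ hbox o x₀ ρ, x o = 0 → ∀ t ∈ Icc (t₀ - ρ ^ 2) t₀, ∀ y ≤ x i,
      update x i y ∈ hbox o x₀ ρ → d (update x i y) t - d x t ≤ L * (x i - y))
    {h : ℝ} (h0 : 0 ≤ h) (h1 : h ≤ ρ) :
    f (update x₀ i (x₀ i + h)) t₀ - f x₀ t₀ ≤ ((8 * n + 18) * S / ρ + G + 2 * L * ρ) * h := by
  classical
  obtain ⟨l, hlo, hli⟩ : ∃ l : ℝ, (i = o → l = 0) ∧ (i ≠ o → l = L + S / ρ ^ 2) := by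
    by_cases h : i = o
    · exact ⟨0, fun _ => rfl, fun h' => (h' h).elim⟩
    · exact ⟨L + S / ρ ^ 2, fun h' => (h h').elim, fun _ => rfl⟩
  have hSρ : 0 < S / ρ ^ 2 := by positivity
  have hl0 : 0 ≤ l := by
    by_cases h : i = o
    · exact (hlo h).ge
    · rw [hli h]; positivity
  have hlle : l ≤ L + S / ρ ^ 2 := by
    by_cases h : i = o
    · rw [hlo h]; positivity
    · exact (hli h).le
  set c : ℝ := 2 * (S / ρ ^ 2) with hcdef
  have hc0 : 0 < c := by positivity
  set β : ℝ := c * (n + 2) with hβ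
  have hβ0 : 0 < β := by positivity
  set α : ℝ := 4 * β * ρ + G with hα
  have hcρ : c * ρ ^ 2 = 2 * S := by rw [hcdef]; field_simp
  set B := barrier o i x₀ t₀ ρ c α β l with hB
  set Ψ : (Fin n → ℝ) × ℝ × ℝ → ℝ := fun p =>
    f p.1 p.2.2 - f (update p.1 i p.2.1) p.2.2 - B p.1 p.2.1 p.2.2 with hΨ
  set K := doubleSet o i x₀ t₀ ρ with hK
  have hKbox : ∀ p ∈ K, p.1 ∈ hbox o x₀ ρ ∧ update p.1 i p.2.1 ∈ hbox o x₀ ρ := by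
    rintro p ⟨h1, h2, -, h4, h5, -⟩
    refine ⟨⟨h1, h4⟩, fun j => ?_, h5⟩
    by_cases hj : j = i
    · subst hj; simpa using h2
    · rw [update_of_ne hj]; exact h1 j
  have hupd : Continuous fun p : (Fin n → ℝ) × ℝ × ℝ => update p.1 i p.2.1 :=
    continuous_fst.update i (continuous_fst.comp continuous_snd)
  have hupdo : Continuous fun p : (Fin n → ℝ) × ℝ × ℝ => update p.1 i p.2.1 o :=
    (continuous_apply o).comp hupd
  have hΨc : ContinuousOn Ψ K := by
    refine (ContinuousOn.sub ?_ ?_).sub (continuous_barrier _ _ _ _ _ _ _ _ _).continuousOn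
    · exact hc.comp (f := fun p : (Fin n → ℝ) × ℝ × ℝ => (p.1, p.2.2)) (by fun_prop)
        fun p hp => ⟨(hKbox p hp).1, hp.2.2.1⟩
    · exact hc.comp (f := fun p : (Fin n → ℝ) × ℝ × ℝ => (update p.1 i p.2.1, p.2.2))
        (hupd.prodMk (by fun_prop)).continuousOn
        fun p hp => ⟨(hKbox p hp).2, hp.2.2.1⟩
  suffices hmain : ∀ p ∈ K, Ψ p ≤ 0 by
    have hx₀u : 0 ≤ update x₀ i (x₀ i + h) o := by
      by_cases ho : o = i
      · subst ho; simp; linarith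
      · rwa [update_of_ne ho]
    have hmem : (update x₀ i (x₀ i + h), x₀ i, t₀) ∈ K := by
      refine ⟨fun j => ?_, by simpa using hρ.le, ⟨by nlinarith, le_refl _⟩, hx₀u, ?_, ?_⟩
      · by_cases hj : j = i
        · subst hj; simp [abs_of_nonneg h0, h1]
        · simpa [update_of_ne hj] using hρ.le
      · simpa using hx₀
      · simp [h0]
    have := hmain _ hmem
    simp only [hΨ, hB, barrier, sum_sq_sub_update, update_idem, update_eq_self, update_self] at this
    have e1 : l * (x₀ o + 2 * ρ - update x₀ i (x₀ i + h) o) = l * (2 * ρ) := by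
      by_cases hi : i = o
      · simp [hlo hi]
      · rw [update_of_ne (Ne.symm hi)]; ring
    have e2 : l * (x₀ i + h - x₀ i) * (x₀ o + 2 * ρ - update x₀ i (x₀ i + h) o)
        = l * (2 * ρ) * h := by rw [← e1]; ring
    rw [e2] at this
    simp only [sub_self, add_sub_cancel_left] at this
    have e3 : l * (2 * ρ) ≤ 2 * L * ρ + 2 * S / ρ := by
      calc l * (2 * ρ) ≤ (L + S / ρ ^ 2) * (2 * ρ) := by gcongr
        _ = _ := by field_simp
    have e4 : α = 8 * (n + 2) * S / ρ + G := by rw [hα, hβ, hcdef]; field_simp; ring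
    have e5 : c * h ^ 2 ≤ β * h ^ 2 := by
      refine mul_le_mul_of_nonneg_right ?_ (sq_nonneg _)
      rw [hβ]; nlinarith [(Nat.cast_nonneg n : (0:ℝ) ≤ n)]
    have e6 : l * (2 * ρ) * h ≤ (2 * L * ρ + 2 * S / ρ) * h := by gcongr
    have e7 : ((8 * n + 18) * S / ρ + G + 2 * L * ρ) * h
      = α * h + (2 * L * ρ + 2 * S / ρ) * h := by rw [e4]; field_simp; ring
    rw [e7]
    have : c * (0 - 0 + h ^ 2 + 0 ^ 2 + 0) = c * h ^ 2 := by ring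
    simp at *
    linarith
  by_contra! hcon
  obtain ⟨p₁, hp₁, hp₁'⟩ := hcon
  obtain ⟨⟨x, y, t⟩, hzK, hzmax⟩ := (isCompact_doubleSet o i x₀ t₀ ρ).exists_isMaxOn ⟨p₁, hp₁⟩ hΨc
  have hpos : 0 < Ψ (x, y, t) := lt_of_lt_of_le hp₁' (hzmax hp₁)
  have hmax : ∀ p ∈ K, Ψ p ≤ Ψ (x, y, t) := fun p hp => hzmax hp
  obtain ⟨hbx, hby⟩ := hKbox _ hzK
  obtain ⟨k1, k2, ⟨k3, k3'⟩, k4, k5, k6⟩ := id hzK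
  simp only at k1 k2 k3 k3' k4 k5 k6 hbx hby
  have htI : t ∈ Icc (t₀ - ρ ^ 2) t₀ := ⟨k3, k3'⟩
  have hfb : f x t - f (update x i y) t ≤ 2 * S := by
    have := abs_le.1 (hb x hbx t htI)
    have := abs_le.1 (hb _ hby t htI)
    linarith
  have hδ2 : x i - y ≤ 2 * ρ := by
    have := abs_le.1 (k1 i); have := abs_le.1 k2; linarith
  have hδ0 : 0 ≤ x i - y := by linarith
  have hterm : 0 ≤ α * (x i - y) - β * (x i - y) ^ 2 := by
    have : 0 ≤ (α - β * (x i - y)) * (x i - y) := by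
      refine mul_nonneg ?_ hδ0
      rw [hα]; nlinarith
    nlinarith
  have hxo : x o ≤ x₀ o + ρ := by have := abs_le.1 (k1 o); linarith
  have hlterm : 0 ≤ l * (x i - y) * (x₀ o + 2 * ρ - x o) :=
    mul_nonneg (mul_nonneg hl0 hδ0) (by linarith)
  have hquad : ∑ k, (x k - x₀ k) ^ 2 + (y - x₀ i) ^ 2 + (t₀ - t) < ρ ^ 2 := by
    have h1 : B x y t < 2 * S := by simp only [hΨ] at hpos; linarith
    have h2 : c * (∑ k, (x k - x₀ k) ^ 2 + (y - x₀ i) ^ 2 + (t₀ - t)) < c * ρ ^ 2 := by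
      rw [hcρ]; simp only [hB, barrier] at h1; linarith
    exact lt_of_mul_lt_mul_left h2 hc0.le
  have hsum0 : 0 ≤ ∑ k, (x k - x₀ k) ^ 2 := Finset.sum_nonneg fun k _ => sq_nonneg _
  have s1 : ∀ j, |x j - x₀ j| < ρ := fun j => by
    have : (x j - x₀ j) ^ 2 ≤ ∑ k, (x k - x₀ k) ^ 2 :=
      Finset.single_le_sum (f := fun k => (x k - x₀ k) ^ 2) (fun k _ => sq_nonneg _)
        (Finset.mem_univ j)
    refine abs_lt_of_sq_lt_sq ?_ hρ.le
    nlinarith [sq_nonneg (y - x₀ i)]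
  have s2 : |y - x₀ i| < ρ := by
    refine abs_lt_of_sq_lt_sq ?_ hρ.le
    nlinarith
  have s3 : t₀ - ρ ^ 2 < t := by nlinarith [sq_nonneg (y - x₀ i)]
  have s4 : y < x i := by
    rcases k6.lt_or_eq with h | h
    · exact h
    · exfalso
      simp only [hΨ, hB, barrier, h] at hpos
      have : 0 ≤ c * (∑ k, (x k - x₀ k) ^ 2 + (x i - x₀ i) ^ 2 + (t₀ - t)) := by
        have : 0 ≤ t₀ - t := by linarith
        positivity
      simp at hpos
      linarith
  have hnhds : ∀ᶠ p : (Fin n → ℝ) × ℝ × ℝ in 𝓝 (x, y, t), p.2.2 ≤ t₀ → 0 ≤ p.1 o →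
      0 ≤ update p.1 i p.2.1 o → p ∈ K := by
    have a1 : ∀ᶠ p : (Fin n → ℝ) × ℝ × ℝ in 𝓝 (x, y, t), ∀ j, |p.1 j - x₀ j| < ρ := by
      refine eventually_all.2 fun j => ?_
      have : Continuous fun p : (Fin n → ℝ) × ℝ × ℝ => |p.1 j - x₀ j| := by fun_prop
      exact this.continuousAt.eventually_lt continuousAt_const (s1 j)
    have a2 : ∀ᶠ p : (Fin n → ℝ) × ℝ × ℝ in 𝓝 (x, y, t), |p.2.1 - x₀ i| < ρ := by
      have : Continuous fun p : (Fin n → ℝ) × ℝ × ℝ => |p.2.1 - x₀ i| := by fun_prop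
      exact this.continuousAt.eventually_lt continuousAt_const s2
    have a3 : ∀ᶠ p : (Fin n → ℝ) × ℝ × ℝ in 𝓝 (x, y, t), t₀ - ρ ^ 2 < p.2.2 := by
      have : Continuous fun p : (Fin n → ℝ) × ℝ × ℝ => p.2.2 := by fun_prop
      exact continuousAt_const.eventually_lt this.continuousAt s3
    have a4 : ∀ᶠ p : (Fin n → ℝ) × ℝ × ℝ in 𝓝 (x, y, t), p.2.1 < p.1 i := by
      have h1 : Continuous fun p : (Fin n → ℝ) × ℝ × ℝ => p.2.1 := by fun_prop
      have h2 : Continuous fun p : (Fin n → ℝ) × ℝ × ℝ => p.1 i := by fun_prop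
      exact h1.continuousAt.eventually_lt h2.continuousAt s4
    filter_upwards [a1, a2, a3, a4] with p b1 b2 b3 b4 c1 c2 c3
    exact ⟨fun j => (b1 j).le, b2.le, ⟨b3.le, c1⟩, c2, c3, b4.le⟩
  -- pulling the maximum back along a curve
  have hcurve : ∀ (γ : ℝ → (Fin n → ℝ) × ℝ × ℝ) (s₀ : ℝ), Continuous γ → γ s₀ = (x, y, t) →
      ∀ᶠ s in 𝓝 s₀, (γ s).2.2 ≤ t₀ → 0 ≤ (γ s).1 o →
        0 ≤ update (γ s).1 i (γ s).2.1 o → Ψ (γ s) ≤ Ψ (γ s₀) := by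
    intro γ s₀ hγ hγ0
    have : Tendsto γ (𝓝 s₀) (𝓝 (x, y, t)) := by rw [← hγ0]; exact hγ.continuousAt
    filter_upwards [this.eventually hnhds] with s hs h1 h2 h3
    rw [hγ0]
    exact hmax _ (hs h1 h2 h3)
  have hux : ∀ j, Continuous fun s : ℝ => ((update x j s, y, t) : (Fin n → ℝ) × ℝ × ℝ) :=
    fun j => (continuous_update_right x j).prodMk continuous_const
  by_cases hxo0 : x o = 0
  · by_cases hio : i = o
    · subst hio
      simp at k5
      linarith
    · have hc1 := hcurve (fun s => (update x o s, y, t)) 0 (hux o) (by rw [← hxo0]; simp)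
      have hyo : (update x i y) o = 0 := by rw [update_of_ne (Ne.symm hio)]; exact hxo0
      have D1 := hd x hbx hxo0 t htI
      have D2 := hd _ hby hyo t htI
      have D3 := (barrier_deriv_o o i x₀ t₀ ρ c α β l (Ne.symm hio) x hxo0 y t).hasDerivWithinAt
        (s := Ici 0)
      have D := (D1.sub D2).sub D3
      have hn := nonpos_of_hasDerivWithinAt_of_max_right D (by
        filter_upwards [hc1] with s hs hs0
        have := hs k3' (by simpa using hs0)
          (by rw [update_of_ne (Ne.symm hio)]; simpa using hs0)
        simp only [hΨ, hB] at this
        rw [update_comm (Ne.symm hio), update_comm (Ne.symm hio)] at this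
        exact this)
      have hdi' := hdi hio x hbx hxo0 t htI y k6 hby
      rw [hli hio] at hn
      have : 0 ≤ c * x₀ o := by positivity
      nlinarith [mul_pos hSρ (sub_pos.2 s4)]
  · have hxo' : 0 < x o := lt_of_le_of_ne k4 (Ne.symm hxo0)
    by_cases hyo0 : update x i y o = 0
    · have hio : i = o := by
        by_contra hio
        rw [update_of_ne (Ne.symm hio)] at hyo0
        exact hxo0 hyo0
      subst hio
      have hy0 : y = 0 := by simpa using hyo0
      subst hy0
      have hc1 := hcurve (fun s => (x, s, t)) 0 (by fun_prop) rfl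
      have D1 := hd _ hby (by simp) t htI
      simp only [update_idem] at D1
      have D3 := (barrier_deriv_snd i i x₀ t₀ ρ c α β l x t).hasDerivWithinAt (s := Ici 0)
      have D := (D1.const_sub (f x t)).sub D3
      have hn := nonpos_of_hasDerivWithinAt_of_max_right D (by
        filter_upwards [hc1] with s hs hs0
        exact hs k3' k4 (by simpa using hs0))
      have hdo' := hdo rfl _ hby (by simp) t htI
      rw [hlo rfl] at hn
      have h5 : x i < 2 * ρ := by
        have := abs_lt.1 (s1 i); have := abs_lt.1 s2; linarith
      have : 0 ≤ c * x₀ i := by positivity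
      rw [hα] at hn
      nlinarith
    · have hyo' : 0 < update x i y o := lt_of_le_of_ne k5 (Ne.symm hyo0)
      obtain ⟨cx, hcx, htx⟩ := hh x hbx hxo' t htI
      obtain ⟨cy, hcy, hty⟩ := hh _ hby hyo' t htI
      have hposx : ∀ j, ∀ᶠ s in 𝓝 (x j), 0 ≤ update x j s o ∧ 0 ≤ update (update x j s) i y o := by
        intro j
        have e1 : Continuous fun s : ℝ => update x j s o :=
          (continuous_apply o).comp (continuous_update_right x j)
        have e2 : Continuous fun s : ℝ => update (update x j s) i y o :=
          (continuous_apply o).comp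
            ((continuous_update_right x j).update i continuous_const)
        have e1' := continuousAt_const.eventually_lt (x₀ := x j) (f := fun _ => (0:ℝ))
          e1.continuousAt (by simpa using hxo')
        have e2' := continuousAt_const.eventually_lt (x₀ := x j) (f := fun _ => (0:ℝ))
          e2.continuousAt (by simpa using hyo')
        filter_upwards [e1', e2'] with s h1 h2 using ⟨h1.le, h2.le⟩
      have hne : ∀ j, j ≠ i → cx j - cy j - 2 * c ≤ 0 := by
        intro j hj
        have h2 : HasD2 (fun s => f (update (update x j s) i y) t) (x j) (cy j) := by
          have := hcy j
          rw [update_of_ne hj] at this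
          exact this.congr fun s => by rw [update_comm hj]
        refine HasD2.nonpos_of_isLocalMax
          (((hcx j).sub h2).sub (barrier_d2_of_ne o i x₀ t₀ ρ c α β l hj x y t)) ?_
        filter_upwards [hcurve (fun s => (update x j s, y, t)) (x j) (hux j) (by simp),
          hposx j] with s hs hs'
        exact hs k3' hs'.1 hs'.2
      have hi1 : cx i - 2 * (c - β) ≤ 0 := by
        have h2 : HasD2 (fun s => f (update x i s) t - f (update x i y) t) (x i) (cx i) := by
          have := (hcx i).sub (HasD2.quadratic (f (update x i y) t) 0 0 (x i))
          simpa using this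
        refine HasD2.nonpos_of_isLocalMax
          (h2.sub (barrier_d2_self o i x₀ t₀ ρ c α β l hlo x y t)) ?_
        filter_upwards [hcurve (fun s => (update x i s, y, t)) (x i) (hux i) (by simp),
          hposx i] with s hs hs'
        have := hs k3' hs'.1 hs'.2
        simpa only [hΨ, update_idem] using this
      have hi2 : -cy i - 2 * (c - β) ≤ 0 := by
        have h2 : HasD2 (fun s => f x t - f (update x i s) t) y (-cy i) := by
          have h3 := hcy i
          simp only [update_self, update_idem] at h3
          have := (HasD2.quadratic (f x t) 0 0 y).sub h3
          simpa using this
        refine HasD2.nonpos_of_isLocalMax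
          (h2.sub (barrier_d2_snd o i x₀ t₀ ρ c α β l x y t)) ?_
        have e2 : Continuous fun s : ℝ => update x i s o :=
          (continuous_apply o).comp (continuous_update_right x i)
        have e2' := continuousAt_const.eventually_lt (x₀ := y) (f := fun _ => (0:ℝ))
          e2.continuousAt hyo'
        filter_upwards [hcurve (fun s => (x, s, t)) y (by fun_prop) rfl, e2'] with s hs hs'
        exact hs k3' k4 hs'.le
      have htt : 0 ≤ ∑ j, cx j - ∑ j, cy j - -c := by
        have D := ((htx.sub hty).sub (barrier_deriv_time o i x₀ t₀ ρ c α β l x y t)).hasDerivWithinAt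
          (s := Iic t)
        refine nonneg_of_hasDerivWithinAt_of_max_left D ?_
        filter_upwards [hcurve (fun s => (x, y, s)) t (by fun_prop) rfl] with s hs hs'
        exact hs (hs'.trans k3') k4 k5
      have hsum : ∑ j, (cx j - cy j) ≤ ∑ j : Fin n, (2 * c) + (2 * c - 4 * β) := by
        rw [← Finset.add_sum_erase _ _ (Finset.mem_univ i),
          ← Finset.add_sum_erase _ (fun _ => 2 * c) (Finset.mem_univ i)]
        have : ∑ j ∈ Finset.univ.erase i, (cx j - cy j) ≤ ∑ j ∈ Finset.univ.erase i, 2 * c :=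
          Finset.sum_le_sum fun j hj => by linarith [hne j (Finset.ne_of_mem_erase hj)]
        linarith
      rw [Finset.sum_sub_distrib] at hsum
      simp at hsum
      rw [hβ] at hsum
      nlinarith [(Nat.cast_nonneg n : (0:ℝ) ≤ n)]

theorem HasD2.comp_add_const {g : ℝ → ℝ} {x c δ : ℝ} (h : HasD2 g (x + δ) c) :
    HasD2 (fun s => g (s + δ)) x c := by
  obtain ⟨g', hg, hg'⟩ := h
  refine ⟨fun s => g' (s + δ), ?_, hg'.comp_add_const x δ⟩
  have : Tendsto (fun s : ℝ => s + δ) (𝓝 x) (𝓝 (x + δ)) := by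
    exact (continuous_add_const δ).continuousAt
  filter_upwards [this.eventually hg] with s hs using hs.comp_add_const s δ

theorem HasD2.neg {f : ℝ → ℝ} {x c : ℝ} (hf : HasD2 f x c) : HasD2 (fun s => -f s) x (-c) := by
  simpa using hf.mul_const (-1)

theorem HeatOn.neg {n : ℕ} {o : Fin n} {f : (Fin n → ℝ) → ℝ → ℝ} {B : Set (Fin n → ℝ)}
    {I : Set ℝ} (h : HeatOn o f B I) : HeatOn o (fun x t => -f x t) B I := by
  intro x hx hx0 t ht
  obtain ⟨c, hc, hct⟩ := h x hx hx0 t ht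
  refine ⟨fun j => -c j, fun j => (hc j).neg, ?_⟩
  rw [Finset.sum_neg_distrib]
  exact hct.neg

theorem le_of_increment_le {g : ℝ → ℝ} {x c K ρ : ℝ} (hρ : 0 < ρ)
    (h : HasDerivWithinAt g c (Ici x) x) (hi : ∀ h, 0 ≤ h → h ≤ ρ → g (x + h) - g x ≤ K * h) :
    c ≤ K := by
  have h' := (hasDerivWithinAt_iff_tendsto_slope.1 h)
  have e : Ici x \ {x} = Ioi x := by ext; simp [lt_iff_le_and_ne]
  rw [e] at h'
  refine le_of_tendsto h' ?_
  have : Iio (x + ρ) ∈ 𝓝 x := Iio_mem_nhds (by linarith)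
  filter_upwards [self_mem_nhdsWithin, mem_nhdsWithin_of_mem_nhds this] with s hs hs'
  have hs : x < s := hs
  have hs' : s < x + ρ := hs'
  rw [slope_def_field, div_le_iff₀ (by linarith)]
  have := hi (s - x) (by linarith) (by linarith)
  simpa using this

/-- A positive bounded solution with bounded gradient in the closed half-space, in coordinates,
with its first and second pure partial derivatives. -/
structure PSol {n : ℕ} (o : Fin n) (q M : ℝ) (W : (Fin n → ℝ) → ℝ → ℝ)
    (D D2 : Fin n → (Fin n → ℝ) → ℝ → ℝ) : Prop where
  cont : ContinuousOn (fun p : (Fin n → ℝ) × ℝ => W p.1 p.2) {p | 0 ≤ p.1 o}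
  pos : ∀ x t, 0 ≤ x o → 0 < W x t
  le : ∀ x t, 0 ≤ x o → W x t ≤ M
  D_le : ∀ j x t, 0 ≤ x o → |D j x t| ≤ M
  hasD : ∀ j x t, 0 ≤ x o → (j ≠ o ∨ 0 < x o) →
    HasDerivAt (fun s => W (update x j s) t) (D j x t) (x j)
  hasDo : ∀ x t, x o = 0 →
    HasDerivWithinAt (fun s => W (update x o s) t) (D o x t) (Ici 0) 0
  bc : ∀ x t, x o = 0 → D o x t = -(W x t) ^ q
  D_cont : ∀ j t, ContinuousOn (fun x => D j x t) {x | 0 ≤ x o}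
  hasDD : ∀ j x t, 0 < x o →
    HasDerivAt (fun s => D j (update x j s) t) (D2 j x t) (x j)
  D2_cont : ∀ j t, ContinuousOn (fun x => D2 j x t) {x | 0 < x o}
  heat : ∀ x t, 0 < x o → HasDerivAt (W x) (∑ j, D2 j x t) t
  heat_cont : ∀ x, 0 < x o → Continuous fun t => ∑ j, D2 j x t

theorem interior_increment {n : ℕ} (o i : Fin n) {f : (Fin n → ℝ) → ℝ → ℝ} {x₀ : Fin n → ℝ}
    {t₀ ρ S : ℝ} (hρ : 0 < ρ) (hS : 0 < S) (hx₀ : ρ < x₀ o)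
    (hc : ContinuousOn (fun p : (Fin n → ℝ) × ℝ => f p.1 p.2)
      (hbox o x₀ ρ ×ˢ Icc (t₀ - ρ ^ 2) t₀))
    (hb : ∀ x ∈ hbox o x₀ ρ, ∀ t ∈ Icc (t₀ - ρ ^ 2) t₀, |f x t| ≤ S)
    (hh : HeatOn o f (hbox o x₀ ρ) (Icc (t₀ - ρ ^ 2) t₀))
    {h : ℝ} (h0 : 0 ≤ h) (h1 : h ≤ ρ) :
    |f (update x₀ i (x₀ i + h)) t₀ - f x₀ t₀| ≤ ((8 * n + 18) * S / ρ) * h := by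
  have hne : ∀ x ∈ hbox o x₀ ρ, x o ≠ 0 := fun x hx h => by
    have := abs_le.1 (hx.1 o); linarith
  have key : ∀ g : (Fin n → ℝ) → ℝ → ℝ,
      ContinuousOn (fun p : (Fin n → ℝ) × ℝ => g p.1 p.2) (hbox o x₀ ρ ×ˢ Icc (t₀ - ρ ^ 2) t₀) →
      (∀ x ∈ hbox o x₀ ρ, ∀ t ∈ Icc (t₀ - ρ ^ 2) t₀, |g x t| ≤ S) →
      HeatOn o g (hbox o x₀ ρ) (Icc (t₀ - ρ ^ 2) t₀) →
      g (update x₀ i (x₀ i + h)) t₀ - g x₀ t₀ ≤ ((8 * n + 18) * S / ρ) * h := by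
    intro g gc gb gh
    have := box_increment_le o i (G := 0) (L := 0) hρ hS le_rfl le_rfl (by linarith) gc gb gh
      (fun _ _ => 0) (fun x hx h => (hne x hx h).elim) (fun _ _ _ _ _ _ => le_rfl)
      (fun _ x hx h => (hne x hx h).elim) h0 h1
    simpa using this
  rw [abs_le]
  constructor
  · have := key (fun x t => -f x t) hc.neg (by simpa using hb) hh.neg
    linarith
  · exact key f hc hb hh

namespace PSol
variable {n : ℕ} {o : Fin n} {q M : ℝ} {W : (Fin n → ℝ) → ℝ → ℝ}
  {D D2 : Fin n → (Fin n → ℝ) → ℝ → ℝ}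

theorem hasD2 (P : PSol o q M W D D2) (j : Fin n) (x : Fin n → ℝ) (t : ℝ) (hx : 0 < x o) :
    HasD2 (fun s => W (update x j s) t) (x j) (D2 j x t) := by
  refine ⟨fun s => D j (update x j s) t, ?_, P.hasDD j x t hx⟩
  have e : Continuous fun s : ℝ => update x j s o :=
    (continuous_apply o).comp (continuous_update_right x j)
  filter_upwards [continuousAt_const.eventually_lt (x₀ := x j) (f := fun _ => (0:ℝ))
    e.continuousAt (by simpa using hx)] with s hs
  have := P.hasD j (update x j s) t hs.le (Or.inr hs)
  simpa using this

theorem heatOn (P : PSol o q M W D D2) (B : Set (Fin n → ℝ)) (I : Set ℝ) : HeatOn o W B I :=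
  fun x _ hx t _ => ⟨fun j => D2 j x t, fun j => P.hasD2 j x t hx, P.heat x t hx⟩

theorem hasDright (P : PSol o q M W D D2) (j : Fin n) (x : Fin n → ℝ) (t : ℝ) (hx : 0 ≤ x o) :
    HasDerivWithinAt (fun s => W (update x j s) t) (D j x t) (Ici (x j)) (x j) := by
  by_cases h : j ≠ o ∨ 0 < x o
  · exact (P.hasD j x t hx h).hasDerivWithinAt
  · push Not at h
    obtain ⟨rfl, h⟩ := h
    have h0 : x j = 0 := le_antisymm h hx
    rw [h0]
    exact P.hasDo x t h0

theorem cont_hbox (P : PSol o q M W D D2) (x₀ : Fin n → ℝ) (ρ : ℝ) (I : Set ℝ) :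
    ContinuousOn (fun p : (Fin n → ℝ) × ℝ => W p.1 p.2) (hbox o x₀ ρ ×ˢ I) :=
  P.cont.mono fun _ hp => hp.1.2

/-- Interior gradient estimate. -/
theorem interior_grad (P : PSol o q M W D D2) {x₀ : Fin n → ℝ} {t₀ ρ S : ℝ} (hρ : 0 < ρ)
    (hS : 0 < S) (hx₀ : ρ < x₀ o)
    (hb : ∀ x ∈ hbox o x₀ ρ, ∀ t ∈ Icc (t₀ - ρ ^ 2) t₀, W x t ≤ S) (i : Fin n) :
    |D i x₀ t₀| ≤ (8 * n + 18) * S / ρ := by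
  have hinc := fun h (h0 : 0 ≤ h) (h1 : h ≤ ρ) => interior_increment o i hρ hS hx₀
    (P.cont_hbox _ _ _) (fun x hx t ht => by
      rw [abs_of_pos (P.pos x t hx.2)]; exact hb x hx t ht) (P.heatOn _ _) h0 h1
  have hx0 : 0 ≤ x₀ o := by linarith
  rw [abs_le]
  constructor
  · have := le_of_increment_le (K := (8 * n + 18) * S / ρ) hρ (P.hasDright i x₀ t₀ hx0).neg
      fun h h0 h1 => by
        have := (abs_le.1 (hinc h h0 h1)).1
        simp only [Pi.neg_apply, update_eq_self]
        linarith
    linarith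
  · refine le_of_increment_le hρ (P.hasDright i x₀ t₀ hx0) fun h h0 h1 => ?_
    have := (abs_le.1 (hinc h h0 h1)).2
    simpa only [update_eq_self] using this

theorem mvt (P : PSol o q M W D D2) {i : Fin n} {x : Fin n → ℝ} {t a b C : ℝ} (hab : a ≤ b)
    (hx : ∀ s ∈ Icc a b, 0 ≤ update x i s o) (hi : ∀ s ∈ Icc a b, i ≠ o ∨ 0 < s)
    (hC : ∀ s ∈ Icc a b, |D i (update x i s) t| ≤ C) :
    |W (update x i b) t - W (update x i a) t| ≤ C * (b - a) := by
  have := (convex_Icc a b).norm_image_sub_le_of_norm_hasDerivWithin_le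
    (f := fun s => W (update x i s) t) (f' := fun s => D i (update x i s) t) (C := C)
    (x := a) (y := b) (fun s hs => ?_) (fun s hs => hC s hs) ⟨le_rfl, hab⟩ ⟨hab, le_rfl⟩
  · simpa [abs_of_nonneg (sub_nonneg.2 hab)] using this
  · have h := P.hasD i (update x i s) t (hx s hs) (by
      rcases hi s hs with h | h
      · exact Or.inl h
      · by_cases e : i = o
        · subst e; right; simpa using h
        · exact Or.inl e)
    simp only [update_idem, update_self] at h
    exact h.hasDerivWithinAt

/-- Interior bound for second derivatives in terms of the gradient. -/
theorem second_bound (P : PSol o q M W D D2) {x₀ : Fin n → ℝ} {t₀ ρ S : ℝ} (hρ : 0 < ρ)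
    (hS : 0 < S) (hx₀ : 2 * ρ < x₀ o) (i : Fin n)
    (hb : ∀ x, (∀ j, |x j - x₀ j| ≤ 2 * ρ) → ∀ t ∈ Icc (t₀ - ρ ^ 2) t₀, |D i x t| ≤ S) :
    |D2 i x₀ t₀| ≤ (8 * n + 18) * S / ρ := by
  have hboxpos : ∀ x ∈ hbox o x₀ ρ, ∀ δ, 0 ≤ δ → δ ≤ ρ → ∀ j,
      |update x i (x i + δ) j - x₀ j| ≤ 2 * ρ := by
    intro x hx δ h0 h1 j
    have := abs_le.1 (hx.1 j)
    by_cases hj : j = i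
    · subst hj; simp only [update_self]; rw [abs_le]; constructor <;> linarith
    · rw [update_of_ne hj, abs_le]; constructor <;> linarith
  have hopos : ∀ x : Fin n → ℝ, (∀ j, |x j - x₀ j| ≤ 2 * ρ) → 0 < x o := fun x hx => by
    have := abs_le.1 (hx o); linarith
  have hstep : ∀ δ, 0 < δ → δ ≤ ρ → ∀ h, 0 ≤ h → h ≤ ρ →
      |(W (update x₀ i (x₀ i + h + δ)) t₀ - W (update x₀ i (x₀ i + h)) t₀) / δ
        - (W (update x₀ i (x₀ i + δ)) t₀ - W x₀ t₀) / δ| ≤ ((8 * n + 18) * S / ρ) * h := by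
    intro δ hδ hδρ h h0 h1
    have key := interior_increment o i (f := fun x t => (W (update x i (x i + δ)) t - W x t) / δ)
      (x₀ := x₀) (t₀ := t₀) hρ hS (by linarith) ?_ ?_ ?_ h0 h1
    · simpa only [update_idem, update_self] using key
    · refine ContinuousOn.div_const (ContinuousOn.sub ?_ (P.cont_hbox _ _ _)) _
      refine P.cont.comp (f := fun p : (Fin n → ℝ) × ℝ => (update p.1 i (p.1 i + δ), p.2))
        ?_ fun p hp => (hopos _ (hboxpos p.1 hp.1 δ hδ.le hδρ)).le
      exact ((continuous_fst.update i (by fun_prop)).prodMk continuous_snd).continuousOn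
    · intro x hx t ht
      have hseg : ∀ s ∈ Icc (x i) (x i + δ), ∀ j, |update x i s j - x₀ j| ≤ 2 * ρ := by
        intro s hs
        have := hboxpos x hx (s - x i) (by linarith [hs.1]) (by linarith [hs.2])
        simpa using this
      have := P.mvt (i := i) (x := x) (t := t) (C := S) (a := x i) (b := x i + δ) (by linarith)
        (fun s hs => (hopos _ (hseg s hs)).le)
        (fun s hs => by
          by_cases e : i = o
          · subst e; right; simpa using hopos _ (hseg s hs)
          · exact Or.inl e)
        (fun s hs => hb _ (hseg s hs) t ht)
      rw [abs_div, abs_of_pos hδ, div_le_iff₀ hδ]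
      simpa using this
    · intro x hx hx0 t _
      set x' := update x i (x i + δ) with hx'
      have hx'0 : 0 < x' o := hopos _ (hboxpos x hx δ hδ.le hδρ)
      refine ⟨fun j => (D2 j x' t - D2 j x t) * δ⁻¹, fun j => ?_, ?_⟩
      · simp only [div_eq_mul_inv]
        refine HasD2.mul_const (HasD2.sub ?_ (P.hasD2 j x t hx0)) _
        have h2 := P.hasD2 j x' t hx'0
        by_cases hj : j = i
        · subst hj
          simp only [hx', update_idem, update_self] at h2 ⊢
          exact h2.comp_add_const
        · have e : x' j = x j := by rw [hx', update_of_ne hj]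
          rw [e] at h2
          refine h2.congr fun s => ?_
          rw [update_of_ne (Ne.symm hj), update_comm hj]
      · rw [← Finset.sum_mul, Finset.sum_sub_distrib]
        exact ((P.heat x' t hx'0).sub (P.heat x t hx0)).mul_const _
  have hD : ∀ x, 0 < x o →
      Tendsto (fun δ => (W (update x i (x i + δ)) t₀ - W x t₀) / δ) (𝓝[>] 0) (𝓝 (D i x t₀)) := by
    intro x hx
    have h := (P.hasD i x t₀ hx.le (Or.inr hx)).tendsto_slope_zero_right
    simpa [div_eq_inv_mul] using h
  have hinc : ∀ h, 0 ≤ h → h ≤ ρ →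
      |D i (update x₀ i (x₀ i + h)) t₀ - D i x₀ t₀| ≤ ((8 * n + 18) * S / ρ) * h := by
    intro h h0 h1
    have hx₀b : x₀ ∈ hbox o x₀ ρ := ⟨fun j => by simpa using hρ.le, by linarith⟩
    have t1 := hD (update x₀ i (x₀ i + h)) (hopos _ (hboxpos x₀ hx₀b h h0 h1))
    have t2 := hD x₀ (by linarith)
    simp only [update_idem, update_self] at t1
    refine le_of_tendsto (t1.sub t2).abs ?_
    filter_upwards [self_mem_nhdsWithin, mem_nhdsWithin_of_mem_nhds (Iio_mem_nhds hρ)] with δ h2 h3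
    exact hstep δ h2 (le_of_lt h3) h h0 h1
  have hdd := (P.hasDD i x₀ t₀ (by linarith)).hasDerivWithinAt (s := Ici (x₀ i))
  rw [abs_le]
  constructor
  · have := le_of_increment_le (K := (8 * n + 18) * S / ρ) hρ hdd.neg
      fun h h0 h1 => by
        have := (abs_le.1 (hinc h h0 h1)).1
        simp only [Pi.neg_apply, update_eq_self]
        linarith
    linarith
  · refine le_of_increment_le hρ hdd fun h h0 h1 => ?_
    have := (abs_le.1 (hinc h h0 h1)).2
    simpa only [update_eq_self] using this

end PSol

theorem rpow_sub_rpow_le {q S a b : ℝ} (hq : 1 < q) (ha : 0 < a) (hb : 0 < b) (haS : a ≤ S)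
    (hbS : b ≤ S) : |a ^ q - b ^ q| ≤ q * S ^ (q - 1) * |a - b| := by
  have hS : 0 < S := lt_of_lt_of_le ha haS
  have := (convex_Ioc 0 S).norm_image_sub_le_of_norm_hasDerivWithin_le
    (f := fun s : ℝ => s ^ q) (f' := fun s => q * s ^ (q - 1)) (C := q * S ^ (q - 1))
    (x := b) (y := a) (fun s hs => ?_) (fun s hs => ?_) ⟨hb, hbS⟩ ⟨ha, haS⟩
  · simpa using this
  · exact (Real.hasDerivAt_rpow_const (Or.inl hs.1.ne')).hasDerivWithinAt
  · rw [Real.norm_eq_abs, abs_of_nonneg (by have := hs.1; positivity)]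
    have := hs.1.le
    have := hs.2
    have : s ^ (q - 1) ≤ S ^ (q - 1) := by gcongr
    gcongr

namespace PSol
variable {n : ℕ} {o : Fin n} {q M : ℝ} {W : (Fin n → ℝ) → ℝ → ℝ}
  {D D2 : Fin n → (Fin n → ℝ) → ℝ → ℝ}

/-- Upper bound for the normal derivative. -/
theorem normal_le (P : PSol o q M W D D2) {x₀ : Fin n → ℝ} {t₀ ρ S : ℝ} (hρ : 0 < ρ)
    (hS : 0 < S) (hx₀ : 0 ≤ x₀ o)
    (hb : ∀ x ∈ hbox o x₀ ρ, ∀ t ∈ Icc (t₀ - ρ ^ 2) t₀, W x t ≤ S) :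
    D o x₀ t₀ ≤ (8 * n + 18) * S / ρ := by
  refine le_of_increment_le hρ (P.hasDright o x₀ t₀ hx₀) fun h h0 h1 => ?_
  have := box_increment_le o o (t₀ := t₀) (G := 0) (L := 0) (f := W) hρ hS le_rfl le_rfl hx₀
    (P.cont_hbox _ _ _) (fun x hx t ht => by
      rw [abs_of_pos (P.pos x t hx.2)]; exact hb x hx t ht) (P.heatOn _ _)
    (D o) (fun x _ hx t _ => P.hasDo x t hx)
    (fun _ x hx hx0 t _ => by
      rw [P.bc x t hx0]
      have := P.pos x t hx.2
      have : 0 ≤ W x t ^ q := by positivity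
      linarith)
    (fun h => (h rfl).elim) h0 h1
  simpa using this

theorem normal_ge (P : PSol o q M W D D2) (hq : 1 < q) {x₀ : Fin n → ℝ} {t₀ ρ S : ℝ} (hρ : 0 < ρ)
    (hS : 0 < S) (hx₀ : 0 ≤ x₀ o)
    (hb : ∀ x ∈ hbox o x₀ ρ, ∀ t ∈ Icc (t₀ - ρ ^ 2) t₀, W x t ≤ S) :
    -D o x₀ t₀ ≤ (8 * n + 18) * S / ρ + S ^ q := by
  refine le_of_increment_le hρ (P.hasDright o x₀ t₀ hx₀).neg fun h h0 h1 => ?_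
  have := box_increment_le o o (t₀ := t₀) (G := S ^ q) (L := 0) (f := fun x t => -W x t) hρ hS
    (by positivity) le_rfl hx₀
    (P.cont_hbox _ _ _).neg (fun x hx t ht => by
      rw [abs_neg, abs_of_pos (P.pos x t hx.2)]; exact hb x hx t ht) (P.heatOn _ _).neg
    (fun x t => -D o x t) (fun x _ hx t _ => (P.hasDo x t hx).neg)
    (fun _ x hx hx0 t ht => by
      rw [P.bc x t hx0, neg_neg]
      exact Real.rpow_le_rpow (P.pos x t hx.2).le (hb x hx t ht) (by linarith))
    (fun h => (h rfl).elim) h0 h1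
  simpa using this

theorem tangential_step (P : PSol o q M W D D2) (hq : 1 < q) {x₀ : Fin n → ℝ}
    {t₀ σ S Y : ℝ} {i : Fin n} (hi : i ≠ o) (hσ : 0 < σ) (hS : 0 < S) (hY : 0 ≤ Y)
    (hx₀ : 0 ≤ x₀ o) (hb : ∀ x ∈ hbox o x₀ σ, ∀ t, W x t ≤ S)
    (hD : ∀ x ∈ hbox o x₀ σ, ∀ t, |D i x t| ≤ Y) :
    |D i x₀ t₀| ≤ (8 * n + 18) * S / σ + 2 * (q * S ^ (q - 1) * Y) * σ := by
  have hflux : ∀ x ∈ hbox o x₀ σ, x o = 0 → ∀ t, ∀ y ≤ x i, update x i y ∈ hbox o x₀ σ →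
      |W x t ^ q - W (update x i y) t ^ q| ≤ (q * S ^ (q - 1) * Y) * (x i - y) := by
    intro x hx hx0 t y hy hy'
    have h1 := rpow_sub_rpow_le hq (P.pos x t hx.2) (P.pos _ t hy'.2) (hb x hx t) (hb _ hy' t)
    have h2 := P.mvt (i := i) (x := x) (t := t) (C := Y) (a := y) (b := x i) hy
      (fun s _ => by rw [update_of_ne hi.symm]; exact hx.2) (fun _ _ => Or.inl hi)
      (fun s hs => hD _ (by
        refine ⟨fun j => ?_, by rw [update_of_ne hi.symm]; exact hx.2⟩
        by_cases hj : j = i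
        · subst hj
          have h1 := abs_le.1 (hx.1 j)
          have h2 := abs_le.1 (hy'.1 j)
          simp only [update_self] at h2 ⊢
          rw [abs_le]; constructor <;> linarith [hs.1, hs.2]
        · rw [update_of_ne hj]; exact hx.1 j) t)
    rw [update_eq_self] at h2
    calc _ ≤ _ := h1
      _ ≤ q * S ^ (q - 1) * (Y * (x i - y)) := by gcongr
      _ = _ := by ring
  have hL : 0 ≤ q * S ^ (q - 1) * Y := by positivity
  rw [abs_le]
  constructor
  · rw [neg_le]
    refine le_of_increment_le hσ (P.hasDright i x₀ t₀ hx₀).neg fun h h0 h1 => ?_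
    have := box_increment_le o i (t₀ := t₀) (G := 0) (L := q * S ^ (q - 1) * Y)
      (f := fun x t => -W x t) hσ hS le_rfl hL hx₀
      (P.cont_hbox _ _ _).neg (fun x hx t ht => by
        rw [abs_neg, abs_of_pos (P.pos x t hx.2)]; exact hb x hx t) (P.heatOn _ _).neg
      (fun x t => -D o x t) (fun x _ hx t _ => (P.hasDo x t hx).neg)
      (fun h => (hi h).elim)
      (fun _ x hx hx0 t _ y hy hy' => by
        rw [P.bc x t hx0, P.bc _ t (by rw [update_of_ne hi.symm]; exact hx0)]
        have := abs_le.1 (hflux x hx hx0 t y hy hy')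
        linarith) h0 h1
    simpa using this
  · refine le_of_increment_le hσ (P.hasDright i x₀ t₀ hx₀) fun h h0 h1 => ?_
    have := box_increment_le o i (t₀ := t₀) (G := 0) (L := q * S ^ (q - 1) * Y)
      (f := W) hσ hS le_rfl hL hx₀
      (P.cont_hbox _ _ _) (fun x hx t ht => by
        rw [abs_of_pos (P.pos x t hx.2)]; exact hb x hx t) (P.heatOn _ _)
      (D o) (fun x _ hx t _ => P.hasDo x t hx)
      (fun h => (hi h).elim)
      (fun _ x hx hx0 t _ y hy hy' => by
        rw [P.bc x t hx0, P.bc _ t (by rw [update_of_ne hi.symm]; exact hx0)]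
        have := abs_le.1 (hflux x hx hx0 t y hy hy')
        linarith) h0 h1
    simpa using this

theorem tangential_grad (P : PSol o q M W D D2) (hq : 1 < q) {x₀ : Fin n → ℝ}
    {ρ S : ℝ} {i : Fin n} (hi : i ≠ o) (hρ : 0 < ρ) (hS : 0 < S)
    (hx₀ : 0 ≤ x₀ o) (hb : ∀ x ∈ hbox o x₀ ρ, ∀ t, W x t ≤ S) (t₀ : ℝ) :
    |D i x₀ t₀| ≤ 16 * q * (8 * n + 18) * (S / ρ + S ^ q) := by
  set A : Set ℝ := {y | ∃ x ∈ hbox o x₀ ρ, ∃ t, y = (ρ - ‖x - x₀‖) * |D i x t|} with hA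
  have hnorm : ∀ x ∈ hbox o x₀ ρ, ‖x - x₀‖ ≤ ρ := fun x hx =>
    (pi_norm_le_iff_of_nonneg hρ.le).2 fun j => by simpa using hx.1 j
  have hx₀m : x₀ ∈ hbox o x₀ ρ := ⟨fun j => by simpa using hρ.le, hx₀⟩
  have hM : 0 ≤ M := (abs_nonneg _).trans (P.D_le i x₀ t₀ hx₀)
  have hbdd : BddAbove A := by
    refine ⟨ρ * M, ?_⟩
    rintro _ ⟨x, hx, t, rfl⟩
    have := norm_nonneg (x - x₀)
    exact mul_le_mul (by linarith) (P.D_le i x t hx.2) (abs_nonneg _) hρ.le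
  have hmem : ρ * |D i x₀ t₀| ∈ A := ⟨x₀, hx₀m, t₀, by simp⟩
  set Y := sSup A with hY
  have hY0 : 0 ≤ Y := le_trans (by positivity) (le_csSup hbdd hmem)
  set K : ℝ := 8 * n + 18 with hK
  have hK0 : 0 < K := by positivity
  have hSq : S ^ (q - 1) * S = S ^ q := by
    rw [← Real.rpow_add_one hS.ne']; ring_nf
  have hSq0 : 0 < S ^ (q - 1) := by positivity
  have hstep : Y ≤ 8 * q * K * (S + ρ * S ^ q) + Y / 2 := by
    refine csSup_le ⟨_, hmem⟩ ?_
    rintro _ ⟨x, hx, t, rfl⟩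
    rcases (hnorm x hx).eq_or_lt with h | h
    · rw [h, sub_self, zero_mul]; positivity
    · set d := ρ - ‖x - x₀‖ with hd
      have hd0 : 0 < d := by linarith
      have hdρ : d ≤ ρ := by linarith [norm_nonneg (x - x₀)]
      set σ := (8 * q * (1 / d + S ^ (q - 1)))⁻¹ with hσ
      have hσ0 : 0 < σ := by positivity
      have hσd : σ ≤ d / 2 := by
        rw [hσ, inv_le_comm₀ (by positivity) (by positivity)]
        have h1 : 0 < 1 / d := by positivity
        have : (d / 2)⁻¹ = 2 * (1 / d) := by field_simp
        rw [this]; nlinarith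
      have hσS : 8 * q * S ^ (q - 1) * σ ≤ 1 := by
        rw [hσ, ← div_eq_mul_inv, div_le_one (by positivity)]
        have h1 : 0 < 1 / d := by positivity
        gcongr; linarith
      have hdσ : d * (S / σ) ≤ 8 * q * (S + ρ * S ^ q) := by
        have : d * (S / σ) = 8 * q * (S + d * (S ^ (q - 1) * S)) := by
          rw [hσ]; field_simp
        rw [this, hSq]; gcongr
      have hsub : ∀ z ∈ hbox o x σ, z ∈ hbox o x₀ ρ ∧ d / 2 ≤ ρ - ‖z - x₀‖ := by
        intro z hz
        have h1 : ‖z - x‖ ≤ σ := (pi_norm_le_iff_of_nonneg hσ0.le).2 fun j => by simpa using hz.1 j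
        have h2 : ‖z - x₀‖ ≤ ‖z - x‖ + ‖x - x₀‖ := norm_sub_le_norm_sub_add_norm_sub _ _ _
        refine ⟨⟨fun j => ?_, hz.2⟩, by linarith⟩
        have : ‖(z - x₀) j‖ ≤ ‖z - x₀‖ := norm_le_pi_norm _ _
        simp only [Pi.sub_apply, Real.norm_eq_abs] at this
        linarith
      have := P.tangential_step hq (t₀ := t) (Y := 2 * Y / d) hi hσ0 hS (by positivity) hx.2
        (fun z hz s => hb z (hsub z hz).1 s) (fun z hz s => by
          obtain ⟨h1, h2⟩ := hsub z hz
          have h3 : (ρ - ‖z - x₀‖) * |D i z s| ≤ Y := le_csSup hbdd ⟨z, h1, s, rfl⟩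
          rw [le_div_iff₀ hd0]
          nlinarith [abs_nonneg (D i z s)])
      calc d * |D i x t| ≤ d * (K * S / σ + 2 * (q * S ^ (q - 1) * (2 * Y / d)) * σ) := by gcongr
        _ = K * (d * (S / σ)) + (8 * q * S ^ (q - 1) * σ) * (Y / 2) := by field_simp; ring
        _ ≤ K * (8 * q * (S + ρ * S ^ q)) + 1 * (Y / 2) := by gcongr
        _ = _ := by ring
  have h1 : ρ * |D i x₀ t₀| ≤ Y := le_csSup hbdd hmem
  have h2 : ρ * |D i x₀ t₀| ≤ 16 * q * K * (S + ρ * S ^ q) := by linarith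
  have h3 : 16 * q * K * (S / ρ + S ^ q) = (16 * q * K * (S + ρ * S ^ q)) / ρ := by field_simp
  rw [h3, le_div_iff₀ hρ]
  linarith

/-- Local gradient estimate up to the boundary. -/
theorem local_grad (P : PSol o q M W D D2) (hq : 1 < q) {x₀ : Fin n → ℝ}
    {ρ S : ℝ} (hρ : 0 < ρ) (hS : 0 < S)
    (hx₀ : 0 ≤ x₀ o) (hb : ∀ x ∈ hbox o x₀ ρ, ∀ t, W x t ≤ S) (i : Fin n) (t₀ : ℝ) :
    |D i x₀ t₀| ≤ 16 * q * (8 * n + 18) * (S / ρ + S ^ q) := by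
  by_cases hi : i = o
  · subst hi
    have h1 := P.normal_le (t₀ := t₀) hρ hS hx₀ (fun x hx t _ => hb x hx t)
    have h2 := P.normal_ge (t₀ := t₀) hq hρ hS hx₀ (fun x hx t _ => hb x hx t)
    have h3 : 0 < S / ρ := by positivity
    have h4 : 0 < S ^ q := by positivity
    have hn : (0:ℝ) ≤ n := Nat.cast_nonneg n
    have h5 : (8 * (n:ℝ) + 18) * S / ρ = (8 * n + 18) * (S / ρ) := by ring
    have h6 : (8 * (n:ℝ) + 18) * (S / ρ) + S ^ q ≤ (8 * n + 18) * (S / ρ + S ^ q) := by nlinarith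
    have h7 : 1 * ((8 * (n:ℝ) + 18) * (S / ρ + S ^ q))
        ≤ 16 * q * ((8 * n + 18) * (S / ρ + S ^ q)) := by
      gcongr; linarith
    rw [abs_le]; constructor <;> linarith
  · exact P.tangential_grad hq hi hρ hS hx₀ hb t₀

end PSol

section Extraction
variable {n : ℕ} {hn : 0 < n}

theorem toLp_update (x : Fin n → ℝ) (j : Fin n) (s : ℝ) :
    WithLp.toLp 2 (update x j s)
      = WithLp.toLp 2 x + (s - x j) • EuclideanSpace.single j (1:ℝ) := by
  ext k
  by_cases h : k = j
  · subst h; simp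
  · simp [h]

theorem hasDerivAt_toLp_update (x : Fin n → ℝ) (j : Fin n) (s : ℝ) :
    HasDerivAt (fun s => WithLp.toLp 2 (update x j s)) (EuclideanSpace.single j (1:ℝ)) s := by
  simp only [toLp_update]
  have := (((hasDerivAt_id s).sub_const (x j)).smul_const
    (EuclideanSpace.single j (1:ℝ))).const_add (WithLp.toLp 2 x)
  simpa using this

theorem isOpen_openHalf : IsOpen (openHalf n hn) :=
  isOpen_lt continuous_const (by fun_prop)

theorem openHalf_subset : openHalf n hn ⊆ closedHalf n hn :=
  fun x (hx : 0 < x ⟨0, hn⟩) => (hx.le : 0 ≤ x ⟨0, hn⟩)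

theorem closedHalf_mem_nhds {x : EuclideanSpace ℝ (Fin n)} (hx : x ∈ openHalf n hn) :
    closedHalf n hn ∈ 𝓝 x :=
  mem_of_superset (isOpen_openHalf.mem_nhds hx) openHalf_subset

theorem IsHalfSpaceSol.pSol {q M : ℝ} {u : EuclideanSpace ℝ (Fin n) × ℝ → ℝ}
    (hsol : IsHalfSpaceSol n hn q u)
    (hbdd : ∀ x ∈ closedHalf n hn, ∀ t : ℝ, u (x, t) ≤ M ∧
      ‖fderivWithin ℝ (fun y => u (y, t)) (closedHalf n hn) x‖ ≤ M) :
    PSol ⟨0, hn⟩ q M (fun x t => u (WithLp.toLp 2 x, t))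
      (fun i x t => fderivWithin ℝ (fun y => u (y, t)) (closedHalf n hn) (WithLp.toLp 2 x)
        (EuclideanSpace.single i 1))
      (fun i x t => fderiv ℝ (fun y => fderiv ℝ (fun z => u (z, t)) y
        (EuclideanSpace.single i 1)) (WithLp.toLp 2 x) (EuclideanSpace.single i 1)) := by
  obtain ⟨h1, h2, h3, h4, h5, h6, h7, h8⟩ := hsol
  have hcl : ∀ x : Fin n → ℝ, 0 ≤ x ⟨0, hn⟩ → WithLp.toLp 2 x ∈ closedHalf n hn := fun x hx => hx
  have hop : ∀ x : Fin n → ℝ, 0 < x ⟨0, hn⟩ → WithLp.toLp 2 x ∈ openHalf n hn := fun x hx => hx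
  have hfd : ∀ t, ∀ x ∈ closedHalf n hn, HasFDerivWithinAt (fun y => u (y, t))
      (fderivWithin ℝ (fun y => u (y, t)) (closedHalf n hn) x) (closedHalf n hn) x := fun t x hx =>
    (((h2 t).differentiableOn one_ne_zero) x hx).hasFDerivWithinAt
  have hcurve : ∀ (j : Fin n) (x : Fin n → ℝ) t, 0 ≤ x ⟨0, hn⟩ →
      HasDerivWithinAt (fun s => u (WithLp.toLp 2 (update x j s), t))
        (fderivWithin ℝ (fun y => u (y, t)) (closedHalf n hn) (WithLp.toLp 2 x)
        (EuclideanSpace.single j 1)) {s | 0 ≤ update x j s ⟨0, hn⟩} (x j) := by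
    intro j x t hx
    have h := hfd t _ (hcl x hx)
    have e : WithLp.toLp 2 x = WithLp.toLp 2 (update x j (x j)) := by simp
    rw [e] at h
    have := h.comp_hasDerivWithinAt (x j) (s := {s | 0 ≤ update x j s ⟨0, hn⟩})
      (hasDerivAt_toLp_update x j (x j)).hasDerivWithinAt (fun s hs => hcl _ hs)
    rw [← e] at this
    exact this
  have hcd1 : ∀ t (i : Fin n), ContDiffOn ℝ 1 (fun y => fderiv ℝ (fun z => u (z, t)) y
      (EuclideanSpace.single i 1)) (openHalf n hn) := fun t i =>
    ((h4 t).fderiv_of_isOpen isOpen_openHalf (m := 1) (by norm_num)).clm_apply contDiffOn_const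
  refine ⟨?_, fun x t hx => h8 _ (hcl x hx) t, fun x t hx => (hbdd _ (hcl x hx) t).1, ?_, ?_, ?_,
    ?_, ?_, ?_, ?_, ?_, ?_⟩
  · refine h1.comp (f := fun p : (Fin n → ℝ) × ℝ => (WithLp.toLp 2 p.1, p.2)) ?_
      fun p hp => ⟨hcl _ hp, trivial⟩
    exact Continuous.continuousOn (by fun_prop)
  · intro j x t hx
    have := ContinuousLinearMap.le_opNorm
      (fderivWithin ℝ (fun y => u (y, t)) (closedHalf n hn) (WithLp.toLp 2 x))
      (EuclideanSpace.single j 1)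
    simp only [PiLp.norm_single, norm_one, mul_one] at this
    exact this.trans (hbdd _ (hcl x hx) t).2
  · intro j x t hx hj
    refine (hcurve j x t hx).hasDerivAt ?_
    rcases hj with hj | hx0
    · have : {s | 0 ≤ update x j s ⟨0, hn⟩} = univ := by
        ext s; simp only [mem_ofPred_eq, mem_univ, iff_true]; rwa [update_of_ne hj.symm]
      rw [this]; exact univ_mem
    · have e : Continuous fun s : ℝ => update x j s ⟨0, hn⟩ :=
        (continuous_apply (⟨0, hn⟩ : Fin n)).comp (continuous_update_right x j)
      filter_upwards [continuousAt_const.eventually_lt (x₀ := x j) (f := fun _ => (0:ℝ))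
        e.continuousAt (by simpa using hx0)] with s hs using le_of_lt hs
  · intro x t hx
    have := hcurve ⟨0, hn⟩ x t hx.ge
    simp only [update_self] at this
    rw [hx] at this
    exact this
  · intro x t hx
    have := h7 (WithLp.toLp 2 x) hx t
    simp only
    linarith
  · intro j t
    have := (h3 t).clm_apply (continuousOn_const (c := EuclideanSpace.single j (1:ℝ)))
    exact this.comp (f := fun x : Fin n → ℝ => WithLp.toLp 2 x)
      (Continuous.continuousOn (by fun_prop)) fun x hx => hcl x hx
  · intro j x t hx
    have hd := ((hcd1 t j).contDiffAt (isOpen_openHalf.mem_nhds (hop x hx))).differentiableAt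
      one_ne_zero |>.hasFDerivAt
    have e : WithLp.toLp 2 x = WithLp.toLp 2 (update x j (x j)) := by simp
    rw [e] at hd
    have := hd.comp_hasDerivAt (x j) (hasDerivAt_toLp_update x j (x j))
    rw [← e] at this
    refine this.congr_of_eventuallyEq ?_
    have e : Continuous fun s : ℝ => update x j s ⟨0, hn⟩ :=
        (continuous_apply (⟨0, hn⟩ : Fin n)).comp (continuous_update_right x j)
    filter_upwards [continuousAt_const.eventually_lt (x₀ := x j) (f := fun _ => (0:ℝ))
        e.continuousAt (by simpa using hx)] with s hs
    simp only [comp_apply]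
    rw [fderivWithin_of_mem_nhds (closedHalf_mem_nhds (hop _ hs))]
  · intro j t
    have := ((hcd1 t j).continuousOn_fderiv_of_isOpen isOpen_openHalf le_rfl).clm_apply
      (continuousOn_const (c := EuclideanSpace.single j (1:ℝ)))
    exact this.comp (f := fun x : Fin n → ℝ => WithLp.toLp 2 x)
      (Continuous.continuousOn (by fun_prop)) fun x hx => hop x hx
  · intro x t hx
    have := h6 _ (hop x hx) t
    rw [lap] at this
    rw [← this]
    exact ((h5 _ (hop x hx)).differentiable one_ne_zero t).hasDerivAt
  · intro x hx
    have := (h5 _ (hop x hx)).continuous_deriv le_rfl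
    refine this.congr fun t => ?_
    rw [h6 _ (hop x hx) t, lap]

end Extraction

namespace PSol
variable {n : ℕ} {o : Fin n} {q M : ℝ} {W : (Fin n → ℝ) → ℝ → ℝ}
  {D D2 : Fin n → (Fin n → ℝ) → ℝ → ℝ}

theorem M_pos (P : PSol o q M W D D2) : 0 < M :=
  (P.pos 0 0 le_rfl).trans_le (P.le 0 0 le_rfl)

theorem D2_le (P : PSol o q M W D D2) (i : Fin n) (x : Fin n → ℝ) (t : ℝ) (hx : 0 < x o) :
    |D2 i x t| ≤ 4 * (8 * n + 18) * M / x o := by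
  have := P.second_bound (x₀ := x) (t₀ := t) (ρ := x o / 4) (S := M) (by linarith) P.M_pos
    (by linarith) i (fun y hy s _ => P.D_le i y s (by
      have := abs_le.1 (hy o); linarith))
  refine this.trans (le_of_eq ?_)
  field_simp

/-- Continuity in time of the gradient at interior points. -/
theorem D_time_cont (P : PSol o q M W D D2) (i : Fin n) (x : Fin n → ℝ) (hx : 0 < x o) :
    Continuous (D i x) := by
  set C := 4 * (8 * n + 18) * M / x o with hC
  have hC0 : 0 < C := by have := P.M_pos; positivity
  have hpos : ∀ s, x i ≤ s → x o ≤ update x i s o := fun s hs => by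
    by_cases h : o = i
    · subst h; simpa using hs
    · rw [update_of_ne h]
  have happ : ∀ δ > 0, ∀ t, |(W (update x i (x i + δ)) t - W x t) / δ - D i x t| ≤ C * δ := by
    intro δ hδ t
    have hd : ∀ s, x i ≤ s →
        HasDerivAt (fun s => W (update x i s) t) (D i (update x i s) t) s := fun s hs => by
      have h0 : 0 < update x i s o := hx.trans_le (hpos s hs)
      simpa using P.hasD i (update x i s) t h0.le (Or.inr h0)
    have hdd : ∀ s, x i ≤ s →
        HasDerivAt (fun s => D i (update x i s) t) (D2 i (update x i s) t) s := fun s hs => by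
      have h0 : 0 < update x i s o := hx.trans_le (hpos s hs)
      simpa using P.hasDD i (update x i s) t h0
    obtain ⟨ξ, hξ, hξ'⟩ := exists_hasDerivAt_eq_slope (fun s => W (update x i s) t)
      (fun s => D i (update x i s) t) (show x i < x i + δ by linarith)
      (fun s hs => (hd s hs.1).continuousAt.continuousWithinAt) (fun s hs => hd s hs.1.le)
    simp only [update_eq_self, add_sub_cancel_left] at hξ'
    rw [← hξ']
    have := (convex_Icc (x i) ξ).norm_image_sub_le_of_norm_hasDerivWithin_le
      (f := fun s => D i (update x i s) t) (f' := fun s => D2 i (update x i s) t) (C := C)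
      (x := x i) (y := ξ) (fun s hs => (hdd s hs.1).hasDerivWithinAt)
      (fun s hs => by
        refine (P.D2_le i _ t (hx.trans_le (hpos s hs.1))).trans ?_
        have := hpos s hs.1
        have := P.M_pos
        rw [hC]; gcongr)
      ⟨le_rfl, hξ.1.le⟩ ⟨hξ.1.le, le_rfl⟩
    simp only [update_eq_self, Real.norm_eq_abs] at this
    refine this.trans ?_
    rw [abs_of_pos (by linarith [hξ.1])]
    gcongr; linarith [hξ.2]
  have hWc : ∀ y : Fin n → ℝ, 0 ≤ y o → Continuous (W y) := fun y hy => by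
    have := P.cont.comp_continuous (f := fun t : ℝ => (y, t)) (by fun_prop) fun t => hy
    exact this
  have hu : TendstoUniformly (fun (k : ℕ) t =>
      (W (update x i (x i + 1 / ((k:ℝ) + 1))) t - W x t) / (1 / ((k:ℝ) + 1))) (D i x) atTop := by
    rw [Metric.tendstoUniformly_iff]
    intro ε hε
    have h1 : Tendsto (fun k : ℕ => C * (1 / ((k:ℝ) + 1))) atTop (𝓝 0) := by
      simpa using tendsto_one_div_add_atTop_nhds_zero_nat.const_mul C
    filter_upwards [h1.eventually (gt_mem_nhds hε)] with k hk t
    rw [dist_comm, Real.dist_eq]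
    exact (happ _ (by positivity) t).trans_lt hk
  refine hu.continuous (Eventually.of_forall fun k => ?_).frequently
  have h0 : 0 ≤ update x i (x i + 1 / ((k:ℝ) + 1)) o :=
    hx.le.trans (hpos _ (by have : 0 < 1 / ((k:ℝ) + 1) := by positivity
                            linarith))
  exact ((hWc _ h0).sub (hWc x hx.le)).div_const _

/-- Scaling and time translation. -/
theorem scale (P : PSol o q M W D D2) (hq : 1 < q) {l : ℝ} (hl : 0 < l) (t₀ : ℝ) :
    PSol o q (max (l ^ (1 / (q - 1))) (l ^ (1 / (q - 1)) * l) * M)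
      (fun x t => l ^ (1 / (q - 1)) * W (fun j => l * x j) (t₀ + l ^ 2 * t))
      (fun i x t => l ^ (1 / (q - 1)) * l * D i (fun j => l * x j) (t₀ + l ^ 2 * t))
      (fun i x t => l ^ (1 / (q - 1)) * l ^ 2 * D2 i (fun j => l * x j) (t₀ + l ^ 2 * t)) := by
  set A := l ^ (1 / (q - 1)) with hA
  have hA0 : 0 < A := by positivity
  have hM := P.M_pos
  have hupd : ∀ (x : Fin n → ℝ) j s, (fun k => l * update x j s k)
      = update (fun k => l * x k) j (l * s) := fun x j s => by
    funext k
    by_cases h : k = j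
    · subst h; simp
    · simp [h]
  have hAq : A * l = A ^ q := by
    rw [hA, ← Real.rpow_mul hl.le, ← Real.rpow_add_one hl.ne']
    congr 1
    have : q - 1 ≠ 0 := by linarith
    field_simp; ring
  have hmul : ∀ s₀ : ℝ, HasDerivAt (fun s : ℝ => l * s) l s₀ := fun s₀ => by
    simpa using (hasDerivAt_id s₀).const_mul l
  refine ⟨?_, fun x t hx => mul_pos hA0 (P.pos _ _ (by positivity)), ?_, ?_, ?_, ?_, ?_, ?_, ?_,
    ?_, ?_, ?_⟩
  · refine continuousOn_const.mul (P.cont.comp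
      (f := fun p : (Fin n → ℝ) × ℝ => (fun j => l * p.1 j, t₀ + l ^ 2 * p.2)) ?_ ?_)
    · exact Continuous.continuousOn (by fun_prop)
    · intro p hp
      have hp : 0 ≤ p.1 o := hp
      exact mul_nonneg hl.le hp
  · intro x t hx
    exact mul_le_mul (le_max_left _ _) (P.le _ _ (by positivity)) (P.pos _ _ (by positivity)).le
      (by positivity)
  · intro j x t hx
    rw [abs_mul, abs_of_pos (by positivity)]
    exact mul_le_mul (le_max_right _ _) (P.D_le _ _ _ (by positivity)) (abs_nonneg _)
      (by positivity)
  · intro j x t hx hj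
    have h := P.hasD j (fun k => l * x k) (t₀ + l ^ 2 * t) (by positivity)
      (hj.imp id fun h => by positivity)
    have h2 := (h.comp (x j) (hmul (x j))).const_mul A
    simp only [hupd]
    exact h2.congr_deriv (by ring)
  · intro x t hx
    have h := P.hasDo (fun k => l * x k) (t₀ + l ^ 2 * t) (by simp [hx])
    have e : (0:ℝ) = l * 0 := by simp
    rw [e] at h
    have h2 := (h.comp 0 (hmul 0).hasDerivWithinAt (s := Ici 0) (fun s hs => by
      have hs : 0 ≤ s := hs
      simpa using mul_nonneg hl.le hs)).const_mul A
    simp only [hupd]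
    exact h2.congr_deriv (by ring)
  · intro x t hx
    rw [P.bc _ _ (by simp [hx]), hAq, Real.mul_rpow hA0.le (P.pos _ _ (by simp [hx])).le]
    ring
  · intro j t
    refine continuousOn_const.mul ((P.D_cont j _).comp
      (f := fun x : Fin n → ℝ => (fun j => l * x j)) ?_ ?_)
    · exact Continuous.continuousOn (by fun_prop)
    · intro x hx
      have hx : 0 ≤ x o := hx
      exact mul_nonneg hl.le hx
  · intro j x t hx
    have h := P.hasDD j (fun k => l * x k) (t₀ + l ^ 2 * t) (by positivity)
    have h2 := (h.comp (x j) (hmul (x j))).const_mul (A * l)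
    simp only [hupd]
    exact h2.congr_deriv (by ring)
  · intro j t
    refine continuousOn_const.mul ((P.D2_cont j _).comp
      (f := fun x : Fin n → ℝ => (fun j => l * x j)) ?_ ?_)
    · exact Continuous.continuousOn (by fun_prop)
    · intro x hx
      have hx : 0 < x o := hx
      exact mul_pos hl hx
  · intro x t hx
    have h := P.heat (fun k => l * x k) (t₀ + l ^ 2 * t) (by positivity)
    have ht : HasDerivAt (fun s : ℝ => t₀ + l ^ 2 * s) (l ^ 2) t := by
      simpa using ((hasDerivAt_id t).const_mul (l ^ 2)).const_add t₀
    have h2 := (h.comp t ht).const_mul A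
    refine h2.congr_deriv ?_
    rw [← Finset.mul_sum]; ring
  · intro x hx
    have h := P.heat_cont (fun k => l * x k) (by positivity)
    have h2 : Continuous fun t => A * l ^ 2 * ∑ j, D2 j (fun k => l * x k) (t₀ + l ^ 2 * t) :=
      continuous_const.mul (h.comp (by fun_prop))
    refine h2.congr fun t => ?_
    rw [← Finset.mul_sum]

end PSol

section rect
open MeasureTheory
variable {L r₁ r₂ : ℝ}

theorem integrableOn_of_continuousOn_bounded {α : Type*} [TopologicalSpace α] [MeasurableSpace α]
    [OpensMeasurableSpace α] [SecondCountableTopology α] {μ : Measure α} {s : Set α}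
    (hs : MeasurableSet s)
    (hμ : μ s ≠ ⊤) {f : α → ℝ} (hf : ContinuousOn f s) {N : ℝ} (hN : ∀ x ∈ s, |f x| ≤ N) :
    IntegrableOn f s μ :=
  have : Fact (μ s < ⊤) := ⟨hμ.lt_top⟩
  Integrable.of_bound (hf.aestronglyMeasurable hs) N ((ae_restrict_iff' hs).2 (ae_of_all _ hN))

theorem measurableSet_rect : MeasurableSet (Ioc 0 L ×ˢ Icc r₁ r₂ : Set (ℝ × ℝ)) :=
  measurableSet_Ioc.prod measurableSet_Icc

theorem volume_rect_ne_top : volume (Ioc 0 L ×ˢ Icc r₁ r₂ : Set (ℝ × ℝ)) ≠ ⊤ := by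
  rw [Measure.volume_eq_prod, Measure.prod_prod]
  exact (ENNReal.mul_lt_top measure_Ioc_lt_top measure_Icc_lt_top).ne

/-- The divergence theorem on `(0, L] × [r₁, r₂]` for a field that vanishes on three sides
and has a limit on the fourth one. -/
theorem divergence_rect (hL : 0 < L) (hr : r₁ ≤ r₂) {P Pa Q Qr : ℝ → ℝ → ℝ} {P0 : ℝ → ℝ} {N : ℝ}
    (hP : ∀ a > 0, ∀ r ∈ Icc r₁ r₂, HasDerivAt (fun s => P s r) (Pa a r) a)
    (hQ : ∀ a > 0, ∀ r ∈ Icc r₁ r₂, HasDerivAt (fun s => Q a s) (Qr a r) r)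
    (cP : ContinuousOn (fun z : ℝ × ℝ => P z.1 z.2) (Ioi 0 ×ˢ Icc r₁ r₂))
    (cPa : ContinuousOn (fun z : ℝ × ℝ => Pa z.1 z.2) (Ioi 0 ×ˢ Icc r₁ r₂))
    (cQr : ContinuousOn (fun z : ℝ × ℝ => Qr z.1 z.2) (Ioi 0 ×ˢ Icc r₁ r₂))
    (bF : ∀ a ∈ Ioc 0 L, ∀ r ∈ Icc r₁ r₂, |Pa a r + Qr a r| ≤ N)
    (bP : ∀ a ∈ Ioc 0 L, ∀ r ∈ Icc r₁ r₂, |P a r| ≤ N)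
    (hPL : ∀ r ∈ Icc r₁ r₂, P L r = 0)
    (hQ1 : ∀ a > 0, Q a r₁ = 0) (hQ2 : ∀ a > 0, Q a r₂ = 0)
    (hP0 : ∀ r ∈ Icc r₁ r₂, Tendsto (fun a => P a r) (𝓝[>] 0) (𝓝 (P0 r))) :
    ∫ z in Ioc 0 L ×ˢ Icc r₁ r₂, (Pa z.1 z.2 + Qr z.1 z.2) = -∫ r in Icc r₁ r₂, P0 r := by
  have hsub : (Ioc 0 L ×ˢ Icc r₁ r₂ : Set (ℝ × ℝ)) ⊆ Ioi 0 ×ˢ Icc r₁ r₂ :=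
    prod_mono Ioc_subset_Ioi_self Subset.rfl
  have hF : IntegrableOn (fun z : ℝ × ℝ => Pa z.1 z.2 + Qr z.1 z.2)
      (Ioc 0 L ×ˢ Icc r₁ r₂) :=
    integrableOn_of_continuousOn_bounded measurableSet_rect volume_rect_ne_top
      ((cPa.add cQr).mono hsub) fun z hz => bF z.1 hz.1 z.2 hz.2
  have hε : ∀ ε, 0 < ε → ε < L →
      ∫ z in Ioc ε L ×ˢ Icc r₁ r₂, (Pa z.1 z.2 + Qr z.1 z.2) = -∫ r in Icc r₁ r₂, P ε r := by
    intro ε h0 h1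
    have hs : (Icc ε L ×ˢ Icc r₁ r₂ : Set (ℝ × ℝ)) ⊆ Ioi 0 ×ˢ Icc r₁ r₂ :=
      prod_mono (fun x hx => h0.trans_le hx.1) Subset.rfl
    have hs' : (Ioc ε L ×ˢ Icc r₁ r₂ : Set (ℝ × ℝ)) ⊆ Icc ε L ×ˢ Icc r₁ r₂ :=
      prod_mono Ioc_subset_Icc_self Subset.rfl
    have hc : IsCompact (Icc ε L ×ˢ Icc r₁ r₂ : Set (ℝ × ℝ)) := isCompact_Icc.prod isCompact_Icc
    have iPa : IntegrableOn (fun z : ℝ × ℝ => Pa z.1 z.2) (Ioc ε L ×ˢ Icc r₁ r₂) :=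
      ((cPa.mono hs).integrableOn_compact hc).mono_set hs'
    have iQr : IntegrableOn (fun z : ℝ × ℝ => Qr z.1 z.2) (Ioc ε L ×ˢ Icc r₁ r₂) :=
      ((cQr.mono hs).integrableOn_compact hc).mono_set hs'
    rw [integral_add iPa iQr]
    have e2 : ∫ z in Ioc ε L ×ˢ Icc r₁ r₂, Qr z.1 z.2 = 0 := by
      rw [Measure.volume_eq_prod] at iQr ⊢
      rw [setIntegral_prod _ iQr]
      refine setIntegral_eq_zero_of_forall_eq_zero fun a ha => ?_
      have ha0 : 0 < a := h0.trans ha.1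
      rw [integral_Icc_eq_integral_Ioc, ← intervalIntegral.integral_of_le hr,
        intervalIntegral.integral_eq_sub_of_hasDerivAt (f := fun s => Q a s)
          (fun r hr' => hQ a ha0 r (by rwa [uIcc_of_le hr] at hr')),
        hQ1 a ha0, hQ2 a ha0, sub_zero]
      refine ContinuousOn.intervalIntegrable_of_Icc hr ?_
      exact cQr.comp (f := fun r : ℝ => (a, r)) (by fun_prop) fun r hr' => ⟨ha0, hr'⟩
    have e1 : ∫ z in Ioc ε L ×ˢ Icc r₁ r₂, Pa z.1 z.2 = -∫ r in Icc r₁ r₂, P ε r := by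
      rw [Measure.volume_eq_prod] at iPa ⊢
      rw [← setIntegral_prod_swap, setIntegral_prod (fun z => Pa z.swap.1 z.swap.2) iPa.swap,
        ← integral_neg]
      refine setIntegral_congr_fun measurableSet_Icc fun r hr' => ?_
      simp only [Prod.swap_prod_mk]
      rw [← intervalIntegral.integral_of_le h1.le,
        intervalIntegral.integral_eq_sub_of_hasDerivAt (f := fun s => P s r)
          (fun a ha => hP a (by rw [uIcc_of_le h1.le] at ha; exact h0.trans_le ha.1) r hr'),
        hPL r hr', zero_sub]
      refine ContinuousOn.intervalIntegrable_of_Icc h1.le ?_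
      exact cPa.comp (f := fun a : ℝ => (a, r)) (by fun_prop)
        fun a ha => ⟨h0.trans_le ha.1, hr'⟩
    rw [e1, e2, add_zero]
  set ε : ℕ → ℝ := fun k => L / ((k:ℝ) + 2) with hεdef
  have hε0 : ∀ k, 0 < ε k := fun k => by positivity
  have hε1 : ∀ k, ε k < L := fun k => by
    rw [hεdef]; simp only; rw [div_lt_iff₀ (by positivity)]; nlinarith [(k.cast_nonneg : (0:ℝ) ≤ k)]
  have hεt : Tendsto ε atTop (𝓝 0) := by
    have : Tendsto (fun k : ℕ => (k:ℝ) + 2) atTop atTop :=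
      tendsto_atTop_add_const_right _ _ tendsto_natCast_atTop_atTop
    exact this.const_div_atTop L
  have hεa : Antitone ε := fun i j hij => by
    simp only [hεdef]; gcongr
  have hU : ⋃ k, Ioc (ε k) L ×ˢ Icc r₁ r₂ = (Ioc 0 L ×ˢ Icc r₁ r₂ : Set (ℝ × ℝ)) := by
    ext ⟨a, r⟩
    simp only [mem_iUnion, mem_prod, mem_Ioc]
    constructor
    · rintro ⟨k, h, h'⟩; exact ⟨⟨(hε0 k).trans h.1, h.2⟩, h'⟩
    · rintro ⟨h, h'⟩
      obtain ⟨k, hk⟩ := (hεt.eventually (gt_mem_nhds h.1)).exists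
      exact ⟨k, ⟨hk, h.2⟩, h'⟩
  have t1 : Tendsto (fun k => ∫ z in Ioc (ε k) L ×ˢ Icc r₁ r₂, (Pa z.1 z.2 + Qr z.1 z.2)) atTop
      (𝓝 (∫ z in Ioc 0 L ×ˢ Icc r₁ r₂, (Pa z.1 z.2 + Qr z.1 z.2))) := by
    rw [← hU]
    refine tendsto_setIntegral_of_monotone
      (fun k => measurableSet_Ioc.prod measurableSet_Icc) (fun i j hij => ?_) (by rwa [hU])
    exact prod_mono (Ioc_subset_Ioc_left (hεa hij)) Subset.rfl
  have t2 : Tendsto (fun k => -∫ r in Icc r₁ r₂, P (ε k) r) atTop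
      (𝓝 (-∫ r in Icc r₁ r₂, P0 r)) := by
    refine (tendsto_integral_of_dominated_convergence (fun _ => N) (fun k => ?_) ?_ ?_ ?_).neg
    · refine ContinuousOn.aestronglyMeasurable ?_ measurableSet_Icc
      exact cP.comp (f := fun r : ℝ => (ε k, r)) (by fun_prop) fun r hr' => ⟨hε0 k, hr'⟩
    · exact integrableOn_const (by exact measure_Icc_lt_top.ne)
    · exact fun k => (ae_restrict_iff' measurableSet_Icc).2
        (ae_of_all _ fun r hr' => bP _ ⟨hε0 k, (hε1 k).le⟩ r hr')
    · refine (ae_restrict_iff' measurableSet_Icc).2 (ae_of_all _ fun r hr' => ?_)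
      exact (hP0 r hr').comp (tendsto_nhdsWithin_iff.2 ⟨hεt, Eventually.of_forall hε0⟩)
  refine tendsto_nhds_unique t1 (t2.congr fun k => (hε _ (hε0 k) (hε1 k)).symm)

end rect

section steklov
open MeasureTheory

/-- The Steklov average of `f` over `[t, t + h]`. -/
noncomputable def stek (h : ℝ) (f : ℝ → ℝ) (t : ℝ) : ℝ := h⁻¹ * ∫ s in t..t + h, f s

variable {h : ℝ}

theorem intervalIntegrable_of_bounded {f : ℝ → ℝ} (hf : Measurable f) {C : ℝ}
    (hC : ∀ s, |f s| ≤ C) (a b : ℝ) : IntervalIntegrable f volume a b := by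
  refine (intervalIntegrable_const (c := C)).mono_fun hf.aestronglyMeasurable
    (ae_of_all _ fun s => ?_)
  simpa only [Real.norm_eq_abs] using (hC s).trans (le_abs_self C)

theorem stek_hasDerivAt (h : ℝ) {f : ℝ → ℝ} (hf : Continuous f) (t : ℝ) :
    HasDerivAt (stek h f) ((f (t + h) - f t) / h) t := by
  have h1 : HasDerivAt (fun t => (∫ s in (0:ℝ)..t + h, f s) - ∫ s in (0:ℝ)..t, f s)
      (f (t + h) - f t) t := by
    refine HasDerivAt.sub ?_ (hf.integral_hasStrictDerivAt 0 t).hasDerivAt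
    have := (hf.integral_hasStrictDerivAt 0 (t + h)).hasDerivAt.comp t
      ((hasDerivAt_id t).add_const h)
    rw [mul_one] at this
    exact this
  have h2 : stek h f = fun t => h⁻¹ * ((∫ s in (0:ℝ)..t + h, f s) - ∫ s in (0:ℝ)..t, f s) := by
    funext t
    rw [stek, intervalIntegral.integral_interval_sub_left (hf.intervalIntegrable _ _)
      (hf.intervalIntegrable _ _)]
  rw [h2, div_eq_inv_mul]
  exact h1.const_mul _

theorem stek_const (hh : 0 < h) (c t : ℝ) : stek h (fun _ => c) t = c := by
  simp [stek, hh.ne']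

theorem stek_mono (hh : 0 < h) {f g : ℝ → ℝ} {t : ℝ}
    (hf : IntervalIntegrable f volume t (t + h)) (hg : IntervalIntegrable g volume t (t + h))
    (hfg : ∀ s ∈ Icc t (t + h), f s ≤ g s) : stek h f t ≤ stek h g t := by
  unfold stek
  gcongr
  exact intervalIntegral.integral_mono_on (by linarith) hf hg hfg

theorem abs_stek_le (hh : 0 < h) {f : ℝ → ℝ} {t C : ℝ} (hf : ∀ s, |f s| ≤ C) :
    |stek h f t| ≤ C := by
  rw [stek, abs_mul, abs_of_pos (inv_pos.2 hh), inv_mul_le_iff₀ hh, mul_comm]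
  have := intervalIntegral.norm_integral_le_of_norm_le_const (a := t) (b := t + h) (f := f)
    (C := C) fun s _ => hf s
  simpa [abs_of_pos hh] using this

theorem stek_pos (hh : 0 < h) {f : ℝ → ℝ} (hf : Continuous f) (h0 : ∀ s, 0 < f s) (t : ℝ) :
    0 < stek h f t :=
  mul_pos (inv_pos.2 hh) (intervalIntegral.intervalIntegral_pos_of_pos
    (hf.intervalIntegrable _ _) h0 (by linarith))

theorem stek_add {f g : ℝ → ℝ} {t : ℝ}
    (hf : IntervalIntegrable f volume t (t + h)) (hg : IntervalIntegrable g volume t (t + h)) :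
    stek h (fun s => f s + g s) t = stek h f t + stek h g t := by
  rw [stek, intervalIntegral.integral_add hf hg, mul_add, stek, stek]

theorem stek_const_mul (c : ℝ) (f : ℝ → ℝ) (t : ℝ) :
    stek h (fun s => c * f s) t = c * stek h f t := by
  rw [stek, intervalIntegral.integral_const_mul, stek]; ring

theorem measurable_of_hasDerivAt_param {f : ℝ → ℝ → ℝ} {f' : ℝ → ℝ} {x₀ δ : ℝ} (hδ : 0 < δ)
    (hc : ∀ x ∈ Ico x₀ (x₀ + δ), Measurable (f x))
    (hd : ∀ s, HasDerivAt (fun x => f x s) (f' s) x₀) : Measurable f' := by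
  have hε : Tendsto (fun k : ℕ => δ / ((k:ℝ) + 2)) atTop (𝓝[≠] 0) := by
    have : Tendsto (fun k : ℕ => (k:ℝ) + 2) atTop atTop :=
      tendsto_atTop_add_const_right _ _ tendsto_natCast_atTop_atTop
    exact tendsto_nhdsWithin_iff.2 ⟨this.const_div_atTop δ,
      Eventually.of_forall fun k => (by positivity : (0:ℝ) < δ / (k + 2)).ne'⟩
  refine measurable_of_tendsto_metrizable (f := fun (k : ℕ) s =>
    (δ / ((k:ℝ) + 2))⁻¹ • (f (x₀ + δ / ((k:ℝ) + 2)) s - f x₀ s)) (fun k => ?_)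
    (tendsto_pi_nhds.2 fun s => (hd s).tendsto_slope_zero.comp hε)
  have : δ / ((k:ℝ) + 2) < δ := by
    rw [div_lt_iff₀ (by positivity)]; nlinarith [(k.cast_nonneg : (0:ℝ) ≤ k)]
  have h1 := hc (x₀ + δ / ((k:ℝ) + 2)) ⟨le_add_of_nonneg_right (by positivity), by linarith⟩
  exact (h1.sub (hc x₀ ⟨le_rfl, by linarith⟩)).const_mul (δ / ((k:ℝ) + 2))⁻¹

theorem stek_hasDerivAt_param {f f' : ℝ → ℝ → ℝ} {x₀ δ C t : ℝ} (hδ : 0 < δ)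
    (hc : ∀ x ∈ Ioo (x₀ - δ) (x₀ + δ), Continuous (f x))
    (hd : ∀ x ∈ Ioo (x₀ - δ) (x₀ + δ), ∀ s, HasDerivAt (fun x => f x s) (f' x s) x)
    (hC : ∀ x ∈ Ioo (x₀ - δ) (x₀ + δ), ∀ s, |f' x s| ≤ C) :
    HasDerivAt (fun x => stek h (f x) t) (stek h (f' x₀) t) x₀ := by
  have hx₀ : x₀ ∈ Ioo (x₀ - δ) (x₀ + δ) := ⟨by linarith, by linarith⟩
  have hm : Measurable (f' x₀) := measurable_of_hasDerivAt_param hδ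
    (fun x hx => (hc x ⟨by linarith [hx.1], hx.2⟩).measurable) fun s => hd x₀ hx₀ s
  refine HasDerivAt.const_mul _ (intervalIntegral.hasDerivAt_integral_of_dominated_loc_of_deriv_le
    (s := Ioo (x₀ - δ) (x₀ + δ)) (bound := fun _ => C) (Ioo_mem_nhds hx₀.1 hx₀.2) ?_
    ((hc x₀ hx₀).intervalIntegrable _ _) hm.aestronglyMeasurable
    (ae_of_all _ fun s _ x hx => hC x hx s) intervalIntegrable_const
    (ae_of_all _ fun s _ x hx => hd x hx s)).2
  filter_upwards [Ioo_mem_nhds hx₀.1 hx₀.2] with x hx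
  exact (hc x hx).aestronglyMeasurable

theorem stek_continuousOn {α : Type*} [TopologicalSpace α] [FirstCountableTopology α]
    {F : α → ℝ → ℝ} {Q : Set α} {t : ℝ}
    (hc : ∀ s, ContinuousOn (fun z => F z s) Q) (hm : ∀ z ∈ Q, Measurable (F z))
    (hb : ∀ z ∈ Q, ∃ C, ∀ᶠ z' in 𝓝[Q] z, ∀ s, |F z' s| ≤ C) :
    ContinuousOn (fun z => stek h (F z) t) Q := by
  intro z hz
  obtain ⟨C, hC⟩ := hb z hz
  refine ContinuousWithinAt.mul continuousWithinAt_const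
    (intervalIntegral.continuousWithinAt_of_dominated_interval (bound := fun _ => C) ?_ ?_
      intervalIntegrable_const (ae_of_all _ fun s _ => hc s z hz))
  · filter_upwards [self_mem_nhdsWithin] with x hx
    exact (hm x hx).aestronglyMeasurable
  · filter_upwards [hC] with x hx
    exact ae_of_all _ fun s _ => hx s

theorem stek_tendsto {ι : Type*} {l : Filter ι} [l.IsCountablyGenerated] {F : ι → ℝ → ℝ}
    {f : ℝ → ℝ} {t C : ℝ} (hm : ∀ᶠ i in l, Measurable (F i)) (hb : ∀ᶠ i in l, ∀ s, |F i s| ≤ C)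
    (hf : ∀ s, Tendsto (fun i => F i s) l (𝓝 (f s))) :
    Tendsto (fun i => stek h (F i) t) l (𝓝 (stek h f t)) := by
  refine Tendsto.const_mul _ (intervalIntegral.tendsto_integral_filter_of_dominated_convergence
    (fun _ => C) ?_ ?_ intervalIntegrable_const (ae_of_all _ fun s _ => hf s))
  · filter_upwards [hm] with i hi using hi.aestronglyMeasurable
  · filter_upwards [hb] with i hi using ae_of_all _ fun s _ => hi s

theorem stek_continuous {α : Type*} [TopologicalSpace α] {F : α → ℝ → ℝ}
    (hF : Continuous fun z : α × ℝ => F z.1 z.2) :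
    Continuous fun z : α × ℝ => stek h (F z.1) z.2 := by
  have h1 : ∀ c : ℝ, Continuous fun z : α × ℝ => ∫ s in (0:ℝ)..z.2 + c, F z.1 s := fun c =>
    intervalIntegral.continuous_parametric_intervalIntegral_of_continuous
      (f := fun (z : α × ℝ) s => F z.1 s) (by fun_prop) (by fun_prop)
  have h2 : (fun z : α × ℝ => stek h (F z.1) z.2) = fun z : α × ℝ =>
      h⁻¹ * ((∫ s in (0:ℝ)..z.2 + h, F z.1 s) - ∫ s in (0:ℝ)..z.2 + 0, F z.1 s) := by
    funext z
    have hc : Continuous (F z.1) := by fun_prop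
    rw [stek, add_zero, intervalIntegral.integral_interval_sub_left (hc.intervalIntegrable _ _)
      (hc.intervalIntegrable _ _)]
  rw [h2]
  exact continuous_const.mul ((h1 h).sub (h1 0))

end steklov

theorem rpow_tangent_le {q x y : ℝ} (hq : 1 ≤ q) (hx : 0 ≤ x) (hy : 0 < y) :
    y ^ q + q * y ^ (q - 1) * (x - y) ≤ x ^ q := by
  have h := one_add_mul_self_le_rpow_one_add (s := x / y - 1) (by
    have : 0 ≤ x / y := by positivity
    linarith) hq
  rw [add_sub_cancel, Real.div_rpow hx hy.le, le_div_iff₀ (by positivity)] at h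
  refine le_trans (le_of_eq ?_) h
  rw [Real.rpow_sub_one hy.ne']
  field_simp

theorem young_rpow {q l x : ℝ} (hq : 1 < q) (hl : 0 ≤ l) (hx : 0 ≤ x) :
    l * x ≤ 1 / 2 * x ^ q + l * (2 * l) ^ (1 / (q - 1)) := by
  have hq1 : 0 < q - 1 := by linarith
  by_cases h : x ≤ (2 * l) ^ (1 / (q - 1))
  · have := mul_le_mul_of_nonneg_left h hl
    have : 0 ≤ x ^ q := by positivity
    linarith
  · push Not at h
    have hx0 : 0 < x := lt_of_le_of_lt (by positivity) h
    have h1 : 2 * l ≤ x ^ (q - 1) := by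
      have := Real.rpow_le_rpow (by positivity) h.le hq1.le
      rwa [← Real.rpow_mul (by positivity), one_div_mul_cancel hq1.ne', Real.rpow_one] at this
    have h2 : x ^ q = x ^ (q - 1) * x := by
      rw [Real.rpow_sub_one hx0.ne']; field_simp
    have : 0 ≤ l * (2 * l) ^ (1 / (q - 1)) := by positivity
    nlinarith

section bddContOn
open MeasureTheory
variable {α : Type*} [TopologicalSpace α] {s : Set α} {f g : α → ℝ}

/-- Bounded continuous real functions on a set. -/
def BddContOn (f : α → ℝ) (s : Set α) : Prop :=
  ContinuousOn f s ∧ ∃ C, ∀ x ∈ s, |f x| ≤ C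

namespace BddContOn

theorem of_bound (hf : ContinuousOn f s) {C : ℝ} (hC : ∀ x ∈ s, |f x| ≤ C) : BddContOn f s :=
  ⟨hf, C, hC⟩

theorem const (c : ℝ) : BddContOn (fun _ => c) s := ⟨continuousOn_const, |c|, fun _ _ => le_rfl⟩

theorem add (hf : BddContOn f s) (hg : BddContOn g s) : BddContOn (fun x => f x + g x) s := by
  obtain ⟨hf, C, hC⟩ := hf
  obtain ⟨hg, C', hC'⟩ := hg
  exact ⟨hf.add hg, C + C', fun x hx => (abs_add_le _ _).trans (add_le_add (hC x hx) (hC' x hx))⟩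

theorem mul (hf : BddContOn f s) (hg : BddContOn g s) : BddContOn (fun x => f x * g x) s := by
  obtain ⟨hf, C, hC⟩ := hf
  obtain ⟨hg, C', hC'⟩ := hg
  refine ⟨hf.mul hg, C * C', fun x hx => ?_⟩
  rw [abs_mul]
  exact mul_le_mul (hC x hx) (hC' x hx) (abs_nonneg _) ((abs_nonneg _).trans (hC x hx))

theorem neg (hf : BddContOn f s) : BddContOn (fun x => -f x) s := by
  simpa using (const (-1)).mul hf

theorem sub (hf : BddContOn f s) (hg : BddContOn g s) : BddContOn (fun x => f x - g x) s := by
  simpa [sub_eq_add_neg] using hf.add hg.neg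

theorem const_mul (c : ℝ) (hf : BddContOn f s) : BddContOn (fun x => c * f x) s :=
  (const c).mul hf

theorem pow (hf : BddContOn f s) (m : ℕ) : BddContOn (fun x => f x ^ m) s := by
  obtain ⟨hf, C, hC⟩ := hf
  refine ⟨hf.pow m, C ^ m, fun x hx => ?_⟩
  rw [abs_pow]
  exact pow_le_pow_left₀ (abs_nonneg _) (hC x hx) m

variable [MeasurableSpace α] [OpensMeasurableSpace α] [SecondCountableTopology α]
  {μ : Measure α}

theorem integrableOn (hf : BddContOn f s) (hs : MeasurableSet s) (hμ : μ s ≠ ⊤) :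
    IntegrableOn f s μ := by
  obtain ⟨hf, C, hC⟩ := hf
  exact integrableOn_of_continuousOn_bounded hs hμ hf hC

theorem integral_mono (hf : BddContOn f s) (hg : BddContOn g s) (hs : MeasurableSet s)
    (hμ : μ s ≠ ⊤) (h : ∀ x ∈ s, f x ≤ g x) : ∫ x in s, f x ∂μ ≤ ∫ x in s, g x ∂μ :=
  setIntegral_mono_on (hf.integrableOn hs hμ) (hg.integrableOn hs hμ) hs h

theorem integral_add (hf : BddContOn f s) (hg : BddContOn g s) (hs : MeasurableSet s)
    (hμ : μ s ≠ ⊤) : ∫ x in s, (f x + g x) ∂μ = ∫ x in s, f x ∂μ + ∫ x in s, g x ∂μ :=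
  MeasureTheory.integral_add (hf.integrableOn hs hμ) (hg.integrableOn hs hμ)

theorem integral_sub (hf : BddContOn f s) (hg : BddContOn g s) (hs : MeasurableSet s)
    (hμ : μ s ≠ ⊤) : ∫ x in s, (f x - g x) ∂μ = ∫ x in s, f x ∂μ - ∫ x in s, g x ∂μ :=
  MeasureTheory.integral_sub (hf.integrableOn hs hμ) (hg.integrableOn hs hμ)

end BddContOn

theorem hasDerivAt_setIntegral [MeasurableSpace α] [OpensMeasurableSpace α]
    [SecondCountableTopology α] {μ : Measure α} (hs : MeasurableSet s) (hμ : μ s ≠ ⊤)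
    {F F' : ℝ → α → ℝ} {C : ℝ} (hF : ∀ t, BddContOn (F t) s) (hF' : ∀ t, BddContOn (F' t) s)
    (hC : ∀ t, ∀ x ∈ s, |F' t x| ≤ C)
    (hd : ∀ t, ∀ x ∈ s, HasDerivAt (fun t => F t x) (F' t x) t) (t : ℝ) :
    HasDerivAt (fun t => ∫ x in s, F t x ∂μ) (∫ x in s, F' t x ∂μ) t :=
  (hasDerivAt_integral_of_dominated_loc_of_deriv_le (μ := μ.restrict s) (s := univ)
    (bound := fun _ => C) univ_mem
    (Eventually.of_forall fun t => (hF t).1.aestronglyMeasurable hs)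
    ((hF t).integrableOn hs hμ) ((hF' t).1.aestronglyMeasurable hs)
    ((ae_restrict_iff' hs).2 (ae_of_all _ fun x hx t _ => hC t x hx))
    (integrableOn_const hμ)
    ((ae_restrict_iff' hs).2 (ae_of_all _ fun x hx t _ => hd t x hx))).2

end bddContOn

/-- A bounded function with `y' ≥ μ y - c` satisfies `y ≤ c / μ`. -/
theorem le_of_deriv_ge_of_bounded {y y' : ℝ → ℝ} {m c B : ℝ} (hm : 0 < m)
    (hd : ∀ t, HasDerivAt y (y' t) t) (h : ∀ t, m * y t - c ≤ y' t) (hB : ∀ t, y t ≤ B) (t : ℝ) :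
    y t ≤ c / m := by
  by_contra! hlt
  have hmono : Monotone fun s => (y s - c / m) * Real.exp (-m * s) := by
    have hd' : ∀ s, HasDerivAt (fun s => (y s - c / m) * Real.exp (-m * s))
        (y' s * Real.exp (-m * s) + (y s - c / m) * (Real.exp (-m * s) * -m)) s := fun s => by
      have h2 : HasDerivAt (fun s => Real.exp (-m * s)) (Real.exp (-m * s) * -m) s := by
        simpa using ((hasDerivAt_id s).const_mul (-m)).exp
      exact ((hd s).sub_const _).mul h2
    refine monotone_of_deriv_nonneg (fun s => (hd' s).differentiableAt) fun s => ?_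
    rw [(hd' s).deriv]
    have e : y' s * Real.exp (-m * s) + (y s - c / m) * (Real.exp (-m * s) * -m) =
        Real.exp (-m * s) * (y' s - (m * y s - c)) := by field_simp; ring
    rw [e]
    exact mul_nonneg (Real.exp_pos _).le (by linarith [h s])
  have hd0 : 0 < y t - c / m := by linarith
  have ht : Tendsto (fun s => (y t - c / m) * Real.exp (m * (s - t))) atTop atTop := by
    refine Tendsto.const_mul_atTop hd0 (Real.tendsto_exp_atTop.comp ?_)
    exact (tendsto_atTop_add_const_right _ (-t) tendsto_id).const_mul_atTop hm
  obtain ⟨s, hs, hst⟩ := ((ht.eventually_gt_atTop (B - c / m)).and (eventually_ge_atTop t)).exists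
  have h1 : (y t - c / m) * Real.exp (-m * t) ≤ (y s - c / m) * Real.exp (-m * s) := hmono hst
  have h2 : (y t - c / m) * Real.exp (m * (s - t)) ≤ y s - c / m := by
    have := mul_le_mul_of_nonneg_right h1 (Real.exp_pos (m * s)).le
    rw [mul_assoc, mul_assoc, ← Real.exp_add, ← Real.exp_add] at this
    rw [show -m * t + m * s = m * (s - t) by ring, show -m * s + m * s = 0 by ring, Real.exp_zero,
      mul_one] at this
    exact this
  linarith [hB s]

theorem hasDerivAt_max_pow (m : ℕ) (x : ℝ) :
    HasDerivAt (fun x : ℝ => max x 0 ^ (m + 2)) ((m + 2) * max x 0 ^ (m + 1)) x := by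
  rcases lt_trichotomy x 0 with h | h | h
  · rw [max_eq_right h.le]
    have : (fun x : ℝ => max x 0 ^ (m + 2)) =ᶠ[𝓝 x] fun _ => 0 := by
      filter_upwards [gt_mem_nhds h] with y hy
      rw [max_eq_right (le_of_lt hy)]; simp
    simpa using (hasDerivAt_const x (0:ℝ)).congr_of_eventuallyEq this
  · subst h
    rw [hasDerivAt_iff_isLittleO_nhds_zero]
    simp only [zero_add, max_self, smul_eq_mul]
    have h1 : (fun h : ℝ => max h 0 ^ (m + 2) - 0 ^ (m + 2) - h * ((m + 2) * 0 ^ (m + 1))) =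
        fun h : ℝ => max h 0 ^ (m + 2) := by funext h; simp
    rw [h1]
    have h2 : (fun h : ℝ => h ^ (m + 2)) =o[𝓝 0] fun h => h := by
      simpa using (Asymptotics.isLittleO_pow_id (𝕜 := ℝ) (n := m + 2) (by omega))
    refine (Asymptotics.IsBigO.of_bound 1 (Eventually.of_forall fun x => ?_)).trans_isLittleO h2
    rw [norm_pow, norm_pow, one_mul]
    refine pow_le_pow_left₀ (norm_nonneg _) ?_ _
    rw [Real.norm_eq_abs, Real.norm_eq_abs, abs_of_nonneg (le_max_right x 0)]
    exact max_le (le_abs_self x) (abs_nonneg x)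
  · rw [max_eq_left h.le]
    have : (fun x : ℝ => max x 0 ^ (m + 2)) =ᶠ[𝓝 x] fun x => x ^ (m + 2) := by
      filter_upwards [lt_mem_nhds h] with y hy
      rw [max_eq_left (le_of_lt hy)]
    have h2 := (hasDerivAt_pow (m + 2) x).congr_of_eventuallyEq this
    simpa using h2

/-- A product cut-off `ξ(a) χ(r)` on `[0, L] × [b - k, b + k]` with its first and second
derivatives, which is a subsolution of the adjoint operator
`φ ↦ φ_aa + φ_rr - (p φ / r)_r - φ / k ^ 2`. -/
structure Cut (p k b L K : ℝ) (ξ ξ₁ ξ₂ χ χ₁ χ₂ : ℝ → ℝ) : Prop where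
  hξ : ∀ a, HasDerivAt ξ (ξ₁ a) a
  hξ₁ : ∀ a, HasDerivAt ξ₁ (ξ₂ a) a
  hχ : ∀ r, HasDerivAt χ (χ₁ r) r
  hχ₁ : ∀ r, HasDerivAt χ₁ (χ₂ r) r
  cξ₂ : Continuous ξ₂
  cχ₂ : Continuous χ₂
  ξ_zero : ξ 0 = 1
  ξ₁_zero : -(K / k) ≤ ξ₁ 0
  ξ_nonneg : ∀ a, 0 ≤ ξ a
  ξ_le : ∀ a, 0 ≤ a → ξ a ≤ 1
  χ_nonneg : ∀ r, 0 ≤ χ r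
  χ_le : ∀ r, χ r ≤ 1
  ξ_L : ξ L = 0
  ξ₁_L : ξ₁ L = 0
  χ_left : χ (b - k) = 0
  χ_right : χ (b + k) = 0
  χ₁_left : χ₁ (b - k) = 0
  χ₁_right : χ₁ (b + k) = 0
  sub : ∀ a, 0 ≤ a → ∀ r ∈ Icc (b - k) (b + k),
    ξ a * χ r / k ^ 2 ≤ ξ₂ a * χ r + ξ a * χ₂ r - ξ a * (p / r * χ₁ r - p / r ^ 2 * χ r)
  ξ₁_sq : ∀ a, 0 ≤ a → ξ₁ a ^ 2 ≤ K ^ 2 / k ^ 2 * ξ a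
  χ₁_sq : ∀ r, χ₁ r ^ 2 ≤ K ^ 2 / k ^ 2 * χ r
  ξ₂_bdd : ∃ B, ∀ a, 0 ≤ a → |ξ₂ a| ≤ B

theorem hasDerivAt_max_pow_comp (m : ℕ) {f : ℝ → ℝ} {f' x : ℝ} (hf : HasDerivAt f f' x) :
    HasDerivAt (fun x => max (f x) 0 ^ (m + 2)) ((m + 2) * max (f x) 0 ^ (m + 1) * f') x :=
  (hasDerivAt_max_pow m (f x)).comp x hf

theorem exists_cut {p l : ℝ} (hp : 0 ≤ p) (hl : 0 < l) :
    ∃ K ≥ 6, ∃ c > 0, ∀ k b : ℝ, 0 < k → 2 * k ≤ b → ∃ ξ ξ₁ ξ₂ χ χ₁ χ₂ : ℝ → ℝ,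
      Cut p k b (l * k) K ξ ξ₁ ξ₂ χ χ₁ χ₂ ∧
      ∀ a ∈ Icc 0 (l * k / 2), ∀ r ∈ Icc (b - k / 2) (b + k / 2), c ≤ ξ a * χ r := by
  obtain ⟨j, hj⟩ := exists_nat_ge (((6 + p) ^ 2 + 1) * l ^ 2)
  refine ⟨max 6 (((j:ℝ) + 3) / l), le_max_left _ _, (1 / 2) ^ (j + 3) * (3 / 4) ^ 3,
    by positivity, fun k b hk hb => ?_⟩
  set K := max 6 (((j:ℝ) + 3) / l)
  have hK6 : 6 ≤ K := le_max_left _ _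
  have hKj : ((j:ℝ) + 3) / l ≤ K := le_max_right _ _
  set s : ℝ → ℝ := fun a => max (1 - a / (l * k)) 0 with hs
  set w : ℝ → ℝ := fun r => max (1 - ((r - b) / k) ^ 2) 0 with hw
  have hs0 : ∀ a, 0 ≤ s a := fun a => le_max_right _ _
  have hw0 : ∀ a, 0 ≤ w a := fun a => le_max_right _ _
  have hs1 : ∀ a, 0 ≤ a → s a ≤ 1 := fun a ha => by
    have : 0 ≤ a / (l * k) := by positivity
    exact max_le (by linarith) zero_le_one
  have hw1 : ∀ r, w r ≤ 1 := fun r => max_le (by nlinarith [sq_nonneg ((r - b) / k)]) zero_le_one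
  have ds : ∀ a, HasDerivAt (fun a => 1 - a / (l * k)) (-(1 / (l * k))) a := fun a =>
    ((hasDerivAt_id a).div_const (l * k)).const_sub 1
  have dx : ∀ r, HasDerivAt (fun r => (r - b) / k) (1 / k) r := fun r =>
    ((hasDerivAt_id r).sub_const b).div_const k
  have dw : ∀ r, HasDerivAt (fun r => 1 - ((r - b) / k) ^ 2) (-(2 * ((r - b) / k) * (1 / k))) r :=
    fun r => by simpa using ((dx r).pow 2).const_sub 1
  have dsp : ∀ (m : ℕ) a, HasDerivAt (fun a => s a ^ (m + 2))
      ((m + 2) * s a ^ (m + 1) * -(1 / (l * k))) a := fun m a => hasDerivAt_max_pow_comp m (ds a)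
  have dwp : ∀ (m : ℕ) r, HasDerivAt (fun r => w r ^ (m + 2))
      ((m + 2) * w r ^ (m + 1) * -(2 * ((r - b) / k) * (1 / k))) r :=
    fun m r => hasDerivAt_max_pow_comp m (dw r)
  have hsL : s (l * k) = 0 := by simp [hs, (mul_pos hl hk).ne']
  have hwl : w (b - k) = 0 := by simp [hw, hk.ne']
  have hwr : w (b + k) = 0 := by simp [hw, hk.ne']
  have cs : Continuous s := by fun_prop
  have cw : Continuous w := by fun_prop
  refine ⟨fun a => s a ^ (j + 3), fun a => -(((j:ℝ) + 3) / (l * k)) * s a ^ (j + 2),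
    fun a => ((j:ℝ) + 3) * (j + 2) / (l * k) ^ 2 * s a ^ (j + 1), fun r => w r ^ 3,
    fun r => -(6 / k) * (w r ^ 2 * ((r - b) / k)),
    fun r => (24 * w r * ((r - b) / k) ^ 2 - 6 * w r ^ 2) / k ^ 2, ⟨?_, ?_, ?_, ?_, ?_, ?_, ?_, ?_,
      ?_, ?_, ?_, ?_, ?_, ?_, ?_, ?_, ?_, ?_, ?_, ?_, ?_, ?_⟩, ?_⟩
  · intro a
    convert dsp (j + 1) a using 1
    push_cast; ring
  · intro a
    refine ((dsp j a).const_mul (-(((j:ℝ) + 3) / (l * k)))).congr_deriv ?_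
    field_simp
  · intro r
    convert dwp 1 r using 1
    push_cast; field_simp; ring
  · intro r
    refine (((dwp 0 r).mul (dx r)).const_mul (-(6 / k))).congr_deriv ?_
    push_cast; field_simp; ring
  · fun_prop
  · fun_prop
  · simp [hs]
  · simp only [hs, zero_div, sub_zero]
    rw [max_eq_left zero_le_one, one_pow, mul_one, neg_le_neg_iff, ← div_div]
    gcongr
  · exact fun a => pow_nonneg (hs0 a) _
  · exact fun a ha => pow_le_one₀ (hs0 a) (hs1 a ha)
  · exact fun r => pow_nonneg (hw0 r) _
  · exact fun r => pow_le_one₀ (hw0 r) (hw1 r)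
  · simp [hsL]
  · simp [hsL]
  · simp [hwl]
  · simp [hwr]
  · simp [hwl]
  · simp [hwr]
  · intro a ha r hr
    have hr0 : k ≤ r := by linarith [hr.1]
    set x := (r - b) / k with hx
    have hx1 : |x| ≤ 1 := by
      rw [hx, abs_div, abs_of_pos hk, div_le_one hk, abs_le]
      constructor <;> linarith [hr.1, hr.2]
    have hwx : w r = 1 - x ^ 2 := by
      simp only [hw]; rw [max_eq_left]
      rw [← hx]; nlinarith [abs_le.1 hx1]
    have h1 : ((6 + p) ^ 2 + 1) / k ^ 2 * s a ^ (j + 3) ≤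
        ((j:ℝ) + 3) * (j + 2) / (l * k) ^ 2 * s a ^ (j + 1) := by
      have e1 : s a ^ (j + 3) ≤ s a ^ (j + 1) :=
        pow_le_pow_of_le_one (hs0 a) (hs1 a ha) (by omega)
      have e2 : ((6 + p) ^ 2 + 1) / k ^ 2 ≤ ((j:ℝ) + 3) * (j + 2) / (l * k) ^ 2 := by
        rw [mul_pow, div_le_div_iff₀ (by positivity) (by positivity)]
        have : (((6 + p) ^ 2 + 1) * l ^ 2) * k ^ 2 ≤ (((j:ℝ) + 3) * (j + 2)) * k ^ 2 := by
          exact mul_le_mul_of_nonneg_right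
            (hj.trans (by nlinarith [(j.cast_nonneg : (0:ℝ) ≤ j)])) (sq_nonneg k)
        linarith
      exact mul_le_mul e2 e1 (pow_nonneg (hs0 a) _) (by positivity)
    have h2 : -((6 + p) ^ 2 / k ^ 2 * w r ^ 3) ≤ (24 * w r * x ^ 2 - 6 * w r ^ 2) / k ^ 2 -
        (p / r * (-(6 / k) * (w r ^ 2 * x)) - p / r ^ 2 * w r ^ 3) := by
      have e1 : 0 ≤ p / r ^ 2 * w r ^ 3 := by have := hw0 r; positivity
      have e2 : -(6 * p * w r ^ 2 / k ^ 2) ≤ p / r * (6 / k) * (w r ^ 2 * x) := by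
        have e3 : p / r * (6 / k) ≤ 6 * p / k ^ 2 := by
          rw [div_mul_div_comm, div_le_div_iff₀ (by nlinarith) (by positivity)]
          nlinarith [mul_nonneg (mul_nonneg hp hk.le) (sub_nonneg.2 hr0)]
        have e4 : 0 ≤ p / r * (6 / k) := by
          have : 0 < r := hk.trans_le hr0
          positivity
        have e5 : -(w r ^ 2) ≤ w r ^ 2 * x := by nlinarith [sq_nonneg (w r), abs_le.1 hx1]
        have e6 : -(6 * p * w r ^ 2 / k ^ 2) = 6 * p / k ^ 2 * (-(w r ^ 2)) := by ring
        rw [e6]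
        nlinarith [sq_nonneg (w r)]
      have e7 : 0 ≤ (24 * w r * x ^ 2 - 6 * w r ^ 2 - 6 * p * w r ^ 2 + (6 + p) ^ 2 * w r ^ 3) /
          k ^ 2 := by
        have hx2 : x ^ 2 = 1 - w r := by linarith
        refine div_nonneg ?_ (by positivity)
        rw [hx2]
        have : 24 * w r * (1 - w r) - 6 * w r ^ 2 - 6 * p * w r ^ 2 + (6 + p) ^ 2 * w r ^ 3 =
          w r * ((((6 + p) * w r) - 3) ^ 2 + 15 + 6 * w r) := by ring
        rw [this]
        have := hw0 r
        positivity
      have e8 : (24 * w r * x ^ 2 - 6 * w r ^ 2 - 6 * p * w r ^ 2 + (6 + p) ^ 2 * w r ^ 3) / k ^ 2 =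
        (24 * w r * x ^ 2 - 6 * w r ^ 2) / k ^ 2 - 6 * p * w r ^ 2 / k ^ 2 +
          (6 + p) ^ 2 / k ^ 2 * w r ^ 3 := by ring
      nlinarith
    have h3 := mul_le_mul_of_nonneg_right h1 (pow_nonneg (hw0 r) 3)
    have h4 := mul_le_mul_of_nonneg_left h2 (pow_nonneg (hs0 a) (j + 3))
    have h5 : s a ^ (j + 3) * w r ^ 3 / k ^ 2 =
      ((6 + p) ^ 2 + 1) / k ^ 2 * s a ^ (j + 3) * w r ^ 3 +
        s a ^ (j + 3) * -((6 + p) ^ 2 / k ^ 2 * w r ^ 3) := by ring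
    rw [h5]
    refine (add_le_add h3 h4).trans (le_of_eq ?_)
    ring
  · intro a ha
    have e1 : (-(((j:ℝ) + 3) / (l * k)) * s a ^ (j + 2)) ^ 2 =
      (((j:ℝ) + 3) / l) ^ 2 / k ^ 2 * s a ^ (2 * j + 4) := by field_simp; ring
    rw [e1]
    have e2 : s a ^ (2 * j + 4) ≤ s a ^ (j + 3) :=
      pow_le_pow_of_le_one (hs0 a) (hs1 a ha) (by omega)
    have := hs0 a
    gcongr
  · intro r
    rcases le_or_gt (1 - ((r - b) / k) ^ 2) 0 with h | h
    · simp [hw, max_eq_right h]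
    · set x := (r - b) / k
      have hx2 : x ^ 2 ≤ 1 := by linarith
      have e1 : (-(6 / k) * (w r ^ 2 * x)) ^ 2 = 6 ^ 2 / k ^ 2 * (w r ^ 4 * x ^ 2) := by
        field_simp
      rw [e1]
      have e2 : w r ^ 4 * x ^ 2 ≤ w r ^ 3 * 1 :=
        mul_le_mul (pow_le_pow_of_le_one (hw0 r) (hw1 r) (by omega)) hx2 (sq_nonneg _)
          (pow_nonneg (hw0 r) _)
      rw [mul_one] at e2
      gcongr
  · refine ⟨((j:ℝ) + 3) * (j + 2) / (l * k) ^ 2, fun a ha => ?_⟩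
    have := hs0 a
    rw [abs_of_nonneg (by positivity)]
    exact mul_le_of_le_one_right (by positivity) (pow_le_one₀ (hs0 a) (hs1 a ha))
  · intro a ha r hr
    have e1 : 1 / 2 ≤ s a := by
      refine le_max_of_le_left ?_
      have : a / (l * k) ≤ 1 / 2 := by
        rw [div_le_iff₀ (by positivity)]; linarith [ha.2]
      linarith
    have e2 : 3 / 4 ≤ w r := by
      refine le_max_of_le_left ?_
      have : |(r - b) / k| ≤ 1 / 2 := by
        rw [abs_div, abs_of_pos hk, div_le_iff₀ hk, abs_le]
        constructor <;> linarith [hr.1, hr.2]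
      nlinarith [abs_le.1 this]
    exact mul_le_mul (pow_le_pow_left₀ (by norm_num) e1 _) (pow_le_pow_left₀ (by norm_num) e2 _)
      (by positivity) (pow_nonneg (hs0 a) _)

/-- Bounded positive solutions of the reduced two-dimensional problem
`v_t = v_aa + v_rr + (p / r) v_r` for `a > 0`, `-v_a = v ^ q` at `a = 0`, together with
the regularity used below. -/
structure Sol2 (q p M C : ℝ) (v va vr vaa vrr : ℝ → ℝ → ℝ → ℝ) : Prop where
  cont : Continuous fun x : ℝ × ℝ × ℝ => v x.1 x.2.1 x.2.2
  pos : ∀ a r t, 0 < v a r t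
  le : ∀ a r t, v a r t ≤ M
  hasA : ∀ a r t, 0 < a → HasDerivAt (fun s => v s r t) (va a r t) a
  hasR : ∀ a r t, 0 < a → HasDerivAt (fun s => v a s t) (vr a r t) r
  hasAA : ∀ a r t, 0 < a → HasDerivAt (fun s => va s r t) (vaa a r t) a
  hasRR : ∀ a r t, 0 < a → HasDerivAt (fun s => vr a s t) (vrr a r t) r
  va_le : ∀ a r t, 0 < a → |va a r t| ≤ M
  vr_le : ∀ a r t, 0 < a → |vr a r t| ≤ M
  vaa_le : ∀ a r t, 0 < a → |vaa a r t| ≤ C / a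
  vrr_le : ∀ a r t, 0 < a → |vrr a r t| ≤ C / a
  va_cont : ∀ t, ContinuousOn (fun z : ℝ × ℝ => va z.1 z.2 t) (Ioi 0 ×ˢ univ)
  vr_cont : ∀ t, ContinuousOn (fun z : ℝ × ℝ => vr z.1 z.2 t) (Ioi 0 ×ˢ univ)
  vaa_cont : ∀ t, ContinuousOn (fun z : ℝ × ℝ => vaa z.1 z.2 t) (Ioi 0 ×ˢ univ)
  vrr_cont : ∀ t, ContinuousOn (fun z : ℝ × ℝ => vrr z.1 z.2 t) (Ioi 0 ×ˢ univ)
  va_time : ∀ a r, 0 < a → Continuous (va a r)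
  vr_time : ∀ a r, 0 < a → Continuous (vr a r)
  heat : ∀ a r t, 0 < a → 0 < r →
    HasDerivAt (v a r) (vaa a r t + vrr a r t + p / r * vr a r t) t
  heat_cont : ∀ a r, 0 < a → 0 < r →
    Continuous fun t => vaa a r t + vrr a r t + p / r * vr a r t
  flux : ∀ r t, Tendsto (fun a => va a r t) (𝓝[>] 0) (𝓝 (-(v 0 r t) ^ q))

/-- The point of the meridian half-plane with coordinates `(a, r)`. -/
noncomputable def meridian {n : ℕ} (o j : Fin n) (a r : ℝ) : Fin n → ℝ :=
  update (update 0 o (max a 0)) j r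

section meridian
variable {n : ℕ} {o j : Fin n}

theorem meridian_o (h : j ≠ o) (a r : ℝ) : meridian o j a r o = max a 0 := by
  simp [meridian, h.symm]

theorem meridian_j (a r : ℝ) : meridian o j a r j = r := by simp [meridian]

theorem meridian_of_ne {i : Fin n} (hi : i ≠ o) (hij : i ≠ j) (a r : ℝ) :
    meridian o j a r i = 0 := by
  simp [meridian, hi, hij]

theorem update_meridian_o (h : j ≠ o) (a r s : ℝ) (hs : 0 ≤ s) :
    update (meridian o j a r) o s = meridian o j s r := by
  rw [meridian, update_comm h, update_idem, meridian, max_eq_left hs]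

theorem update_meridian_j (a r s : ℝ) :
    update (meridian o j a r) j s = meridian o j a s := by
  rw [meridian, update_idem, meridian]

theorem continuous_meridian : Continuous fun z : ℝ × ℝ => meridian o j z.1 z.2 := by
  unfold meridian
  exact (continuous_const.update o (by fun_prop)).update j continuous_snd

end meridian

namespace PSol
variable {n : ℕ} {o : Fin n} {q M : ℝ} {W : (Fin n → ℝ) → ℝ → ℝ}
  {D D2 : Fin n → (Fin n → ℝ) → ℝ → ℝ}

/-- In the directions orthogonal to the meridian plane the second derivative is `v_r / r`. -/
theorem D2_transversal (P : PSol o q M W D D2) {j i : Fin n} (hj : j ≠ o) (hio : i ≠ o)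
    (hij : i ≠ j)
    (hs : ∀ x y : Fin n → ℝ, x o = y o → (∑ i ∈ Finset.univ.erase o, x i ^ 2)
      = (∑ i ∈ Finset.univ.erase o, y i ^ 2) → ∀ t, W x t = W y t)
    {a r t : ℝ} (ha : 0 < a) (hr : 0 < r) :
    D2 i (meridian o j a r) t = 1 / r * D j (meridian o j a r) t := by
  set m := meridian o j a r with hm
  have hmo : ∀ s, 0 < meridian o j a s o := fun s => by
    rw [meridian_o hj, max_eq_left ha.le]; exact ha
  set φ : ℝ → ℝ := fun s => √(r ^ 2 + s ^ 2) with hφ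
  have hφ0 : ∀ s, 0 < φ s := fun s => Real.sqrt_pos.2 (by positivity)
  have hφd : ∀ s, HasDerivAt φ (s / φ s) s := fun s => by
    have h1 : HasDerivAt (fun s : ℝ => r ^ 2 + s ^ 2) (2 * s) s := by
      simpa using (hasDerivAt_pow 2 s).const_add (r ^ 2)
    convert h1.sqrt (by positivity) using 1
    simp only [hφ]; field_simp
  have hrot : ∀ s, W (update m i s) t = W (meridian o j a (φ s)) t := fun s => by
    refine hs _ _ ?_ ?_ t
    · rw [update_of_ne hio.symm, hm, meridian_o hj, meridian_o hj]
    · have hje : j ∈ Finset.univ.erase o := by simp [hj]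
      have hie : i ∈ (Finset.univ.erase o).erase j := by simp [hio, hij]
      rw [← Finset.add_sum_erase _ _ hje, ← Finset.add_sum_erase _ _ hje,
        ← Finset.add_sum_erase _ _ hie, ← Finset.add_sum_erase _ _ hie]
      have hz : ∀ f : Fin n → ℝ, (∀ k, k ≠ o → k ≠ j → k ≠ i → f k = 0) →
          ∑ k ∈ ((Finset.univ.erase o).erase j).erase i, f k ^ 2 = 0 := fun f hf =>
        Finset.sum_eq_zero fun k hk => by
          simp only [Finset.mem_erase, Finset.mem_univ, and_true] at hk
          rw [hf k hk.2.2 hk.2.1 hk.1]; simp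
      rw [hz _ fun k h1 h2 h3 => by rw [update_of_ne h3, hm, meridian_of_ne h1 h2],
        hz _ fun k h1 h2 h3 => meridian_of_ne h1 h2 _ _]
      rw [update_of_ne hij.symm, update_self, hm, meridian_j, meridian_j,
        meridian_of_ne hio hij, Real.sq_sqrt (by positivity)]
      ring
  have hDi : ∀ s, D i (update m i s) t = D j (meridian o j a (φ s)) t * (s / φ s) := fun s => by
    have h1 := P.hasD i (update m i s) t (by
      rw [update_of_ne hio.symm]; exact (hmo r).le) (Or.inl hio)
    have h2 := P.hasD j (meridian o j a (φ s)) t (hmo _).le (Or.inl hj)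
    simp only [update_idem, update_self, hrot, update_meridian_j, meridian_j] at h1 h2
    exact h1.unique (h2.comp s (hφd s))
  have hφr : φ 0 = r := by simp [hφ, Real.sqrt_sq hr.le]
  have h1 := P.hasDD i m t (hmo r)
  have hmi : m i = 0 := meridian_of_ne hio hij _ _
  rw [hmi] at h1
  simp only [hDi] at h1
  have h2 := P.hasDD j (meridian o j a (φ 0)) t (hmo _)
  simp only [update_meridian_j, meridian_j] at h2
  have h3 := (h2.comp (0:ℝ) (hφd 0)).mul ((hasDerivAt_id (0:ℝ)).div (hφd 0) (hφ0 0).ne')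
  have h4 := h1.unique h3
  rw [h4, hm]
  simp only [comp, hφr, id]
  field_simp
  simp [mul_comm]

theorem sol2 (P : PSol o q M W D D2) {j : Fin n} (hj : j ≠ o)
    (hs : ∀ x y : Fin n → ℝ, x o = y o → (∑ i ∈ Finset.univ.erase o, x i ^ 2)
      = (∑ i ∈ Finset.univ.erase o, y i ^ 2) → ∀ t, W x t = W y t) :
    Sol2 q ((n : ℝ) - 2) M (4 * (8 * n + 18) * M) (fun a r t => W (meridian o j a r) t)
      (fun a r t => D o (meridian o j a r) t) (fun a r t => D j (meridian o j a r) t)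
      (fun a r t => D2 o (meridian o j a r) t) (fun a r t => D2 j (meridian o j a r) t) := by
  have hmo : ∀ a r, 0 ≤ meridian o j a r o := fun a r => by
    rw [meridian_o hj]; exact le_max_right _ _
  have hmp : ∀ a r, 0 < a → 0 < meridian o j a r o := fun a r ha => by
    rw [meridian_o hj]; exact lt_max_of_lt_left ha
  have hme : ∀ a r, 0 < a → meridian o j a r o = a := fun a r ha => by
    rw [meridian_o hj, max_eq_left ha.le]
  have hmt : MapsTo (fun z : ℝ × ℝ => meridian o j z.1 z.2) (Ioi 0 ×ˢ univ) {x | 0 < x o} :=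
    fun z hz => hmp _ _ hz.1
  have hDc : ∀ i t, ContinuousOn (fun x => D i x t) {x | 0 < x o} := fun i t =>
    (P.D_cont i t).mono fun x (hx : 0 < x o) => hx.le
  have hsum : ∀ a r t, 0 < a → 0 < r → ∑ i, D2 i (meridian o j a r) t =
      D2 o (meridian o j a r) t + D2 j (meridian o j a r) t +
        ((n : ℝ) - 2) / r * D j (meridian o j a r) t := fun a r t ha hr => by
    have hje : j ∈ Finset.univ.erase o := by simp [hj]
    rw [← Finset.add_sum_erase _ _ (Finset.mem_univ o), ← Finset.add_sum_erase _ _ hje,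
      Finset.sum_congr rfl (g := fun _ => 1 / r * D j (meridian o j a r) t) fun i hi => by
        simp only [Finset.mem_erase, Finset.mem_univ, and_true] at hi
        exact P.D2_transversal hj hi.2 hi.1 hs ha hr]
    have h2 : 2 ≤ n := by
      have := Finset.card_le_univ ({o, j} : Finset (Fin n))
      rw [Finset.card_pair hj.symm] at this; simpa using this
    rw [Finset.sum_const, Finset.card_erase_of_mem hje,
      Finset.card_erase_of_mem (Finset.mem_univ o), Finset.card_univ, Fintype.card_fin,
      nsmul_eq_mul, Nat.sub_sub, Nat.cast_sub h2]
    push_cast; ring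
  have hheat : ∀ a r t, 0 < a → 0 < r → HasDerivAt (W (meridian o j a r))
      (D2 o (meridian o j a r) t + D2 j (meridian o j a r) t +
        ((n : ℝ) - 2) / r * D j (meridian o j a r) t) t := fun a r t ha hr => by
    rw [← hsum a r t ha hr]; exact P.heat _ t (hmp a r ha)
  refine
    { cont := ?_
      pos := fun a r t => P.pos _ t (hmo a r)
      le := fun a r t => P.le _ t (hmo a r)
      hasA := fun a r t ha => ?_
      hasR := fun a r t ha => ?_
      hasAA := fun a r t ha => ?_
      hasRR := fun a r t ha => ?_
      va_le := fun a r t ha => P.D_le _ _ _ (hmo a r)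
      vr_le := fun a r t ha => P.D_le _ _ _ (hmo a r)
      vaa_le := fun a r t ha => by
        have := P.D2_le o (meridian o j a r) t (hmp a r ha)
        rwa [hme a r ha] at this
      vrr_le := fun a r t ha => by
        have := P.D2_le j (meridian o j a r) t (hmp a r ha)
        rwa [hme a r ha] at this
      va_cont := fun t => (hDc o t).comp
        continuous_meridian.continuousOn hmt
      vr_cont := fun t => (hDc j t).comp
        continuous_meridian.continuousOn hmt
      vaa_cont := fun t => (P.D2_cont o t).comp continuous_meridian.continuousOn hmt
      vrr_cont := fun t => (P.D2_cont j t).comp continuous_meridian.continuousOn hmt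
      va_time := fun a r ha => P.D_time_cont o _ (hmp a r ha)
      vr_time := fun a r ha => P.D_time_cont j _ (hmp a r ha)
      heat := hheat
      heat_cont := fun a r ha hr => by
        have := P.heat_cont _ (hmp a r ha)
        simpa only [hsum a r _ ha hr] using this
      flux := fun r t => ?_ }
  · exact P.cont.comp_continuous (f := fun x : ℝ × ℝ × ℝ => (meridian o j x.1 x.2.1, x.2.2))
      ((continuous_meridian.comp (by fun_prop : Continuous fun x : ℝ × ℝ × ℝ =>
        (x.1, x.2.1))).prodMk (by fun_prop)) fun x => hmo _ _
  · have h := P.hasD o (meridian o j a r) t (hmo a r) (Or.inr (hmp a r ha))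
    rw [hme a r ha] at h
    refine h.congr_of_eventuallyEq ?_
    filter_upwards [lt_mem_nhds ha] with s hs
    rw [update_meridian_o hj _ _ _ (le_of_lt hs)]
  · have h := P.hasD j (meridian o j a r) t (hmo a r) (Or.inl hj)
    simpa only [meridian_j, update_meridian_j] using h
  · have h := P.hasDD o (meridian o j a r) t (hmp a r ha)
    rw [hme a r ha] at h
    refine h.congr_of_eventuallyEq ?_
    filter_upwards [lt_mem_nhds ha] with s hs
    rw [update_meridian_o hj _ _ _ (le_of_lt hs)]
  · have h := P.hasDD j (meridian o j a r) t (hmp a r ha)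
    simpa only [meridian_j, update_meridian_j] using h
  · have h0 : meridian o j 0 r o = 0 := by rw [meridian_o hj]; simp
    have hb := P.bc (meridian o j 0 r) t h0
    rw [← hb]
    have hc : Continuous fun a : ℝ => meridian o j a r :=
      continuous_meridian.comp (by fun_prop : Continuous fun a : ℝ => (a, r))
    have := (P.D_cont o t).comp_continuous hc fun a => hmo a r
    exact (this.tendsto 0).mono_left nhdsWithin_le_nhds

end PSol

/-- Time-regularised solutions of the reduced problem: `U` is a Steklov average of a
solution, `V` its time derivative and `g` its flux through `a = 0`. -/
structure USol (q p N : ℝ) (U Ua Ur Uaa Urr V Va Vr : ℝ → ℝ → ℝ → ℝ) (g : ℝ → ℝ → ℝ) :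
    Prop where
  pos : ∀ a r t, 0 < U a r t
  U_le : ∀ a r t, |U a r t| ≤ N
  V_le : ∀ a r t, |V a r t| ≤ N
  Ua_le : ∀ a r t, 0 < a → |Ua a r t| ≤ N
  Ur_le : ∀ a r t, 0 < a → |Ur a r t| ≤ N
  Va_le : ∀ a r t, 0 < a → |Va a r t| ≤ N
  Vr_le : ∀ a r t, 0 < a → |Vr a r t| ≤ N
  hasUa : ∀ a r t, 0 < a → HasDerivAt (fun s => U s r t) (Ua a r t) a
  hasUr : ∀ a r t, 0 < a → HasDerivAt (fun s => U a s t) (Ur a r t) r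
  hasUaa : ∀ a r t, 0 < a → HasDerivAt (fun s => Ua s r t) (Uaa a r t) a
  hasUrr : ∀ a r t, 0 < a → HasDerivAt (fun s => Ur a s t) (Urr a r t) r
  hasVa : ∀ a r t, 0 < a → HasDerivAt (fun s => V s r t) (Va a r t) a
  hasVr : ∀ a r t, 0 < a → HasDerivAt (fun s => V a s t) (Vr a r t) r
  hasUt : ∀ a r t, HasDerivAt (U a r) (V a r t) t
  hasUat : ∀ a r t, 0 < a → HasDerivAt (Ua a r) (Va a r t) t
  hasUrt : ∀ a r t, 0 < a → HasDerivAt (Ur a r) (Vr a r t) t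
  U_cont : ∀ t, Continuous fun z : ℝ × ℝ => U z.1 z.2 t
  V_cont : ∀ t, Continuous fun z : ℝ × ℝ => V z.1 z.2 t
  g_cont : ∀ t, Continuous fun r => g r t
  Ua_cont : ∀ t, ContinuousOn (fun z : ℝ × ℝ => Ua z.1 z.2 t) (Ioi 0 ×ˢ univ)
  Ur_cont : ∀ t, ContinuousOn (fun z : ℝ × ℝ => Ur z.1 z.2 t) (Ioi 0 ×ˢ univ)
  Uaa_cont : ∀ t, ContinuousOn (fun z : ℝ × ℝ => Uaa z.1 z.2 t) (Ioi 0 ×ˢ univ)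
  Urr_cont : ∀ t, ContinuousOn (fun z : ℝ × ℝ => Urr z.1 z.2 t) (Ioi 0 ×ˢ univ)
  Va_cont : ∀ t, ContinuousOn (fun z : ℝ × ℝ => Va z.1 z.2 t) (Ioi 0 ×ˢ univ)
  Vr_cont : ∀ t, ContinuousOn (fun z : ℝ × ℝ => Vr z.1 z.2 t) (Ioi 0 ×ˢ univ)
  heat : ∀ a r t, 0 < a → 0 < r → V a r t = Uaa a r t + Urr a r t + p / r * Ur a r t
  flux : ∀ r t, Tendsto (fun a => Ua a r t) (𝓝[>] 0) (𝓝 (-g r t))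
  jensen : ∀ r t, U 0 r t ^ q ≤ g r t

/-- Forward difference quotient. -/
noncomputable def dquot (h : ℝ) (f : ℝ → ℝ) (t : ℝ) : ℝ := (f (t + h) - f t) / h

theorem abs_dquot_le {h N : ℝ} (hh : 0 < h) {f : ℝ → ℝ} (hf : ∀ s, |f s| ≤ N) (t : ℝ) :
    |dquot h f t| ≤ 2 * N / h := by
  rw [dquot, abs_div, abs_of_pos hh]
  gcongr
  exact (abs_sub _ _).trans (by linarith [hf (t + h), hf t])

namespace Sol2
variable {q p M C : ℝ} {v va vr vaa vrr : ℝ → ℝ → ℝ → ℝ}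

theorem M_pos (S : Sol2 q p M C v va vr vaa vrr) : 0 < M :=
  (S.pos 0 0 0).trans_le (S.le 0 0 0)

theorem time_cont (S : Sol2 q p M C v va vr vaa vrr) (a r : ℝ) : Continuous (v a r) :=
  S.cont.comp (by fun_prop : Continuous fun t : ℝ => (a, r, t))

theorem abs_le (S : Sol2 q p M C v va vr vaa vrr) (a r t : ℝ) : |v a r t| ≤ M := by
  rw [abs_of_pos (S.pos a r t)]; exact S.le a r t

theorem vaa_meas (S : Sol2 q p M C v va vr vaa vrr) {a : ℝ} (ha : 0 < a) (r : ℝ) :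
    Measurable (vaa a r) :=
  measurable_of_hasDerivAt_param (f := fun a s => va a r s) one_pos
    (fun x hx => (S.va_time x r (ha.trans_le hx.1)).measurable) fun s => S.hasAA a r s ha

theorem vrr_meas (S : Sol2 q p M C v va vr vaa vrr) {a : ℝ} (ha : 0 < a) (r : ℝ) :
    Measurable (vrr a r) :=
  measurable_of_hasDerivAt_param (f := fun r s => vr a r s) one_pos
    (fun x _ => (S.vr_time a x ha).measurable) fun s => S.hasRR a r s ha

theorem rpow_stek_le (S : Sol2 q p M C v va vr vaa vrr) (hq : 1 < q) {h : ℝ} (hh : 0 < h)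
    (a r t : ℝ) : stek h (v a r) t ^ q ≤ stek h (fun s => v a r s ^ q) t := by
  have hc := S.time_cont a r
  have hcq : Continuous fun s => v a r s ^ q := hc.rpow_const fun s => Or.inr (by linarith)
  set U := stek h (v a r) t with hU
  have hU0 : 0 < U := stek_pos hh hc (S.pos a r) t
  have h1 : stek h (fun s => U ^ q + q * U ^ (q - 1) * (v a r s - U)) t ≤
      stek h (fun s => v a r s ^ q) t := by
    refine stek_mono hh ?_ (hcq.intervalIntegrable _ _)
      fun s _ => rpow_tangent_le hq.le (S.pos a r s).le hU0
    exact Continuous.intervalIntegrable (by fun_prop) _ _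
  refine le_trans (le_of_eq ?_) h1
  rw [stek_add intervalIntegrable_const (Continuous.intervalIntegrable (by fun_prop) _ _),
    stek_const hh, stek_const_mul]
  simp only [sub_eq_add_neg]
  rw [stek_add (hc.intervalIntegrable _ _) intervalIntegrable_const, stek_const hh, ← hU]
  ring

theorem uSol (S : Sol2 q p M C v va vr vaa vrr) (hq : 1 < q) {h : ℝ} (hh : 0 < h) :
    USol q p (M + 2 * M / h) (fun a r t => stek h (v a r) t) (fun a r t => stek h (va a r) t)
      (fun a r t => stek h (vr a r) t) (fun a r t => stek h (vaa a r) t)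
      (fun a r t => stek h (vrr a r) t) (fun a r t => dquot h (v a r) t)
      (fun a r t => dquot h (va a r) t) (fun a r t => dquot h (vr a r) t)
      (fun r t => stek h (fun s => v 0 r s ^ q) t) := by
  have hM := S.M_pos
  have h1 : M ≤ M + 2 * M / h := by have : 0 ≤ 2 * M / h := by positivity
                                    linarith
  have h2 : 2 * M / h ≤ M + 2 * M / h := by linarith
  have hC : 0 ≤ C := by
    have := (abs_nonneg _).trans (S.vaa_le 1 0 0 one_pos)
    simpa using this
  have hI : ∀ {a δ x : ℝ}, δ ≤ a / 2 → x ∈ Ioo (a - δ) (a + δ) → a / 2 < x := fun h1 h2 => by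
    linarith [h2.1]
  have hCb : ∀ {a x : ℝ}, 0 < a → a / 2 < x → C / x ≤ C / (a / 2) := fun h1 h2 => by
    gcongr
  have hvc : Continuous fun z : (ℝ × ℝ) × ℝ => v z.1.1 z.1.2 z.2 :=
    S.cont.comp (by fun_prop : Continuous fun z : (ℝ × ℝ) × ℝ => (z.1.1, z.1.2, z.2))
  refine
    { pos := fun a r t => stek_pos hh (S.time_cont a r) (S.pos a r) t
      U_le := fun a r t => (abs_stek_le hh (S.abs_le a r)).trans h1
      V_le := fun a r t => (abs_dquot_le hh (S.abs_le a r) t).trans h2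
      Ua_le := fun a r t ha => (abs_stek_le hh fun s => S.va_le a r s ha).trans h1
      Ur_le := fun a r t ha => (abs_stek_le hh fun s => S.vr_le a r s ha).trans h1
      Va_le := fun a r t ha => (abs_dquot_le hh (fun s => S.va_le a r s ha) t).trans h2
      Vr_le := fun a r t ha => (abs_dquot_le hh (fun s => S.vr_le a r s ha) t).trans h2
      hasUa := fun a r t ha => ?_
      hasUr := fun a r t ha => ?_
      hasUaa := fun a r t ha => ?_
      hasUrr := fun a r t ha => ?_
      hasVa := fun a r t ha => ((S.hasA a r (t + h) ha).sub (S.hasA a r t ha)).div_const h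
      hasVr := fun a r t ha => ((S.hasR a r (t + h) ha).sub (S.hasR a r t ha)).div_const h
      hasUt := fun a r t => stek_hasDerivAt h (S.time_cont a r) t
      hasUat := fun a r t ha => stek_hasDerivAt h (S.va_time a r ha) t
      hasUrt := fun a r t ha => stek_hasDerivAt h (S.vr_time a r ha) t
      U_cont := fun t => (stek_continuous (F := fun z : ℝ × ℝ => v z.1 z.2) hvc).comp
        (by fun_prop : Continuous fun z : ℝ × ℝ => (z, t))
      V_cont := fun t => ((hvc.comp (by fun_prop : Continuous fun z : ℝ × ℝ => (z, t + h))).sub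
        (hvc.comp (by fun_prop : Continuous fun z : ℝ × ℝ => (z, t)))).div_const h
      g_cont := fun t => ?_
      Ua_cont := fun t => stek_continuousOn (F := fun z : ℝ × ℝ => va z.1 z.2)
        (fun s => S.va_cont s) (fun z hz => (S.va_time z.1 z.2 hz.1).measurable)
        fun z hz => ⟨M, by
          filter_upwards [self_mem_nhdsWithin] with y hy s using S.va_le _ _ _ hy.1⟩
      Ur_cont := fun t => stek_continuousOn (F := fun z : ℝ × ℝ => vr z.1 z.2)
        (fun s => S.vr_cont s) (fun z hz => (S.vr_time z.1 z.2 hz.1).measurable)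
        fun z hz => ⟨M, by
          filter_upwards [self_mem_nhdsWithin] with y hy s using S.vr_le _ _ _ hy.1⟩
      Uaa_cont := fun t => stek_continuousOn (F := fun z : ℝ × ℝ => vaa z.1 z.2)
        (fun s => S.vaa_cont s) (fun z hz => S.vaa_meas hz.1 z.2) fun z hz => ⟨C / (z.1 / 2), ?_⟩
      Urr_cont := fun t => stek_continuousOn (F := fun z : ℝ × ℝ => vrr z.1 z.2)
        (fun s => S.vrr_cont s) (fun z hz => S.vrr_meas hz.1 z.2) fun z hz => ⟨C / (z.1 / 2), ?_⟩
      Va_cont := fun t => ((S.va_cont (t + h)).sub (S.va_cont t)).div_const h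
      Vr_cont := fun t => ((S.vr_cont (t + h)).sub (S.vr_cont t)).div_const h
      heat := fun a r t ha hr => ?_
      flux := fun r t => ?_
      jensen := fun r t => S.rpow_stek_le hq hh 0 r t }
  · exact stek_hasDerivAt_param (f := fun a s => v a r s) (f' := fun a s => va a r s)
      (half_pos ha) (fun x _ => S.time_cont x r)
      (fun x hx s => S.hasA x r s ((half_pos ha).trans (hI le_rfl hx)))
      fun x hx s => S.va_le x r s ((half_pos ha).trans (hI le_rfl hx))
  · exact stek_hasDerivAt_param (f := fun r s => v a r s) (f' := fun r s => vr a r s)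
      one_pos (fun x _ => S.time_cont a x) (fun x hx s => S.hasR a x s ha)
      fun x hx s => S.vr_le a x s ha
  · exact stek_hasDerivAt_param (f := fun a s => va a r s) (f' := fun a s => vaa a r s)
      (half_pos ha) (fun x hx => S.va_time x r ((half_pos ha).trans (hI le_rfl hx)))
      (fun x hx s => S.hasAA x r s ((half_pos ha).trans (hI le_rfl hx)))
      fun x hx s => (S.vaa_le x r s ((half_pos ha).trans (hI le_rfl hx))).trans
        (hCb ha (hI le_rfl hx))
  · exact stek_hasDerivAt_param (f := fun r s => vr a r s) (f' := fun r s => vrr a r s)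
      one_pos (fun x hx => S.vr_time a x ha) (fun x hx s => S.hasRR a x s ha)
      fun x hx s => S.vrr_le a x s ha
  · refine (stek_continuous (F := fun r s => v 0 r s ^ q) ?_).comp
      (by fun_prop : Continuous fun r : ℝ => (r, t))
    exact (S.cont.comp (by fun_prop : Continuous fun z : ℝ × ℝ => ((0:ℝ), z.1, z.2))).rpow_const
      fun z => Or.inr (by linarith)
  · filter_upwards [nhdsWithin_le_nhds (continuous_fst.continuousAt.eventually
      (lt_mem_nhds (half_lt_self hz.1)))] with y hy s
    exact (S.vaa_le _ _ _ ((half_pos hz.1).trans hy)).trans (hCb hz.1 hy)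
  · filter_upwards [nhdsWithin_le_nhds (continuous_fst.continuousAt.eventually
      (lt_mem_nhds (half_lt_self hz.1)))] with y hy s
    exact (S.vrr_le _ _ _ ((half_pos hz.1).trans hy)).trans (hCb hz.1 hy)
  · have i1 := intervalIntegrable_of_bounded (S.vaa_meas ha r)
      (fun s => S.vaa_le a r s ha) t (t + h)
    have i2 := intervalIntegrable_of_bounded (S.vrr_meas ha r)
      (fun s => S.vrr_le a r s ha) t (t + h)
    have i3 : IntervalIntegrable (fun s => p / r * vr a r s) MeasureTheory.volume t (t + h) :=
      ((S.vr_time a r ha).intervalIntegrable _ _).const_mul _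
    rw [← stek_const_mul, ← stek_add i1 i2, ← stek_add (i1.add i2) i3, stek,
      intervalIntegral.integral_eq_sub_of_hasDerivAt (f := v a r)
        (fun s _ => S.heat a r s ha hr) ((S.heat_cont a r ha hr).intervalIntegrable _ _), dquot,
      div_eq_inv_mul]
  · have := stek_tendsto (h := h) (F := fun a s => va a r s) (l := 𝓝[>] 0) (C := M) (t := t)
      (by filter_upwards [self_mem_nhdsWithin] with a ha using (S.va_time a r ha).measurable)
      (by filter_upwards [self_mem_nhdsWithin] with a ha s using S.va_le a r s ha)
      (fun s => S.flux r s)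
    convert this using 2
    rw [stek, stek, intervalIntegral.integral_neg, mul_neg]

/-- Half-Hölder continuity in time on the boundary. -/
theorem boundary_holder (S : Sol2 q p M C v va vr vaa vrr) {r s t K B : ℝ}
    (hr : 0 < r) (hst : t < s) (hK : ∀ a, 0 < a → a ^ 2 ≤ s - t → ∀ τ ∈ Icc t s,
      |va a r τ| ≤ K)
    (hB : ∀ a, 0 < a → a ^ 2 = s - t → ∀ τ ∈ Icc t s,
      |vaa a r τ + vrr a r τ + p / r * vr a r τ| ≤ B / a) :
    |v 0 r s - v 0 r t| ≤ (2 * K + B) * √(s - t) := by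
  set a := √(s - t) with ha
  have ha0 : 0 < a := Real.sqrt_pos.2 (by linarith)
  have hsq : a ^ 2 = s - t := Real.sq_sqrt (by linarith)
  have h1 : ∀ τ ∈ Icc t s, |v a r τ - v 0 r τ| ≤ K * a := fun τ hτ => by
    obtain ⟨ξ, hξ, h⟩ := exists_hasDerivAt_eq_slope (fun x => v x r τ) (fun x => va x r τ) ha0
      (by
        have := S.cont.comp (by fun_prop : Continuous fun x : ℝ => (x, r, τ))
        exact this.continuousOn)
      (fun x hx => S.hasA x r τ hx.1)
    rw [sub_zero, eq_div_iff ha0.ne'] at h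
    rw [← h, abs_mul, abs_of_pos ha0]
    gcongr
    exact hK ξ hξ.1 (by nlinarith [hξ.1, hξ.2]) τ hτ
  have h2 : |v a r s - v a r t| ≤ B * a := by
    have := (convex_Icc t s).norm_image_sub_le_of_norm_hasDerivWithin_le (f := v a r)
      (f' := fun τ => vaa a r τ + vrr a r τ + p / r * vr a r τ) (C := B / a) (x := t) (y := s)
      (fun τ _ => (S.heat a r τ ha0 hr).hasDerivWithinAt) (fun τ hτ => hB a ha0 hsq τ hτ)
      ⟨le_rfl, hst.le⟩ ⟨hst.le, le_rfl⟩
    rw [Real.norm_eq_abs, Real.norm_eq_abs, abs_of_pos (by linarith : 0 < s - t), ← hsq] at this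
    refine this.trans (le_of_eq ?_)
    field_simp
  have e1 := _root_.abs_le.1 (h1 s ⟨hst.le, le_rfl⟩)
  have e2 := _root_.abs_le.1 (h1 t ⟨le_rfl, hst.le⟩)
  have e3 := _root_.abs_le.1 h2
  rw [_root_.abs_le]; constructor <;> linarith [e1.1, e1.2, e2.1, e2.2, e3.1, e3.2]

/-- The commutator between averaging in time and the nonlinear flux is negligible. -/
theorem commutator_small (S : Sol2 q p M C v va vr vaa vrr) (hq : 1 < q) (hp : 0 ≤ p) {k η : ℝ}
    (hk : 0 < k) (hη : 0 < η) :
    ∃ h₀ > 0, ∀ h, 0 < h → h < h₀ → ∀ r ≥ k, ∀ t,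
      (stek h (fun s => v 0 r s ^ q) t - stek h (v 0 r) t ^ q) * |dquot h (v 0 r) t| ≤ η := by
  have hM := S.M_pos
  have hC : 0 ≤ C := by
    have := (abs_nonneg _).trans (S.vaa_le 1 0 0 one_pos)
    simpa using this
  set A := 2 * M + (2 * C + p / k * M) with hA
  have hA0 : 0 < A := by positivity
  have hold : ∀ r ≥ k, ∀ t s, t < s → s ≤ t + 1 → |v 0 r s - v 0 r t| ≤ A * √(s - t) := by
    intro r hr t s hts hs
    have hr0 : 0 < r := hk.trans_le hr
    refine S.boundary_holder hr0 hts (fun a ha _ τ _ => S.va_le a r τ ha) ?_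
    intro a ha ha2 τ _
    have ha1 : a ≤ 1 := by nlinarith
    have e1 := S.vaa_le a r τ ha
    have e2 := S.vrr_le a r τ ha
    have e3 : |p / r * vr a r τ| ≤ p / k * M := by
      rw [abs_mul, abs_of_nonneg (by positivity : 0 ≤ p / r)]
      gcongr
      exact S.vr_le a r τ ha
    have e4 : p / k * M ≤ p / k * M / a := by
      rw [le_div_iff₀ ha]; nlinarith [(by positivity : 0 ≤ p / k * M)]
    calc _ ≤ |vaa a r τ| + |vrr a r τ| + |p / r * vr a r τ| := abs_add_three _ _ _
      _ ≤ C / a + C / a + p / k * M / a := by linarith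
      _ = _ := by ring
  have hosc : ∀ r ≥ k, ∀ t h, 0 < h → h ≤ 1 → ∀ s ∈ Icc t (t + h),
      |v 0 r s - v 0 r t| ≤ A * √h := by
    intro r hr t h hh h1 s hs
    rcases hs.1.eq_or_lt with rfl | h2
    · simp; positivity
    · refine (hold r hr t s h2 (by linarith [hs.2])).trans ?_
      gcongr; linarith [hs.2]
  have huc : UniformContinuousOn (fun x : ℝ => x ^ (q - 1)) (Icc 0 M) :=
    isCompact_Icc.uniformContinuousOn_of_continuous
      (continuousOn_id.rpow_const fun x _ => Or.inr (by linarith))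
  rw [Metric.uniformContinuousOn_iff] at huc
  obtain ⟨δ, hδ, hδ'⟩ := huc (η / (q * (2 * A) * A)) (by positivity)
  refine ⟨min 1 ((δ / (2 * A + 1)) ^ 2), by positivity, fun h hh hh0 r hr t => ?_⟩
  have hh1 : h ≤ 1 := (hh0.trans_le (min_le_left _ _)).le
  have hsh : √h < δ / (2 * A + 1) := by
    rw [Real.sqrt_lt' (by positivity)]; exact hh0.trans_le (min_le_right _ _)
  have hsh0 : 0 < √h := Real.sqrt_pos.2 hh
  have hAδ : 2 * A * √h < δ := by
    rw [lt_div_iff₀ (by positivity)] at hsh; nlinarith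
  have hV : |dquot h (v 0 r) t| ≤ A / √h := by
    rw [dquot, abs_div, abs_of_pos hh, div_le_div_iff₀ hh hsh0]
    have h1 := hosc r hr t h hh hh1 (t + h) ⟨by linarith, le_rfl⟩
    have h2 : √h * √h = h := Real.mul_self_sqrt hh.le
    nlinarith
  have hc := S.time_cont 0 r
  have hcq : Continuous fun s => v 0 r s ^ q := hc.rpow_const fun s => Or.inr (by linarith)
  set U := stek h (v 0 r) t with hU
  have hU0 : 0 < U := stek_pos hh hc (S.pos 0 r) t
  have hUM : U ≤ M := (le_abs_self _).trans (abs_stek_le hh (S.abs_le 0 r))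
  have hUv : |U - v 0 r t| ≤ A * √h := by
    have l1 : stek h (v 0 r) t ≤ stek h (fun _ => v 0 r t + A * √h) t :=
      stek_mono hh (hc.intervalIntegrable _ _) intervalIntegrable_const fun s hs => by
        have := _root_.abs_le.1 (hosc r hr t h hh hh1 s hs); linarith [this.2]
    have l2 : stek h (fun _ => v 0 r t - A * √h) t ≤ stek h (v 0 r) t :=
      stek_mono hh intervalIntegrable_const (hc.intervalIntegrable _ _) fun s hs => by
        have := _root_.abs_le.1 (hosc r hr t h hh hh1 s hs); linarith [this.1]
    rw [stek_const hh] at l1 l2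
    rw [_root_.abs_le]; constructor <;> linarith
  have hvU : ∀ s ∈ Icc t (t + h), |v 0 r s - U| ≤ 2 * A * √h := fun s hs => by
    have h1 := _root_.abs_le.1 (hosc r hr t h hh hh1 s hs)
    have h2 := _root_.abs_le.1 hUv
    rw [_root_.abs_le]; constructor <;> linarith [h1.1, h1.2, h2.1, h2.2]
  set e := η / (q * (2 * A) * A) with he
  have hup : stek h (fun s => v 0 r s ^ q) t ≤
      stek h (fun s => (U ^ q + q * e * (2 * A * √h)) + q * U ^ (q - 1) * (v 0 r s - U)) t := by
    refine stek_mono hh (hcq.intervalIntegrable _ _)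
      (Continuous.intervalIntegrable (by fun_prop) _ _) fun s hs => ?_
    have h1 := rpow_tangent_le hq.le hU0.le (S.pos 0 r s)
    have h2 := hvU s hs
    have h3 := (hδ' (v 0 r s) ⟨(S.pos 0 r s).le, S.le 0 r s⟩ U ⟨hU0.le, hUM⟩ (by
      rw [Real.dist_eq]; linarith)).le
    rw [Real.dist_eq] at h3
    have h4 : (v 0 r s ^ (q - 1) - U ^ (q - 1)) * (v 0 r s - U) ≤ e * (2 * A * √h) :=
      (le_abs_self _).trans (by rw [abs_mul]; gcongr)
    nlinarith
  rw [stek_add intervalIntegrable_const (Continuous.intervalIntegrable (by fun_prop) _ _),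
    stek_const hh, stek_const_mul] at hup
  simp only [sub_eq_add_neg] at hup
  rw [stek_add (hc.intervalIntegrable _ _) intervalIntegrable_const, stek_const hh, ← hU] at hup
  have hj := S.rpow_stek_le hq hh 0 r t
  rw [← hU] at hj
  calc (stek h (fun s => v 0 r s ^ q) t - U ^ q) * |dquot h (v 0 r) t|
      ≤ (q * e * (2 * A * √h)) * (A / √h) := by
        gcongr
        linarith
    _ = η := by rw [he]; field_simp

end Sol2

open MeasureTheory

theorem BddContOn.mono {α : Type*} [TopologicalSpace α] {f : α → ℝ} {s t : Set α}
    (h : BddContOn f t) (hst : s ⊆ t) : BddContOn f s :=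
  ⟨h.1.mono hst, h.2.imp fun _ hC x hx => hC x (hst hx)⟩

/-- The half-strip `(0, ∞) × [b - k, b + k]`. -/
abbrev strip (b k : ℝ) : Set (ℝ × ℝ) := Ioi 0 ×ˢ Icc (b - k) (b + k)

/-- The rectangle `(0, L] × [b - k, b + k]`. -/
abbrev rect (L b k : ℝ) : Set (ℝ × ℝ) := Ioc 0 L ×ˢ Icc (b - k) (b + k)

theorem rect_subset_strip (L b k : ℝ) : rect L b k ⊆ strip b k :=
  prod_mono (fun _ h => h.1) le_rfl

theorem strip_subset (b k : ℝ) : strip b k ⊆ Ioi 0 ×ˢ univ :=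
  prod_mono le_rfl (subset_univ _)

theorem bddContOn_inv_snd {b k p : ℝ} (hk : 0 < k) (hb : 2 * k ≤ b) :
    BddContOn (fun z : ℝ × ℝ => p / z.2) (strip b k) := by
  have h : ∀ z ∈ strip b k, k ≤ z.2 := fun z hz => by linarith [hz.2.1]
  refine BddContOn.of_bound (C := |p| / k)
    (continuousOn_const.div continuousOn_snd fun z hz => (hk.trans_le (h z hz)).ne') fun z hz => ?_
  rw [abs_div]
  exact div_le_div_of_nonneg_left (abs_nonneg _) hk ((h z hz).trans (le_abs_self _))

/-- Bounded `C¹` functions on the half-strip, with a trace at `a = 0`. -/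
structure C1Fn (b k : ℝ) (ψ ψa ψr : ℝ → ℝ → ℝ) : Prop where
  da : ∀ a > 0, ∀ r ∈ Icc (b - k) (b + k), HasDerivAt (fun s => ψ s r) (ψa a r) a
  dr : ∀ a > 0, ∀ r ∈ Icc (b - k) (b + k), HasDerivAt (fun s => ψ a s) (ψr a r) r
  bdd : BddContOn (fun z : ℝ × ℝ => ψ z.1 z.2) (strip b k)
  bdda : BddContOn (fun z : ℝ × ℝ => ψa z.1 z.2) (strip b k)
  bddr : BddContOn (fun z : ℝ × ℝ => ψr z.1 z.2) (strip b k)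
  trace : ∀ r ∈ Icc (b - k) (b + k), ContinuousWithinAt (fun a => ψ a r) (Ioi 0) 0

/-- Test functions for the integrated form of the equation. -/
structure TestFn (L b k : ℝ) (ψ ψa ψr : ℝ → ℝ → ℝ) : Prop extends C1Fn b k ψ ψa ψr where
  top : ∀ r ∈ Icc (b - k) (b + k), ψ L r = 0
  left : ∀ a > 0, ψ a (b - k) = 0
  right : ∀ a > 0, ψ a (b + k) = 0

theorem TestFn.mul {L b k : ℝ} {f fa fr ψ ψa ψr : ℝ → ℝ → ℝ} (hf : C1Fn b k f fa fr)
    (hψ : TestFn L b k ψ ψa ψr) :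
    TestFn L b k (fun a r => f a r * ψ a r) (fun a r => fa a r * ψ a r + f a r * ψa a r)
      (fun a r => fr a r * ψ a r + f a r * ψr a r) where
  da a ha r hr := (hf.da a ha r hr).mul (hψ.da a ha r hr)
  dr a ha r hr := (hf.dr a ha r hr).mul (hψ.dr a ha r hr)
  bdd := hf.bdd.mul hψ.bdd
  bdda := (hf.bdda.mul hψ.bdd).add (hf.bdd.mul hψ.bdda)
  bddr := (hf.bddr.mul hψ.bdd).add (hf.bdd.mul hψ.bddr)
  trace r hr := (hf.trace r hr).mul (hψ.trace r hr)
  top r hr := by rw [hψ.top r hr, mul_zero]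
  left a ha := by rw [hψ.left a ha, mul_zero]
  right a ha := by rw [hψ.right a ha, mul_zero]

theorem Cut.testFn {p k b L K : ℝ} {ξ ξ₁ ξ₂ χ χ₁ χ₂ : ℝ → ℝ} (X : Cut p k b L K ξ ξ₁ ξ₂ χ χ₁ χ₂) :
    TestFn L b k (fun a r => ξ a * χ r) (fun a r => ξ₁ a * χ r) (fun a r => ξ a * χ₁ r) := by
  have cξ : Continuous ξ := continuous_iff_continuousAt.2 fun a => (X.hξ a).continuousAt
  have cξ₁ : Continuous ξ₁ := continuous_iff_continuousAt.2 fun a => (X.hξ₁ a).continuousAt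
  have cχ : Continuous χ := continuous_iff_continuousAt.2 fun a => (X.hχ a).continuousAt
  have cχ₁ : Continuous χ₁ := continuous_iff_continuousAt.2 fun a => (X.hχ₁ a).continuousAt
  have bξ : BddContOn (fun z : ℝ × ℝ => ξ z.1) (strip b k) :=
    .of_bound (C := 1) (by fun_prop) fun z hz => by
      rw [abs_of_nonneg (X.ξ_nonneg _)]; exact X.ξ_le _ (le_of_lt hz.1)
  have bχ : BddContOn (fun z : ℝ × ℝ => χ z.2) (strip b k) :=
    .of_bound (C := 1) (by fun_prop) fun z hz => by
      rw [abs_of_nonneg (X.χ_nonneg _)]; exact X.χ_le _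
  have hsq : ∀ x y : ℝ, 0 ≤ y → y ≤ 1 → x ^ 2 ≤ K ^ 2 / k ^ 2 * y → |x| ≤ |K / k| := by
    intro x y hy hy1 h
    refine sq_le_sq.1 (h.trans ?_)
    rw [div_pow]
    exact mul_le_of_le_one_right (by positivity) hy1
  have bξ₁ : BddContOn (fun z : ℝ × ℝ => ξ₁ z.1) (strip b k) :=
    .of_bound (by fun_prop) fun z hz =>
      hsq _ _ (X.ξ_nonneg _) (X.ξ_le _ (le_of_lt hz.1)) (X.ξ₁_sq _ (le_of_lt hz.1))
  have bχ₁ : BddContOn (fun z : ℝ × ℝ => χ₁ z.2) (strip b k) :=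
    .of_bound (by fun_prop) fun z hz => hsq _ _ (X.χ_nonneg _) (X.χ_le _) (X.χ₁_sq _)
  exact
  { da := fun a _ r _ => (X.hξ a).mul_const _
    dr := fun a _ r _ => (X.hχ r).const_mul _
    bdd := bξ.mul bχ
    bdda := bξ₁.mul bχ
    bddr := bξ.mul bχ₁
    trace := fun r _ => by
      have : Continuous fun a => ξ a * χ r := by fun_prop
      exact this.continuousWithinAt
    top := fun r _ => by simp [X.ξ_L]
    left := fun a _ => by simp [X.χ_left]
    right := fun a _ => by simp [X.χ_right] }

theorem divergence_rect' {L b k : ℝ} (hL : 0 < L) (hk : 0 < k) {P Pa Q Qr F : ℝ → ℝ → ℝ}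
    {P0 : ℝ → ℝ}
    (hP : ∀ a > 0, ∀ r ∈ Icc (b - k) (b + k), HasDerivAt (fun s => P s r) (Pa a r) a)
    (hQ : ∀ a > 0, ∀ r ∈ Icc (b - k) (b + k), HasDerivAt (fun s => Q a s) (Qr a r) r)
    (cPa : ContinuousOn (fun z : ℝ × ℝ => Pa z.1 z.2) (strip b k))
    (cQr : ContinuousOn (fun z : ℝ × ℝ => Qr z.1 z.2) (strip b k))
    (bP : BddContOn (fun z : ℝ × ℝ => P z.1 z.2) (strip b k))
    (bF : BddContOn (fun z : ℝ × ℝ => F z.1 z.2) (strip b k))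
    (hF : ∀ a > 0, ∀ r ∈ Icc (b - k) (b + k), Pa a r + Qr a r = F a r)
    (hPL : ∀ r ∈ Icc (b - k) (b + k), P L r = 0)
    (hQ1 : ∀ a > 0, Q a (b - k) = 0) (hQ2 : ∀ a > 0, Q a (b + k) = 0)
    (hP0 : ∀ r ∈ Icc (b - k) (b + k), Tendsto (fun a => P a r) (𝓝[>] 0) (𝓝 (P0 r))) :
    ∫ z in rect L b k, F z.1 z.2 = -∫ r in Icc (b - k) (b + k), P0 r := by
  obtain ⟨C, hC⟩ := bF.2
  obtain ⟨C', hC'⟩ := bP.2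
  rw [← divergence_rect (N := max C C') hL (by linarith) hP hQ bP.1 cPa cQr
    (fun a ha r hr => by rw [hF a ha.1 r hr]; exact (hC (a, r) ⟨ha.1, hr⟩).trans (le_max_left _ _))
    (fun a ha r hr => (hC' (a, r) ⟨ha.1, hr⟩).trans (le_max_right _ _)) hPL hQ1 hQ2 hP0]
  exact setIntegral_congr_fun measurableSet_rect fun z hz => (hF z.1 hz.1.1 z.2 hz.2).symm

namespace USol
variable {q p N : ℝ} {U Ua Ur Uaa Urr V Va Vr : ℝ → ℝ → ℝ → ℝ} {g : ℝ → ℝ → ℝ} {L b k : ℝ}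

theorem bU (H : USol q p N U Ua Ur Uaa Urr V Va Vr g) (t : ℝ) :
    BddContOn (fun z : ℝ × ℝ => U z.1 z.2 t) (strip b k) :=
  .of_bound (H.U_cont t).continuousOn fun z _ => H.U_le z.1 z.2 t

theorem bV (H : USol q p N U Ua Ur Uaa Urr V Va Vr g) (t : ℝ) :
    BddContOn (fun z : ℝ × ℝ => V z.1 z.2 t) (strip b k) :=
  .of_bound (H.V_cont t).continuousOn fun z _ => H.V_le z.1 z.2 t

theorem bUa (H : USol q p N U Ua Ur Uaa Urr V Va Vr g) (t : ℝ) :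
    BddContOn (fun z : ℝ × ℝ => Ua z.1 z.2 t) (strip b k) :=
  .of_bound ((H.Ua_cont t).mono (strip_subset b k)) fun z hz => H.Ua_le z.1 z.2 t hz.1

theorem bUr (H : USol q p N U Ua Ur Uaa Urr V Va Vr g) (t : ℝ) :
    BddContOn (fun z : ℝ × ℝ => Ur z.1 z.2 t) (strip b k) :=
  .of_bound ((H.Ur_cont t).mono (strip_subset b k)) fun z hz => H.Ur_le z.1 z.2 t hz.1

theorem bVa (H : USol q p N U Ua Ur Uaa Urr V Va Vr g) (t : ℝ) :
    BddContOn (fun z : ℝ × ℝ => Va z.1 z.2 t) (strip b k) :=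
  .of_bound ((H.Va_cont t).mono (strip_subset b k)) fun z hz => H.Va_le z.1 z.2 t hz.1

theorem bVr (H : USol q p N U Ua Ur Uaa Urr V Va Vr g) (t : ℝ) :
    BddContOn (fun z : ℝ × ℝ => Vr z.1 z.2 t) (strip b k) :=
  .of_bound ((H.Vr_cont t).mono (strip_subset b k)) fun z hz => H.Vr_le z.1 z.2 t hz.1

theorem c1U (H : USol q p N U Ua Ur Uaa Urr V Va Vr g) (t : ℝ) :
    C1Fn b k (fun a r => U a r t) (fun a r => Ua a r t) (fun a r => Ur a r t) where
  da a ha r _ := H.hasUa a r t ha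
  dr a ha r _ := H.hasUr a r t ha
  bdd := H.bU t
  bdda := H.bUa t
  bddr := H.bUr t
  trace r _ := ((H.U_cont t).comp (by fun_prop : Continuous fun a : ℝ => (a, r))).continuousWithinAt

theorem c1V (H : USol q p N U Ua Ur Uaa Urr V Va Vr g) (t : ℝ) :
    C1Fn b k (fun a r => V a r t) (fun a r => Va a r t) (fun a r => Vr a r t) where
  da a ha r _ := H.hasVa a r t ha
  dr a ha r _ := H.hasVr a r t ha
  bdd := H.bV t
  bdda := H.bVa t
  bddr := H.bVr t
  trace r _ := ((H.V_cont t).comp (by fun_prop : Continuous fun a : ℝ => (a, r))).continuousWithinAt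

/-- Integrated form of the equation. -/
theorem green (H : USol q p N U Ua Ur Uaa Urr V Va Vr g) (hL : 0 < L) (hk : 0 < k)
    (hb : 2 * k ≤ b) (t : ℝ) {ψ ψa ψr : ℝ → ℝ → ℝ} (hψ : TestFn L b k ψ ψa ψr) :
    ∫ z in rect L b k, ((V z.1 z.2 t - p / z.2 * Ur z.1 z.2 t) * ψ z.1 z.2 +
      (Ua z.1 z.2 t * ψa z.1 z.2 + Ur z.1 z.2 t * ψr z.1 z.2)) =
    ∫ r in Icc (b - k) (b + k), g r t * ψ 0 r := by
  have := divergence_rect' (P := fun a r => Ua a r t * ψ a r) (Q := fun a r => Ur a r t * ψ a r)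
    (Pa := fun a r => Uaa a r t * ψ a r + Ua a r t * ψa a r)
    (Qr := fun a r => Urr a r t * ψ a r + Ur a r t * ψr a r)
    (F := fun a r => (V a r t - p / r * Ur a r t) * ψ a r + (Ua a r t * ψa a r + Ur a r t * ψr a r))
    (P0 := fun r => -g r t * ψ 0 r) hL hk
    (fun a ha r hr => (H.hasUaa a r t ha).mul (hψ.da a ha r hr))
    (fun a ha r hr => (H.hasUrr a r t ha).mul (hψ.dr a ha r hr))
    ((((H.Uaa_cont t).mono (strip_subset b k)).mul hψ.bdd.1).add ((H.bUa t).mul hψ.bdda).1)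
    ((((H.Urr_cont t).mono (strip_subset b k)).mul hψ.bdd.1).add ((H.bUr t).mul hψ.bddr).1)
    ((H.bUa t).mul hψ.bdd)
    ((((H.bV t).sub ((bddContOn_inv_snd hk hb).mul (H.bUr t))).mul hψ.bdd).add
      (((H.bUa t).mul hψ.bdda).add ((H.bUr t).mul hψ.bddr)))
    (fun a ha r hr => by
      rw [H.heat a r t ha (by linarith [hr.1])]; ring)
    (fun r hr => by rw [hψ.top r hr, mul_zero])
    (fun a ha => by rw [hψ.left a ha, mul_zero])
    (fun a ha => by rw [hψ.right a ha, mul_zero])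
    (fun r hr => (H.flux r t).mul (hψ.trace r hr))
  rw [this, ← integral_neg]
  simp only [neg_mul, neg_neg]

end USol

theorem square_pointwise {U V Ua Ur φ fa fr ρ A B C₁ : ℝ} (hU : 0 ≤ U) (hUC : U ≤ C₁)
    (h0 : 0 ≤ φ) (h1 : φ ≤ 1) (hρ : ρ ^ 2 ≤ A) (hf : fa ^ 2 + fr ^ 2 ≤ B * φ) :
    U * V * φ ^ 2 ≤ (V - ρ * Ur) * (U * (φ * φ)) + (Ua * (Ua * (φ * φ) + U * (fa * φ + φ * fa)) +
      Ur * (Ur * (φ * φ) + U * (fr * φ + φ * fr))) - 1 / 2 * ((Ua ^ 2 + Ur ^ 2) * φ ^ 2) +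
      C₁ * (A + 4 * B) * (U * φ) := by
  have e1 : ρ ^ 2 * φ ^ 2 ≤ A * φ :=
    mul_le_mul hρ (by nlinarith) (sq_nonneg _) ((sq_nonneg _).trans hρ)
  have e2 : U ^ 2 * (ρ ^ 2 * φ ^ 2 + 4 * (fa ^ 2 + fr ^ 2)) ≤ U * C₁ * (A * φ + 4 * (B * φ)) :=
    mul_le_mul (by nlinarith) (by linarith) (by positivity) (mul_nonneg hU (hU.trans hUC))
  nlinarith [sq_nonneg (1 / 2 * Ur * φ - ρ * U * φ), sq_nonneg (1 / 2 * Ua * φ + 2 * U * fa),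
    sq_nonneg (1 / 2 * Ur * φ + 2 * U * fr)]

theorem energy_pointwise {V Ua Ur Va Vr φ fa fr ρ A B : ℝ}
    (h0 : 0 ≤ φ) (h1 : φ ≤ 1) (hρ : ρ ^ 2 ≤ A) (hB : 0 ≤ B)
    (hf : fa ^ 2 + fr ^ 2 ≤ B * φ) :
    (Ua * Va + Ur * Vr) * φ ^ 4 ≤ (V - ρ * Ur) * (V * (φ * (φ * (φ * φ)))) +
      (Ua * (Va * (φ * (φ * (φ * φ))) +
        V * (fa * (φ * (φ * φ)) + φ * (fa * (φ * φ) + φ * (fa * φ + φ * fa)))) +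
      Ur * (Vr * (φ * (φ * (φ * φ))) +
        V * (fr * (φ * (φ * φ)) + φ * (fr * (φ * φ) + φ * (fr * φ + φ * fr))))) -
      1 / 2 * (V ^ 2 * φ ^ 4) + (A + 16 * B) * ((Ua ^ 2 + Ur ^ 2) * φ ^ 2) := by
  have hφ2 : φ ^ 4 ≤ φ ^ 2 := pow_le_pow_of_le_one h0 h1 (by norm_num)
  have e1 : ρ ^ 2 * (Ur ^ 2 * φ ^ 4) ≤ A * ((Ua ^ 2 + Ur ^ 2) * φ ^ 2) :=
    mul_le_mul hρ (mul_le_mul (by nlinarith) hφ2 (by positivity) (by positivity))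
      (by positivity) ((sq_nonneg _).trans hρ)
  have e2 : 16 * φ ^ 2 * (Ua * fa + Ur * fr) ^ 2 ≤ 16 * B * ((Ua ^ 2 + Ur ^ 2) * φ ^ 2) := by
    have e3 : (Ua * fa + Ur * fr) ^ 2 ≤ (Ua ^ 2 + Ur ^ 2) * (fa ^ 2 + fr ^ 2) := by
      nlinarith [sq_nonneg (Ua * fr - Ur * fa)]
    have e4 : (Ua ^ 2 + Ur ^ 2) * (fa ^ 2 + fr ^ 2) ≤ (Ua ^ 2 + Ur ^ 2) * B :=
      mul_le_mul_of_nonneg_left (hf.trans (by nlinarith)) (by positivity)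
    nlinarith [mul_le_mul_of_nonneg_left (e3.trans e4) (sq_nonneg φ)]
  nlinarith [sq_nonneg (1 / 2 * V * φ ^ 2 - ρ * Ur * φ ^ 2),
    sq_nonneg (1 / 2 * V * φ ^ 2 + 4 * φ * (Ua * fa + Ur * fr))]

namespace USol
variable {q p N : ℝ} {U Ua Ur Uaa Urr V Va Vr : ℝ → ℝ → ℝ → ℝ} {g : ℝ → ℝ → ℝ} {L b k K : ℝ}
  {ξ ξ₁ ξ₂ χ χ₁ χ₂ : ℝ → ℝ}

theorem setIntegral_cut_le (X : Cut p k b L K ξ ξ₁ ξ₂ χ χ₁ χ₂) (hk : 0 < k) :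
    ∫ r in Icc (b - k) (b + k), χ r ≤ 2 * k := by
  have cχ : Continuous χ := continuous_iff_continuousAt.2 fun a => (X.hχ a).continuousAt
  have h := setIntegral_mono_on (μ := volume) (g := fun _ => (1:ℝ)) (cχ.integrableOn_Icc)
    (integrableOn_const measure_Icc_lt_top.ne) (measurableSet_Icc (a := b - k) (b := b + k))
    fun r _ => X.χ_le r
  refine h.trans (le_of_eq ?_)
  rw [setIntegral_const, smul_eq_mul, mul_one, measureReal_def, Real.volume_Icc,
    ENNReal.toReal_ofReal (by linarith)]
  ring

/-- Lower bound for the growth of the weighted mass. -/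
theorem mass_growth (H : USol q p N U Ua Ur Uaa Urr V Va Vr g)
    (X : Cut p k b L K ξ ξ₁ ξ₂ χ χ₁ χ₂) (hq : 1 < q) (hL : 0 < L) (hk : 0 < k) (hb : 2 * k ≤ b)
    (hK : 0 ≤ K) (t : ℝ) :
    1 / k ^ 2 * (∫ z in rect L b k, U z.1 z.2 t * (ξ z.1 * χ z.2)) +
      1 / 2 * (∫ r in Icc (b - k) (b + k), g r t * χ r) -
      2 * K * (2 * K) ^ (1 / (q - 1)) * k ^ (-(1 / (q - 1))) ≤
    ∫ z in rect L b k, V z.1 z.2 t * (ξ z.1 * χ z.2) := by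
  have cξ₁ : Continuous ξ₁ := continuous_iff_continuousAt.2 fun a => (X.hξ₁ a).continuousAt
  have cξ : Continuous ξ := continuous_iff_continuousAt.2 fun a => (X.hξ a).continuousAt
  have cχ : Continuous χ := continuous_iff_continuousAt.2 fun a => (X.hχ a).continuousAt
  have cχ₁ : Continuous χ₁ := continuous_iff_continuousAt.2 fun a => (X.hχ₁ a).continuousAt
  have T := X.testFn
  have br := bddContOn_inv_snd (p := p) hk hb
  have br1 := bddContOn_inv_snd (p := 1) hk hb
  have bξχ₂ : BddContOn (fun z : ℝ × ℝ => ξ z.1 * χ₂ z.2) (strip b k) := by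
    obtain ⟨B, hB⟩ := isCompact_Icc.exists_bound_of_continuousOn
      (X.cχ₂.continuousOn (s := Icc (b - k) (b + k)))
    have := X.cχ₂
    refine .of_bound (C := 1 * B) (by fun_prop) fun z hz => ?_
    rw [abs_mul, abs_of_nonneg (X.ξ_nonneg _)]
    exact mul_le_mul (X.ξ_le _ (le_of_lt hz.1)) (hB _ hz.2) (abs_nonneg _) zero_le_one
  have bξ₂χ : BddContOn (fun z : ℝ × ℝ => ξ₂ z.1 * χ z.2) (strip b k) := by
    obtain ⟨B, hB⟩ := X.ξ₂_bdd
    have := X.cξ₂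
    refine .of_bound (C := B * 1) (by fun_prop) fun z hz => ?_
    rw [abs_mul, abs_of_nonneg (X.χ_nonneg z.2)]
    exact mul_le_mul (hB _ (le_of_lt hz.1)) (X.χ_le _) (X.χ_nonneg _)
      ((abs_nonneg _).trans (hB _ (le_of_lt hz.1)))
  have bS : BddContOn (fun z : ℝ × ℝ => U z.1 z.2 t * (ξ₂ z.1 * χ z.2 + ξ z.1 * χ₂ z.2 -
      (p / z.2 * (ξ z.1 * χ₁ z.2) - p / z.2 * (1 / z.2) * (ξ z.1 * χ z.2)))) (strip b k) :=
    (H.bU t).mul ((bξ₂χ.add bξχ₂).sub ((br.mul T.bddr).sub ((br.mul br1).mul T.bdd)))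
  have bG : BddContOn (fun z : ℝ × ℝ => Ua z.1 z.2 t * (ξ₁ z.1 * χ z.2) +
      Ur z.1 z.2 t * (ξ z.1 * χ₁ z.2)) (strip b k) :=
    ((H.bUa t).mul T.bdda).add ((H.bUr t).mul T.bddr)
  have bI : BddContOn (fun z : ℝ × ℝ => (V z.1 z.2 t - p / z.2 * Ur z.1 z.2 t) * (ξ z.1 * χ z.2) +
      (Ua z.1 z.2 t * (ξ₁ z.1 * χ z.2) + Ur z.1 z.2 t * (ξ z.1 * χ₁ z.2))) (strip b k) :=
    (((H.bV t).sub (br.mul (H.bUr t))).mul T.bdd).add bG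
  have bF : BddContOn (fun z : ℝ × ℝ => Ua z.1 z.2 t * (ξ₁ z.1 * χ z.2) +
      Ur z.1 z.2 t * (ξ z.1 * χ₁ z.2) - p / z.2 * Ur z.1 z.2 t * (ξ z.1 * χ z.2) +
      U z.1 z.2 t * (ξ₂ z.1 * χ z.2 + ξ z.1 * χ₂ z.2 -
      (p / z.2 * (ξ z.1 * χ₁ z.2) - p / z.2 * (1 / z.2) * (ξ z.1 * χ z.2)))) (strip b k) :=
    (bG.sub ((br.mul (H.bUr t)).mul T.bdd)).add bS
  have h1 := H.green hL hk hb t T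
  have h2 := divergence_rect' (P := fun a r => U a r t * (ξ₁ a * χ r))
    (Q := fun a r => U a r t * (ξ a * χ₁ r) - p * (r⁻¹ * (U a r t * (ξ a * χ r))))
    (Pa := fun a r => Ua a r t * (ξ₁ a * χ r) + U a r t * (ξ₂ a * χ r))
    (Qr := fun a r => Ur a r t * (ξ a * χ₁ r) + U a r t * (ξ a * χ₂ r) -
      p * (-(r ^ 2)⁻¹ * (U a r t * (ξ a * χ r)) +
        r⁻¹ * (Ur a r t * (ξ a * χ r) + U a r t * (ξ a * χ₁ r))))
    (F := fun a r => Ua a r t * (ξ₁ a * χ r) + Ur a r t * (ξ a * χ₁ r) -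
      p / r * Ur a r t * (ξ a * χ r) + U a r t * (ξ₂ a * χ r + ξ a * χ₂ r -
      (p / r * (ξ a * χ₁ r) - p / r * (1 / r) * (ξ a * χ r))))
    (P0 := fun r => U 0 r t * (ξ₁ 0 * χ r)) hL hk
    (fun a ha r hr => (H.hasUa a r t ha).mul ((X.hξ₁ a).mul_const _))
    (fun a ha r hr => ((H.hasUr a r t ha).mul ((X.hχ₁ r).const_mul _)).sub
      (((hasDerivAt_inv (by linarith [hr.1] : r ≠ 0)).mul
        ((H.hasUr a r t ha).mul ((X.hχ r).const_mul _))).const_mul p))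
    (((H.bUa t).mul T.bdda).add ((H.bU t).mul bξ₂χ)).1 ?_ ((H.bU t).mul T.bdda) bF ?_
    (fun r hr => by simp [X.ξ₁_L])
    (fun a ha => by simp [X.χ_left, X.χ₁_left])
    (fun a ha => by simp [X.χ_right, X.χ₁_right])
    (fun r hr => by
      have : Continuous fun a => U a r t * (ξ₁ a * χ r) :=
        ((H.U_cont t).comp (by fun_prop : Continuous fun a : ℝ => (a, r))).mul (by fun_prop)
      exact this.continuousWithinAt)
  · have hm : MeasurableSet (rect L b k) := measurableSet_rect
    have hv : volume (rect L b k) ≠ ⊤ := volume_rect_ne_top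
    have hsub := rect_subset_strip L b k
    have e1 : ∫ z in rect L b k, V z.1 z.2 t * (ξ z.1 * χ z.2) =
        (∫ r in Icc (b - k) (b + k), g r t * χ r) +
        (∫ r in Icc (b - k) (b + k), U 0 r t * (ξ₁ 0 * χ r)) +
        ∫ z in rect L b k, U z.1 z.2 t * (ξ₂ z.1 * χ z.2 + ξ z.1 * χ₂ z.2 -
          (p / z.2 * (ξ z.1 * χ₁ z.2) - p / z.2 * (1 / z.2) * (ξ z.1 * χ z.2))) := by
      simp only [X.ξ_zero, one_mul] at h1
      rw [← h1, ← neg_eq_iff_eq_neg.2 h2, ← sub_eq_add_neg,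
        ← (bI.mono hsub).integral_sub (bF.mono hsub) hm hv,
        ← ((bI.sub bF).mono hsub).integral_add (bS.mono hsub) hm hv]
      refine setIntegral_congr_fun hm fun z _ => ?_
      ring
    have e2 : 1 / k ^ 2 * (∫ z in rect L b k, U z.1 z.2 t * (ξ z.1 * χ z.2)) ≤
        ∫ z in rect L b k, U z.1 z.2 t * (ξ₂ z.1 * χ z.2 + ξ z.1 * χ₂ z.2 -
          (p / z.2 * (ξ z.1 * χ₁ z.2) - p / z.2 * (1 / z.2) * (ξ z.1 * χ z.2))) := by
      rw [← integral_const_mul]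
      refine BddContOn.integral_mono ((((H.bU t).mul T.bdd).const_mul _).mono hsub) (bS.mono hsub)
        hm hv fun z hz => ?_
      have hz2 : 0 < z.2 := by linarith [hz.2.1]
      have h := mul_le_mul_of_nonneg_left (X.sub z.1 hz.1.1.le z.2 hz.2) (H.pos z.1 z.2 t).le
      refine le_trans (le_of_eq ?_) (h.trans (le_of_eq ?_))
      · ring
      · field_simp
    have cg := H.g_cont t
    have cU : Continuous fun r => U 0 r t :=
      (H.U_cont t).comp (by fun_prop : Continuous fun r : ℝ => ((0:ℝ), r))
    have e3 : -(1 / 2 * (∫ r in Icc (b - k) (b + k), g r t * χ r)) -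
        K / k * (2 * (K / k)) ^ (1 / (q - 1)) * (∫ r in Icc (b - k) (b + k), χ r) ≤
        ∫ r in Icc (b - k) (b + k), U 0 r t * (ξ₁ 0 * χ r) := by
      rw [← integral_const_mul, ← integral_const_mul, ← integral_neg,
        ← MeasureTheory.integral_sub (Continuous.integrableOn_Icc (by fun_prop))
          (Continuous.integrableOn_Icc (by fun_prop))]
      refine setIntegral_mono_on (Continuous.integrableOn_Icc (by fun_prop))
        (Continuous.integrableOn_Icc (by fun_prop)) measurableSet_Icc fun r _ => ?_
      have h := young_rpow hq (show 0 ≤ K / k by positivity) (H.pos 0 r t).le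
      have h' : -(1 / 2 * g r t) - K / k * (2 * (K / k)) ^ (1 / (q - 1)) ≤ U 0 r t * ξ₁ 0 := by
        nlinarith [H.jensen r t, mul_le_mul_of_nonneg_left X.ξ₁_zero (H.pos 0 r t).le]
      nlinarith [mul_le_mul_of_nonneg_right h' (X.χ_nonneg r)]
    have e4 : K / k * (2 * (K / k)) ^ (1 / (q - 1)) * (∫ r in Icc (b - k) (b + k), χ r) ≤
        2 * K * (2 * K) ^ (1 / (q - 1)) * k ^ (-(1 / (q - 1))) := by
      refine (mul_le_mul_of_nonneg_left (setIntegral_cut_le X hk) (by positivity)).trans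
        (le_of_eq ?_)
      rw [show 2 * (K / k) = 2 * K / k by ring, Real.div_rpow (by positivity) hk.le,
        Real.rpow_neg hk.le]
      field_simp
    linarith
  · have ci : ContinuousOn (fun z : ℝ × ℝ => z.2⁻¹) (strip b k) :=
      continuousOn_snd.inv₀ fun z hz => by linarith [hz.2.1]
    have ci2 : ContinuousOn (fun z : ℝ × ℝ => (z.2 ^ 2)⁻¹) (strip b k) :=
      (continuousOn_snd.pow 2).inv₀ fun z hz => by
        have : 0 < z.2 := by linarith [hz.2.1]
        exact (pow_pos this 2).ne'
    have cU := (H.bU t (b := b) (k := k)).1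
    exact (((H.bUr t).mul T.bddr).add ((H.bU t).mul bξχ₂)).1.sub (continuousOn_const.mul
      ((ci2.neg.mul (cU.mul T.bdd.1)).add
        (ci.mul (((H.bUr t).mul T.bdd).add ((H.bU t).mul T.bddr)).1)))
  · intro a ha r hr
    have : r ≠ 0 := by linarith [hr.1]
    field_simp
    ring

theorem hasDerivAt_mass (H : USol q p N U Ua Ur Uaa Urr V Va Vr g)
    (X : Cut p k b L K ξ ξ₁ ξ₂ χ χ₁ χ₂) (t : ℝ) :
    HasDerivAt (fun t => ∫ z in rect L b k, U z.1 z.2 t * (ξ z.1 * χ z.2))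
      (∫ z in rect L b k, V z.1 z.2 t * (ξ z.1 * χ z.2)) t := by
  have hsub := rect_subset_strip L b k
  refine hasDerivAt_setIntegral (C := N) measurableSet_rect volume_rect_ne_top
    (F := fun t z => U z.1 z.2 t * (ξ z.1 * χ z.2)) (F' := fun t z => V z.1 z.2 t * (ξ z.1 * χ z.2))
    (fun t => ((H.bU t).mul X.testFn.bdd).mono hsub)
    (fun t => ((H.bV t).mul X.testFn.bdd).mono hsub) (fun t z hz => ?_)
    (fun t z _ => (H.hasUt z.1 z.2 t).mul_const _) t
  rw [abs_mul, abs_of_nonneg (mul_nonneg (X.ξ_nonneg z.1) (X.χ_nonneg z.2))]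
  exact (mul_le_of_le_one_right (abs_nonneg _) (mul_le_one₀ (X.ξ_le _ hz.1.1.le) (X.χ_nonneg _)
    (X.χ_le _))).trans (H.V_le _ _ _)

theorem mass_nonneg (H : USol q p N U Ua Ur Uaa Urr V Va Vr g)
    (X : Cut p k b L K ξ ξ₁ ξ₂ χ χ₁ χ₂) (t : ℝ) :
    0 ≤ ∫ z in rect L b k, U z.1 z.2 t * (ξ z.1 * χ z.2) :=
  setIntegral_nonneg measurableSet_rect fun z _ =>
    mul_nonneg (H.pos _ _ _).le (mul_nonneg (X.ξ_nonneg _) (X.χ_nonneg _))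

theorem flux_nonneg (H : USol q p N U Ua Ur Uaa Urr V Va Vr g)
    (X : Cut p k b L K ξ ξ₁ ξ₂ χ χ₁ χ₂) (t : ℝ) :
    0 ≤ ∫ r in Icc (b - k) (b + k), g r t * χ r :=
  setIntegral_nonneg measurableSet_Icc fun r _ =>
    mul_nonneg ((Real.rpow_nonneg (H.pos 0 r t).le q).trans (H.jensen r t)) (X.χ_nonneg _)

/-- The weighted mass is bounded by `k ^ (2 - 1 / (q - 1))`. -/
theorem mass_le (H : USol q p N U Ua Ur Uaa Urr V Va Vr g)
    (X : Cut p k b L K ξ ξ₁ ξ₂ χ χ₁ χ₂) (hq : 1 < q) (hL : 0 < L) (hk : 0 < k) (hb : 2 * k ≤ b)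
    (hK : 0 ≤ K) (t : ℝ) :
    ∫ z in rect L b k, U z.1 z.2 t * (ξ z.1 * χ z.2) ≤
      k ^ 2 * (2 * K * (2 * K) ^ (1 / (q - 1)) * k ^ (-(1 / (q - 1)))) := by
  refine (le_of_deriv_ge_of_bounded (m := 1 / k ^ 2)
    (c := 2 * K * (2 * K) ^ (1 / (q - 1)) * k ^ (-(1 / (q - 1)))) (by positivity) (H.hasDerivAt_mass X)
    (fun t => ?_) (B := ∫ _z in rect L b k, N) (fun t => ?_) t).trans (le_of_eq (by field_simp))
  · linarith [H.mass_growth X hq hL hk hb hK t, H.flux_nonneg X t]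
  · refine BddContOn.integral_mono (((H.bU t).mul X.testFn.bdd).mono (rect_subset_strip L b k))
      (.const N) measurableSet_rect volume_rect_ne_top fun z hz => ?_
    exact (mul_le_of_le_one_right (H.pos _ _ _).le (mul_le_one₀ (X.ξ_le _ hz.1.1.le) (X.χ_nonneg _)
      (X.χ_le _))).trans ((le_abs_self _).trans (H.U_le _ _ _))

/-- The cut-off gradient is controlled by the cut-off. -/
theorem _root_.Cut.grad_sq_le (X : Cut p k b L K ξ ξ₁ ξ₂ χ χ₁ χ₂) {a : ℝ} (ha : 0 ≤ a) (r : ℝ) :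
    (ξ₁ a * χ r) ^ 2 + (ξ a * χ₁ r) ^ 2 ≤ 2 * K ^ 2 / k ^ 2 * (ξ a * χ r) := by
  have h1 := X.ξ_nonneg a
  have h2 := X.χ_nonneg r
  have h3 := X.ξ_le a ha
  have h4 := X.χ_le r
  have e1 : (ξ₁ a * χ r) ^ 2 ≤ K ^ 2 / k ^ 2 * ξ a * χ r := by
    rw [mul_pow]
    exact mul_le_mul (X.ξ₁_sq a ha) (by nlinarith) (by positivity) (by positivity)
  have e2 : (ξ a * χ₁ r) ^ 2 ≤ ξ a * (K ^ 2 / k ^ 2 * χ r) := by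
    rw [mul_pow]
    exact mul_le_mul (by nlinarith) (X.χ₁_sq r) (by positivity) (by positivity)
  refine (add_le_add e1 e2).trans (le_of_eq ?_)
  ring

theorem hasDerivAt_square (H : USol q p N U Ua Ur Uaa Urr V Va Vr g)
    (X : Cut p k b L K ξ ξ₁ ξ₂ χ χ₁ χ₂) (t : ℝ) :
    HasDerivAt (fun t => ∫ z in rect L b k, 1 / 2 * (U z.1 z.2 t ^ 2 * (ξ z.1 * χ z.2) ^ 2))
      (∫ z in rect L b k, U z.1 z.2 t * V z.1 z.2 t * (ξ z.1 * χ z.2) ^ 2) t := by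
  have hsub := rect_subset_strip L b k
  refine hasDerivAt_setIntegral (C := N * N) measurableSet_rect volume_rect_ne_top
    (F := fun t z => 1 / 2 * (U z.1 z.2 t ^ 2 * (ξ z.1 * χ z.2) ^ 2))
    (F' := fun t z => U z.1 z.2 t * V z.1 z.2 t * (ξ z.1 * χ z.2) ^ 2)
    (fun t => ((((H.bU t).pow 2).mul (X.testFn.bdd.pow 2)).const_mul _).mono hsub)
    (fun t => (((H.bU t).mul (H.bV t)).mul (X.testFn.bdd.pow 2)).mono hsub) (fun t z hz => ?_)
    (fun t z _ => ?_) t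
  · rw [abs_mul, abs_mul, abs_of_nonneg (sq_nonneg (ξ z.1 * χ z.2))]
    refine (mul_le_of_le_one_right (by positivity) (pow_le_one₀ (mul_nonneg (X.ξ_nonneg _)
      (X.χ_nonneg _)) (mul_le_one₀ (X.ξ_le _ hz.1.1.le) (X.χ_nonneg _) (X.χ_le _)))).trans ?_
    exact mul_le_mul (H.U_le _ _ _) (H.V_le _ _ _) (abs_nonneg _)
      ((abs_nonneg _).trans (H.U_le 0 0 0))
  · refine ((((H.hasUt z.1 z.2 t).pow 2).mul_const _).const_mul _).congr_deriv ?_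
    push_cast; ring

/-- Growth of the weighted square integral. -/
theorem square_growth (H : USol q p N U Ua Ur Uaa Urr V Va Vr g)
    (X : Cut p k b L K ξ ξ₁ ξ₂ χ χ₁ χ₂) (hL : 0 < L) (hk : 0 < k) (hb : 2 * k ≤ b)
    {C₁ t : ℝ} (hC : ∀ a ∈ Icc 0 L, ∀ r ∈ Icc (b - k) (b + k), U a r t ≤ C₁) :
    ∫ z in rect L b k, U z.1 z.2 t * V z.1 z.2 t * (ξ z.1 * χ z.2) ^ 2 ≤
      C₁ * (∫ r in Icc (b - k) (b + k), g r t * χ r) -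
      1 / 2 * (∫ z in rect L b k, (Ua z.1 z.2 t ^ 2 + Ur z.1 z.2 t ^ 2) * (ξ z.1 * χ z.2) ^ 2) +
      C₁ * (p ^ 2 + 8 * K ^ 2) / k ^ 2 * ∫ z in rect L b k, U z.1 z.2 t * (ξ z.1 * χ z.2) := by
  have hsub := rect_subset_strip L b k
  have hm : MeasurableSet (rect L b k) := measurableSet_rect
  have hv : volume (rect L b k) ≠ ⊤ := volume_rect_ne_top
  have T := X.testFn
  have br := bddContOn_inv_snd (p := p) hk hb
  have T2 := TestFn.mul (H.c1U t) (TestFn.mul T.toC1Fn T)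
  have h1 := H.green hL hk hb t T2
  simp only [X.ξ_zero, one_mul] at h1
  have bI := ((((H.bV t).sub (br.mul (H.bUr t))).mul T2.bdd).add
    (((H.bUa t).mul T2.bdda).add ((H.bUr t).mul T2.bddr))).mono hsub
  have bD := ((((H.bUa t).pow 2).add ((H.bUr t).pow 2)).mul (T.bdd.pow 2)).mono hsub
  have bM := ((H.bU t).mul T.bdd).mono hsub
  have cχ : Continuous χ := continuous_iff_continuousAt.2 fun a => (X.hχ a).continuousAt
  have cg := H.g_cont t
  have cU : Continuous fun r => U 0 r t :=
    (H.U_cont t).comp (by fun_prop : Continuous fun r : ℝ => ((0:ℝ), r))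
  have h2 : ∫ r in Icc (b - k) (b + k), g r t * (U 0 r t * (χ r * χ r)) ≤
      C₁ * ∫ r in Icc (b - k) (b + k), g r t * χ r := by
    rw [← integral_const_mul]
    refine setIntegral_mono_on (Continuous.integrableOn_Icc (by fun_prop))
        (Continuous.integrableOn_Icc (by fun_prop)) measurableSet_Icc fun r hr => ?_
    have g0 : 0 ≤ g r t := (Real.rpow_nonneg (H.pos 0 r t).le q).trans (H.jensen r t)
    have e1 := hC 0 ⟨le_rfl, hL.le⟩ r hr
    have e2 : U 0 r t * (χ r * χ r) ≤ C₁ * χ r :=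
      mul_le_mul e1 (mul_le_of_le_one_right (X.χ_nonneg r) (X.χ_le r))
        (mul_self_nonneg _) ((H.pos 0 r t).le.trans e1)
    nlinarith [mul_le_mul_of_nonneg_left e2 g0]
  rw [← h1] at h2
  refine le_trans ?_ (add_le_add_left (sub_le_sub_right h2 _) _)
  rw [← integral_const_mul, ← integral_const_mul, ← bI.integral_sub (bD.const_mul _) hm hv,
    ← (bI.sub (bD.const_mul _)).integral_add (bM.const_mul _) hm hv]
  refine BddContOn.integral_mono ((((H.bU t).mul (H.bV t)).mul (T.bdd.pow 2)).mono hsub)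
    ((bI.sub (bD.const_mul _)).add (bM.const_mul _)) hm hv fun z hz => ?_
  have hz2 : k ≤ z.2 := by linarith [hz.2.1]
  have hρ : (p / z.2) ^ 2 ≤ p ^ 2 / k ^ 2 := by
    rw [div_pow]; gcongr
  have h3 := square_pointwise (V := V z.1 z.2 t) (Ua := Ua z.1 z.2 t) (Ur := Ur z.1 z.2 t)
    (H.pos z.1 z.2 t).le (hC z.1 ⟨hz.1.1.le, hz.1.2⟩ z.2 hz.2)
    (mul_nonneg (X.ξ_nonneg z.1) (X.χ_nonneg z.2))
    (mul_le_one₀ (X.ξ_le _ hz.1.1.le) (X.χ_nonneg _) (X.χ_le _)) hρ (X.grad_sq_le hz.1.1.le z.2)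
  refine h3.trans (le_of_eq ?_)
  ring

theorem hasDerivAt_energy (H : USol q p N U Ua Ur Uaa Urr V Va Vr g)
    (X : Cut p k b L K ξ ξ₁ ξ₂ χ χ₁ χ₂) (hq : 1 < q) (t : ℝ) :
    HasDerivAt (fun t => (∫ z in rect L b k,
        1 / 2 * ((Ua z.1 z.2 t ^ 2 + Ur z.1 z.2 t ^ 2) * (ξ z.1 * χ z.2) ^ 4)) -
        ∫ r in Icc (b - k) (b + k), U 0 r t ^ (q + 1) / (q + 1) * χ r ^ 4)
      ((∫ z in rect L b k, (Ua z.1 z.2 t * Va z.1 z.2 t + Ur z.1 z.2 t * Vr z.1 z.2 t) *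
        (ξ z.1 * χ z.2) ^ 4) - ∫ r in Icc (b - k) (b + k), U 0 r t ^ q * V 0 r t * χ r ^ 4) t := by
  have hsub := rect_subset_strip L b k
  have T := X.testFn
  have hN : 0 ≤ N := (abs_nonneg _).trans (H.U_le 0 0 0)
  refine HasDerivAt.sub ?_ ?_
  · refine hasDerivAt_setIntegral (C := N * N + N * N) measurableSet_rect volume_rect_ne_top
      (F := fun t z => 1 / 2 * ((Ua z.1 z.2 t ^ 2 + Ur z.1 z.2 t ^ 2) * (ξ z.1 * χ z.2) ^ 4))
      (F' := fun t z => (Ua z.1 z.2 t * Va z.1 z.2 t + Ur z.1 z.2 t * Vr z.1 z.2 t) *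
        (ξ z.1 * χ z.2) ^ 4)
      (fun t => (((((H.bUa t).pow 2).add ((H.bUr t).pow 2)).mul (T.bdd.pow 4)).const_mul _).mono
        hsub)
      (fun t => ((((H.bUa t).mul (H.bVa t)).add ((H.bUr t).mul (H.bVr t))).mul
        (T.bdd.pow 4)).mono hsub) (fun t z hz => ?_) (fun t z hz => ?_) t
    · rw [abs_mul, abs_of_nonneg (pow_nonneg (mul_nonneg (X.ξ_nonneg z.1) (X.χ_nonneg z.2)) 4)]
      refine (mul_le_of_le_one_right (abs_nonneg _) (pow_le_one₀ (mul_nonneg (X.ξ_nonneg _)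
        (X.χ_nonneg _)) (mul_le_one₀ (X.ξ_le _ hz.1.1.le) (X.χ_nonneg _) (X.χ_le _)))).trans ?_
      refine (abs_add_le _ _).trans ?_
      rw [abs_mul, abs_mul]
      exact add_le_add
        (mul_le_mul (H.Ua_le _ _ _ hz.1.1) (H.Va_le _ _ _ hz.1.1) (abs_nonneg _) hN)
        (mul_le_mul (H.Ur_le _ _ _ hz.1.1) (H.Vr_le _ _ _ hz.1.1) (abs_nonneg _) hN)
    · refine (((((H.hasUat z.1 z.2 t hz.1.1).pow 2).add
        ((H.hasUrt z.1 z.2 t hz.1.1).pow 2)).mul_const _).const_mul _).congr_deriv ?_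
      push_cast; ring
  · have cχ : Continuous χ := continuous_iff_continuousAt.2 fun a => (X.hχ a).continuousAt
    have cU : ∀ t, Continuous fun r => U 0 r t := fun t =>
      (H.U_cont t).comp (by fun_prop : Continuous fun r : ℝ => ((0:ℝ), r))
    have cV : ∀ t, Continuous fun r => V 0 r t := fun t =>
      (H.V_cont t).comp (by fun_prop : Continuous fun r : ℝ => ((0:ℝ), r))
    have cp : ∀ (s : ℝ) t, Continuous fun r => U 0 r t ^ s := fun s t =>
      (cU t).rpow_const fun r => Or.inl (H.pos 0 r t).ne'
    have hp : ∀ (s : ℝ), 0 ≤ s → ∀ r t, |U 0 r t ^ s| ≤ N ^ s := fun s hs r t => by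
      rw [abs_of_nonneg (Real.rpow_nonneg (H.pos 0 r t).le s)]
      exact Real.rpow_le_rpow (H.pos 0 r t).le ((le_abs_self _).trans (H.U_le _ _ _)) hs
    have hχ : ∀ r, |χ r ^ 4| ≤ 1 := fun r => by
      rw [abs_of_nonneg (pow_nonneg (X.χ_nonneg r) 4)]
      exact pow_le_one₀ (X.χ_nonneg r) (X.χ_le r)
    have hb' : ∀ t r, |U 0 r t ^ q * V 0 r t * χ r ^ 4| ≤ N ^ q * N * 1 := fun t r => by
      rw [abs_mul, abs_mul]
      exact mul_le_mul (mul_le_mul (hp q (by linarith) r t) (H.V_le _ _ _) (abs_nonneg _)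
        (Real.rpow_nonneg hN q)) (hχ r) (abs_nonneg _) (mul_nonneg (Real.rpow_nonneg hN q) hN)
    refine hasDerivAt_setIntegral (C := N ^ q * N * 1) measurableSet_Icc measure_Icc_lt_top.ne
      (F := fun t r => U 0 r t ^ (q + 1) / (q + 1) * χ r ^ 4)
      (F' := fun t r => U 0 r t ^ q * V 0 r t * χ r ^ 4) (fun t => ?_)
      (fun t => .of_bound ((((cp q t).mul (cV t)).mul (cχ.pow 4)).continuousOn)
        fun r _ => hb' t r) (fun t r _ => hb' t r) (fun t r _ => ?_) t
    · refine .of_bound (C := N ^ (q + 1) / (q + 1) * 1)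
        ((((cp (q + 1) t).div_const _).mul (cχ.pow 4)).continuousOn) fun r _ => ?_
      rw [abs_mul, abs_div, abs_of_pos (show 0 < q + 1 by linarith)]
      exact mul_le_mul (div_le_div_of_nonneg_right (hp _ (by linarith) r t) (by linarith)) (hχ r)
        (abs_nonneg _) (by have := Real.rpow_nonneg hN (q + 1); positivity)
    · refine ((((H.hasUt 0 r t).rpow_const (Or.inl (H.pos 0 r t).ne')).div_const _).mul_const
        _).congr_deriv ?_
      have : q + 1 ≠ 0 := by linarith
      rw [add_sub_cancel_right]
      field_simp

/-- Decay of the localised energy. -/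
theorem energy_growth (H : USol q p N U Ua Ur Uaa Urr V Va Vr g)
    (X : Cut p k b L K ξ ξ₁ ξ₂ χ χ₁ χ₂) (hL : 0 < L) (hk : 0 < k) (hb : 2 * k ≤ b)
    {η t : ℝ} (hη : ∀ r ∈ Icc (b - k) (b + k), (g r t - U 0 r t ^ q) * |V 0 r t| ≤ η) :
    (∫ z in rect L b k, (Ua z.1 z.2 t * Va z.1 z.2 t + Ur z.1 z.2 t * Vr z.1 z.2 t) *
        (ξ z.1 * χ z.2) ^ 4) - ∫ r in Icc (b - k) (b + k), U 0 r t ^ q * V 0 r t * χ r ^ 4 ≤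
      2 * k * η - 1 / 2 * (∫ z in rect L b k, V z.1 z.2 t ^ 2 * (ξ z.1 * χ z.2) ^ 4) +
      (p ^ 2 + 32 * K ^ 2) / k ^ 2 *
        ∫ z in rect L b k, (Ua z.1 z.2 t ^ 2 + Ur z.1 z.2 t ^ 2) * (ξ z.1 * χ z.2) ^ 2 := by
  have hsub := rect_subset_strip L b k
  have hm : MeasurableSet (rect L b k) := measurableSet_rect
  have hv : volume (rect L b k) ≠ ⊤ := volume_rect_ne_top
  have T := X.testFn
  have br := bddContOn_inv_snd (p := p) hk hb
  have T4 := TestFn.mul (H.c1V t) (TestFn.mul T.toC1Fn (TestFn.mul T.toC1Fn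
    (TestFn.mul T.toC1Fn T)))
  have h1 := H.green hL hk hb t T4
  simp only [X.ξ_zero, one_mul] at h1
  have bI := ((((H.bV t).sub (br.mul (H.bUr t))).mul T4.bdd).add
    (((H.bUa t).mul T4.bdda).add ((H.bUr t).mul T4.bddr))).mono hsub
  have bD := ((((H.bUa t).pow 2).add ((H.bUr t).pow 2)).mul (T.bdd.pow 2)).mono hsub
  have bV := (((H.bV t).pow 2).mul (T.bdd.pow 4)).mono hsub
  have bE := ((((H.bUa t).mul (H.bVa t)).add ((H.bUr t).mul (H.bVr t))).mul (T.bdd.pow 4)).mono hsub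
  have cχ : Continuous χ := continuous_iff_continuousAt.2 fun a => (X.hχ a).continuousAt
  have cg := H.g_cont t
  have cU : Continuous fun r => U 0 r t :=
    (H.U_cont t).comp (by fun_prop : Continuous fun r : ℝ => ((0:ℝ), r))
  have cV : Continuous fun r => V 0 r t :=
    (H.V_cont t).comp (by fun_prop : Continuous fun r : ℝ => ((0:ℝ), r))
  have cp : Continuous fun r => U 0 r t ^ q :=
    cU.rpow_const fun r => Or.inl (H.pos 0 r t).ne'
  have hη0 : 0 ≤ η := (mul_nonneg (sub_nonneg.2 (H.jensen b t)) (abs_nonneg _)).trans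
    (hη b ⟨by linarith, by linarith⟩)
  have h2 : (∫ r in Icc (b - k) (b + k), g r t * (V 0 r t * (χ r * (χ r * (χ r * χ r))))) -
      ∫ r in Icc (b - k) (b + k), U 0 r t ^ q * V 0 r t * χ r ^ 4 ≤ 2 * k * η := by
    have h3 := mul_le_mul_of_nonneg_left (setIntegral_cut_le X hk) hη0
    rw [← integral_const_mul] at h3
    rw [← MeasureTheory.integral_sub (Continuous.integrableOn_Icc (by fun_prop))
        (Continuous.integrableOn_Icc (by fun_prop))]
    refine le_trans ?_ (h3.trans (le_of_eq (by ring)))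
    refine setIntegral_mono_on (Continuous.integrableOn_Icc (by fun_prop))
        (Continuous.integrableOn_Icc (by fun_prop)) measurableSet_Icc fun r hr => ?_
    have e1 : (g r t - U 0 r t ^ q) * V 0 r t ≤ η :=
      (mul_le_mul_of_nonneg_left (le_abs_self _) (sub_nonneg.2 (H.jensen r t))).trans (hη r hr)
    have e2 : χ r ^ 4 ≤ χ r := pow_le_of_le_one (X.χ_nonneg r) (X.χ_le r) (by norm_num)
    have e3 := X.χ_nonneg r
    calc _ = (g r t - U 0 r t ^ q) * V 0 r t * χ r ^ 4 := by ring
      _ ≤ η * χ r ^ 4 := by gcongr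
      _ ≤ η * χ r := by gcongr
  have h3 : ∫ z in rect L b k, (Ua z.1 z.2 t * Va z.1 z.2 t + Ur z.1 z.2 t * Vr z.1 z.2 t) *
        (ξ z.1 * χ z.2) ^ 4 ≤
      (∫ r in Icc (b - k) (b + k), g r t * (V 0 r t * (χ r * (χ r * (χ r * χ r))))) -
      1 / 2 * (∫ z in rect L b k, V z.1 z.2 t ^ 2 * (ξ z.1 * χ z.2) ^ 4) +
      (p ^ 2 + 32 * K ^ 2) / k ^ 2 *
        ∫ z in rect L b k, (Ua z.1 z.2 t ^ 2 + Ur z.1 z.2 t ^ 2) * (ξ z.1 * χ z.2) ^ 2 := by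
    rw [← h1, ← integral_const_mul, ← integral_const_mul, ← bI.integral_sub (bV.const_mul _) hm hv,
      ← (bI.sub (bV.const_mul _)).integral_add (bD.const_mul _) hm hv]
    refine BddContOn.integral_mono bE
      ((bI.sub (bV.const_mul _)).add (bD.const_mul _)) hm hv fun z hz => ?_
    have hz2 : k ≤ z.2 := by linarith [hz.2.1]
    have hρ : (p / z.2) ^ 2 ≤ p ^ 2 / k ^ 2 := by
      rw [div_pow]; gcongr
    have h3 := energy_pointwise (V := V z.1 z.2 t) (Ua := Ua z.1 z.2 t) (Ur := Ur z.1 z.2 t)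
      (Va := Va z.1 z.2 t) (Vr := Vr z.1 z.2 t)
      (mul_nonneg (X.ξ_nonneg z.1) (X.χ_nonneg z.2))
      (mul_le_one₀ (X.ξ_le _ hz.1.1.le) (X.χ_nonneg _) (X.χ_le _)) hρ (by positivity)
      (X.grad_sq_le hz.1.1.le z.2)
    refine h3.trans (le_of_eq ?_)
    ring
  linarith

end USol

set_option maxHeartbeats 1000000 in
/-- Abstract form of the combined mass, square and energy inequalities. -/
theorem exists_small_of_growth {y z e y' z' e' G D W : ℝ → ℝ} {k A B C₁ m ε τ : ℝ}
    (hk : 1 ≤ k) (hA : 0 ≤ A) (hB : 0 ≤ B) (hC : 0 ≤ C₁) (hε : 0 ≤ ε) (hm : 0 ≤ m)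
    (hτ : 0 < τ) (hτ1 : τ ≤ 1)
    (dy : ∀ t, HasDerivAt y (y' t) t) (dz : ∀ t, HasDerivAt z (z' t) t)
    (de : ∀ t, HasDerivAt e (e' t) t)
    (hG : ∀ t, 0 ≤ G t) (hW : ∀ t, 0 ≤ W t) (hy0 : ∀ t, 0 ≤ y t)
    (hym : ∀ t, y t ≤ k ^ 2 * m) (hy : ∀ t, 1 / k ^ 2 * y t + 1 / 2 * G t - m ≤ y' t)
    (hz0 : ∀ t, 0 ≤ z t) (hzy : ∀ t, z t ≤ C₁ / 2 * y t)
    (hz : ∀ t, z' t ≤ C₁ * G t - 1 / 2 * D t + C₁ * B / k ^ 2 * y t)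
    (he : ∀ t, e' t ≤ ε - 1 / 2 * W t + A / k ^ 2 * D t)
    (heD : ∀ t, e t ≤ 1 / 2 * D t) (heG : ∀ t, -e t ≤ C₁ * G t) :
    ∃ t ∈ Ioo 0 τ, W t ≤ (C₁ * (2 * B + 17) + 2 * A * C₁ + 16 * A * C₁ * (2 + B) + 6) *
      (m + k ^ 2 * ε) / τ := by
  have hk2 : 1 ≤ k ^ 2 := one_le_pow₀ hk
  set s := 1 / k ^ 2 with hs
  have hs0 : 0 < s := by positivity
  have hsk : s * k ^ 2 = 1 := by rw [hs]; field_simp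
  have hs1 : s ≤ 1 := by nlinarith
  have hsym : ∀ t, s * y t ≤ m := fun t => by
    have := mul_le_mul_of_nonneg_left (hym t) hs0.le
    rwa [← mul_assoc, hsk, one_mul] at this
  have hsy0 : ∀ t, 0 ≤ s * y t := fun t => mul_nonneg hs0.le (hy0 t)
  have hz2 : ∀ t, z' t ≤ C₁ * G t - 1 / 2 * D t + C₁ * B * (s * y t) := fun t => by
    refine (hz t).trans (le_of_eq ?_); rw [hs]; ring
  have he2 : ∀ t, e' t ≤ ε - 1 / 2 * W t + A * s * D t := fun t => by
    refine (he t).trans (le_of_eq ?_); rw [hs]; ring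
  set β := 2 * A * C₁ * (2 + B) with hβ
  have hβ0 : 0 ≤ β := by positivity
  set E : ℝ → ℝ := fun t => e t + 2 * A * s * z t - β * s * y t with hE
  have dE : ∀ t, HasDerivAt E (e' t + 2 * A * s * z' t - β * s * y' t) t := fun t =>
    ((de t).add ((dz t).const_mul _)).sub ((dy t).const_mul _)
  set κ := ε + β * s * m with hκ
  have hκ0 : 0 ≤ κ := by positivity
  have hE' : ∀ t, e' t + 2 * A * s * z' t - β * s * y' t ≤ κ - 1 / 2 * W t := fun t => by
    have h1 := mul_le_mul_of_nonneg_left (hz2 t) (show 0 ≤ 2 * A * s by positivity)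
    have h2 := mul_le_mul_of_nonneg_left (hy t) (show 0 ≤ β * s by positivity)
    have h3 : 0 ≤ A * C₁ * B * s * G t := by have := hG t; positivity
    have h4 : 0 ≤ A * C₁ * s * (s * y t) := by have := hsy0 t; positivity
    have h5 := he2 t
    rw [hβ] at h2 ⊢
    nlinarith
  have hEmono : ∀ t₁ t₂, t₁ ≤ t₂ → E t₂ - E t₁ ≤ κ * (t₂ - t₁) := fun t₁ t₂ h =>
    image_sub_le_mul_sub_of_deriv_le (fun t => (dE t).differentiableAt)
      (fun t => by rw [(dE t).deriv]; linarith [hE' t, hW t]) h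
  obtain ⟨t₁, ht₁, hD⟩ : ∃ t ∈ Ioo (-k ^ 2) 0, D t ≤ C₁ * (2 * B + 9) * m := by
    have dF : ∀ t, HasDerivAt (fun t => z t - 2 * C₁ * y t) (z' t - 2 * C₁ * y' t) t := fun t =>
      (dz t).sub ((dy t).const_mul _)
    obtain ⟨t, ht, hd⟩ := exists_hasDerivAt_eq_slope _ _ (show -k ^ 2 < 0 by linarith)
      (fun t _ => (dF t).continuousAt.continuousWithinAt) fun t _ => dF t
    refine ⟨t, ht, ?_⟩
    have h1 : -(5 / 2 * C₁ * m) ≤ z' t - 2 * C₁ * y' t := by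
      rw [hd, le_div_iff₀ (by linarith)]
      have h2 := mul_le_mul_of_nonneg_left (hym 0) hC
      have h3 := mul_le_mul_of_nonneg_left (hym (-k ^ 2)) hC
      nlinarith [hz0 0, hzy (-k ^ 2), hy0 (-k ^ 2)]
    have h2 := mul_le_mul_of_nonneg_left (hy t) hC
    have h3 := mul_le_mul_of_nonneg_left (hsym t) (mul_nonneg hC hB)
    have h4 := mul_nonneg hC (hsy0 t)
    nlinarith [hz2 t]
  obtain ⟨t₂, ht₂, hG₂⟩ : ∃ t ∈ Ioo τ (τ + k ^ 2), G t ≤ 4 * m := by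
    obtain ⟨t, ht, hd⟩ := exists_hasDerivAt_eq_slope y y' (show τ < τ + k ^ 2 by linarith)
      (fun t _ => (dy t).continuousAt.continuousWithinAt) fun t _ => dy t
    refine ⟨t, ht, ?_⟩
    have h1 : y' t ≤ m := by
      rw [hd, div_le_iff₀ (by linarith)]
      nlinarith [hym (τ + k ^ 2), hy0 τ]
    linarith [hy t, hsy0 t]
  obtain ⟨t, ht, hd⟩ := exists_hasDerivAt_eq_slope E _ hτ
    (fun t _ => (dE t).continuousAt.continuousWithinAt) fun t _ => dE t
  refine ⟨t, ht, ?_⟩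
  have hE₁ : E t₁ ≤ (C₁ * (2 * B + 9) / 2 + A * C₁) * m := by
    have h1 := mul_le_mul_of_nonneg_left (hzy t₁) (show 0 ≤ 2 * A * s by positivity)
    have h2 := mul_le_mul_of_nonneg_left (hsym t₁) (show 0 ≤ A * C₁ by positivity)
    have h3 := mul_nonneg hβ0 (hsy0 t₁)
    simp only [hE]
    nlinarith [heD t₁]
  have hE₂ : -E t₂ ≤ (4 * C₁ + β) * m := by
    have h1 := mul_nonneg (show 0 ≤ 2 * A * s by positivity) (hz0 t₂)
    have h2 := mul_le_mul_of_nonneg_left (hsym t₂) hβ0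
    have h3 := mul_le_mul_of_nonneg_left hG₂ hC
    simp only [hE]
    nlinarith [heG t₂]
  have h1 := hEmono t₁ 0 ht₁.2.le
  have h2 := hEmono τ t₂ ht₂.1.le
  have h3 : κ * (0 - t₁) ≤ κ * k ^ 2 := mul_le_mul_of_nonneg_left (by linarith [ht₁.1]) hκ0
  have h4 : κ * (t₂ - τ) ≤ κ * k ^ 2 := mul_le_mul_of_nonneg_left (by linarith [ht₂.2]) hκ0
  have h5 : κ * k ^ 2 = k ^ 2 * ε + β * m := by
    rw [hκ]; linear_combination β * m * hsk
  rw [le_div_iff₀ hτ]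
  have h6 : (E τ - E 0) / (τ - 0) * τ = E τ - E 0 := by rw [sub_zero]; field_simp
  have h7 := mul_le_mul_of_nonneg_right (hE' t) hτ.le
  rw [hd, h6] at h7
  have h8 : κ * τ ≤ κ * k ^ 2 := mul_le_mul_of_nonneg_left (by linarith) hκ0
  have h9 : 0 ≤ C₁ * (2 * B + 17) + 2 * A * C₁ + 16 * A * C₁ * (2 + B) := by positivity
  have h10 : 0 ≤ k ^ 2 * ε := by positivity
  have h11 := mul_nonneg h9 h10
  have hβe : 16 * A * C₁ * (2 + B) = 8 * β := by rw [hβ]; ring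
  rw [hβe] at h11 ⊢
  nlinarith

namespace USol
variable {q p N : ℝ} {U Ua Ur Uaa Urr V Va Vr : ℝ → ℝ → ℝ → ℝ} {g : ℝ → ℝ → ℝ} {L b k K : ℝ}
  {ξ ξ₁ ξ₂ χ χ₁ χ₂ : ℝ → ℝ}

/-- At some time in `(0, τ)` the time derivative is small in `L²`. -/
theorem exists_small_time_deriv (H : USol q p N U Ua Ur Uaa Urr V Va Vr g)
    (X : Cut p k b L K ξ ξ₁ ξ₂ χ χ₁ χ₂) (hq : 1 < q) (hL : 0 < L) (hk : 1 ≤ k) (hb : 2 * k ≤ b)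
    (hK : 0 ≤ K) {C₁ η τ : ℝ} (hτ : 0 < τ) (hτ1 : τ ≤ 1)
    (hC : ∀ a ∈ Icc 0 L, ∀ r ∈ Icc (b - k) (b + k), ∀ t, U a r t ≤ C₁)
    (hη : ∀ r ∈ Icc (b - k) (b + k), ∀ t, (g r t - U 0 r t ^ q) * |V 0 r t| ≤ η) :
    ∃ t ∈ Ioo 0 τ, ∫ z in rect L b k, V z.1 z.2 t ^ 2 * (ξ z.1 * χ z.2) ^ 4 ≤
      (C₁ * (2 * (p ^ 2 + 8 * K ^ 2) + 17) + 2 * (p ^ 2 + 32 * K ^ 2) * C₁ +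
        16 * (p ^ 2 + 32 * K ^ 2) * C₁ * (2 + (p ^ 2 + 8 * K ^ 2)) + 6) *
      (2 * K * (2 * K) ^ (1 / (q - 1)) * k ^ (-(1 / (q - 1))) + k ^ 2 * (2 * k * η)) / τ := by
  have hk0 : 0 < k := by linarith
  have hsub := rect_subset_strip L b k
  have hm : MeasurableSet (rect L b k) := measurableSet_rect
  have hv : volume (rect L b k) ≠ ⊤ := volume_rect_ne_top
  have T := X.testFn
  have hbI : b ∈ Icc (b - k) (b + k) := ⟨by linarith, by linarith⟩
  have hC0 : 0 ≤ C₁ := (H.pos 0 b 0).le.trans (hC 0 ⟨le_rfl, hL.le⟩ b hbI 0)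
  have hη0 : 0 ≤ η := (mul_nonneg (sub_nonneg.2 (H.jensen b 0)) (abs_nonneg _)).trans (hη b hbI 0)
  have hφ0 : ∀ z : ℝ × ℝ, 0 ≤ ξ z.1 * χ z.2 := fun z => mul_nonneg (X.ξ_nonneg _) (X.χ_nonneg _)
  have hφ1 : ∀ z ∈ rect L b k, ξ z.1 * χ z.2 ≤ 1 := fun z hz =>
    mul_le_one₀ (X.ξ_le _ hz.1.1.le) (X.χ_nonneg _) (X.χ_le _)
  refine exists_small_of_growth hk (by positivity) (by positivity) hC0 (by positivity)
    (by positivity) hτ hτ1 (H.hasDerivAt_mass X) (H.hasDerivAt_square X) (H.hasDerivAt_energy X hq)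
    (H.flux_nonneg X)
    (fun t => setIntegral_nonneg hm fun z _ => mul_nonneg (sq_nonneg _) (pow_nonneg (hφ0 z) 4))
    (H.mass_nonneg X)
    (H.mass_le X hq hL hk0 hb hK) (H.mass_growth X hq hL hk0 hb hK)
    (fun t => setIntegral_nonneg hm fun z _ => by positivity) (fun t => ?_)
    (fun t => H.square_growth X hL hk0 hb fun a ha r hr => hC a ha r hr t)
    (fun t => H.energy_growth X hL hk0 hb fun r hr => hη r hr t) (fun t => ?_) (fun t => ?_)
  · rw [← integral_const_mul]
    refine BddContOn.integral_mono (((((H.bU t).pow 2).mul (T.bdd.pow 2)).const_mul _).mono hsub)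
      ((((H.bU t).mul T.bdd).const_mul _).mono hsub) hm hv fun z hz => ?_
    have h1 : U z.1 z.2 t ^ 2 ≤ C₁ * U z.1 z.2 t := by
      nlinarith [hC z.1 ⟨hz.1.1.le, hz.1.2⟩ z.2 hz.2 t, H.pos z.1 z.2 t]
    have h2 : (ξ z.1 * χ z.2) ^ 2 ≤ ξ z.1 * χ z.2 :=
      pow_le_of_le_one (hφ0 z) (hφ1 z hz) (by norm_num)
    have h3 := mul_le_mul h1 h2 (sq_nonneg _) (mul_nonneg hC0 (H.pos z.1 z.2 t).le)
    linarith
  · refine (sub_le_self _ (setIntegral_nonneg measurableSet_Icc fun r _ => ?_)).trans ?_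
    · exact mul_nonneg (div_nonneg (Real.rpow_nonneg (H.pos 0 r t).le _) (by linarith))
        (pow_nonneg (X.χ_nonneg r) 4)
    rw [← integral_const_mul]
    have b2 := ((H.bUa t (b := b) (k := k)).pow 2).add ((H.bUr t).pow 2)
    refine BddContOn.integral_mono (((b2.mul (T.bdd.pow 4)).const_mul _).mono hsub)
      (((b2.mul (T.bdd.pow 2)).const_mul _).mono hsub) hm hv fun z hz => ?_
    have h2 : (ξ z.1 * χ z.2) ^ 4 ≤ (ξ z.1 * χ z.2) ^ 2 :=
      pow_le_pow_of_le_one (hφ0 z) (hφ1 z hz) (by norm_num)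
    gcongr
  · have cχ : Continuous χ := continuous_iff_continuousAt.2 fun a => (X.hχ a).continuousAt
    have cg := H.g_cont t
    have cU : Continuous fun r => U 0 r t :=
      (H.U_cont t).comp (by fun_prop : Continuous fun r : ℝ => ((0:ℝ), r))
    have cp : Continuous fun r => U 0 r t ^ (q + 1) :=
      cU.rpow_const fun r => Or.inl (H.pos 0 r t).ne'
    have h1 : ∫ r in Icc (b - k) (b + k), U 0 r t ^ (q + 1) / (q + 1) * χ r ^ 4 ≤
        C₁ * ∫ r in Icc (b - k) (b + k), g r t * χ r := by
      rw [← integral_const_mul]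
      refine setIntegral_mono_on (Continuous.integrableOn_Icc (by fun_prop))
        (Continuous.integrableOn_Icc (by fun_prop)) measurableSet_Icc fun r hr => ?_
      have hU := H.pos 0 r t
      have e1 : U 0 r t ^ (q + 1) / (q + 1) ≤ C₁ * g r t := by
        refine (div_le_self (Real.rpow_nonneg hU.le _) (by linarith)).trans ?_
        rw [Real.rpow_add hU, Real.rpow_one, mul_comm]
        exact mul_le_mul (hC 0 ⟨le_rfl, hL.le⟩ r hr t) (H.jensen r t) (Real.rpow_nonneg hU.le _) hC0
      have e2 : χ r ^ 4 ≤ χ r := pow_le_of_le_one (X.χ_nonneg r) (X.χ_le r) (by norm_num)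
      rw [← mul_assoc]
      exact mul_le_mul e1 e2 (pow_nonneg (X.χ_nonneg r) 4)
        (mul_nonneg hC0 ((Real.rpow_nonneg hU.le _).trans (H.jensen r t)))
    refine le_trans ?_ h1
    have h0 : 0 ≤ ∫ z in rect L b k,
        1 / 2 * ((Ua z.1 z.2 t ^ 2 + Ur z.1 z.2 t ^ 2) * (ξ z.1 * χ z.2) ^ 4) :=
      setIntegral_nonneg hm fun z _ =>
        mul_nonneg (by norm_num) (mul_nonneg (by positivity) (pow_nonneg (hφ0 z) 4))
    linarith

end USol

theorem setIntegral_inv_sq_add_sq_le {b c A : ℝ} (hc : 0 < c) (hA : 0 ≤ A) :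
    ∫ r in Icc (b - A) (b + A), (c ^ 2 + (r - b) ^ 2)⁻¹ ≤ Real.pi / c := by
  have hd : ∀ r, HasDerivAt (fun r => Real.arctan ((r - b) / c) / c) (c ^ 2 + (r - b) ^ 2)⁻¹ r := by
    intro r
    have := ((((hasDerivAt_id r).sub_const b).div_const c).arctan).div_const c
    refine this.congr_deriv ?_
    have h1 : 0 < c ^ 2 + (r - b) ^ 2 := by positivity
    have h2 : 0 < 1 + ((r - b) / c) ^ 2 := by positivity
    simp only [id]
    field_simp
  have hcont : Continuous fun r : ℝ => (c ^ 2 + (r - b) ^ 2)⁻¹ :=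
    Continuous.inv₀ (by fun_prop) fun r => by positivity
  rw [integral_Icc_eq_integral_Ioc, ← intervalIntegral.integral_of_le (by linarith),
    intervalIntegral.integral_eq_sub_of_hasDerivAt (fun r _ => hd r)
      (hcont.intervalIntegrable _ _), ← sub_div]
  gcongr
  linarith [Real.arctan_lt_pi_div_two ((b + A - b) / c),
    Real.neg_pi_div_two_lt_arctan ((b - A - b) / c)]

theorem setIntegral_rect_inv_sq_le {b A : ℝ} (hA : 0 ≤ A) :
    ∫ z in rect A b A, ((1 + z.1) ^ 2 + (z.2 - b) ^ 2)⁻¹ ≤ Real.pi * Real.log (1 + A) := by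
  have hB : BddContOn (fun z : ℝ × ℝ => ((1 + z.1) ^ 2 + (z.2 - b) ^ 2)⁻¹) (rect A b A) := by
    refine .of_bound (C := 1) (ContinuousOn.inv₀ (by fun_prop) fun z hz => ?_) fun z hz => ?_
    · have := hz.1.1
      positivity
    · have h1 : (1:ℝ) ≤ (1 + z.1) ^ 2 + (z.2 - b) ^ 2 := by nlinarith [hz.1.1, sq_nonneg (z.2 - b)]
      rw [abs_of_nonneg (by positivity)]
      exact inv_le_one_of_one_le₀ h1
  have hI := hB.integrableOn measurableSet_rect (μ := volume) volume_rect_ne_top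
  rw [Measure.volume_eq_prod] at hI ⊢
  rw [setIntegral_prod _ hI]
  rw [IntegrableOn, ← Measure.prod_restrict] at hI
  have hd : ∀ a ∈ uIcc 0 A, HasDerivAt (fun a => Real.pi * Real.log (1 + a)) (Real.pi / (1 + a)) a := by
    intro a ha
    rw [uIcc_of_le hA] at ha
    have := (((hasDerivAt_id a).const_add 1).log (by simp only [id]; linarith [ha.1])).const_mul
      Real.pi
    refine this.congr_deriv ?_
    simp only [id]; ring
  have hc : ContinuousOn (fun a : ℝ => Real.pi / (1 + a)) (uIcc 0 A) := by
    refine continuousOn_const.div (by fun_prop) fun a ha => ?_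
    rw [uIcc_of_le hA] at ha
    linarith [ha.1]
  calc _ ≤ ∫ a in Ioc 0 A, Real.pi / (1 + a) := by
        refine setIntegral_mono_on hI.integral_prod_left ?_ measurableSet_Ioc fun a ha =>
          setIntegral_inv_sq_add_sq_le (c := 1 + a) (by linarith [ha.1]) hA
        exact (intervalIntegrable_iff_integrableOn_Ioc_of_le hA).1 hc.intervalIntegrable
    _ = _ := by
        rw [← intervalIntegral.integral_of_le hA,
          intervalIntegral.integral_eq_sub_of_hasDerivAt hd hc.intervalIntegrable]
        simp

/-- A logarithmic cut-off with small Dirichlet energy. -/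
theorem exists_log_cutoff (b : ℝ) {A : ℝ} (hA : 2 ≤ A) : ∃ Φ Φa Φr G : ℝ → ℝ → ℝ,
    TestFn A b A Φ Φa Φr ∧ (∀ a r, 0 ≤ Φ a r) ∧ (∀ a ≥ 0, ∀ r, Φ a r ≤ 1) ∧
    Continuous (Φ 0) ∧
    (∀ r, |r - b| ≤ 1 → 1 / 4 ≤ Φ 0 r) ∧ (∀ a r, 0 ≤ G a r) ∧
    (∀ a > 0, ∀ r, Φa a r ^ 2 + Φr a r ^ 2 ≤ 4 * Φ a r * G a r) ∧
    BddContOn (fun z : ℝ × ℝ => G z.1 z.2) (strip b A) ∧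
    ∫ z in rect A b A, G z.1 z.2 ≤ 2 * Real.pi / Real.log A := by
  have hl2 : 0 < Real.log 2 := Real.log_pos (by norm_num)
  have hlA : Real.log 2 ≤ Real.log A := Real.log_le_log (by norm_num) hA
  set l := Real.log A with hl
  have hl0 : 0 < l := hl2.trans_le hlA
  set d : ℝ → ℝ → ℝ := fun a r => (1 + a) ^ 2 + (r - b) ^ 2 with hd
  have hd1 : ∀ a ≥ 0, ∀ r, 1 ≤ d a r := fun a ha r => by
    simp only [hd]; nlinarith [sq_nonneg (r - b)]
  set w : ℝ → ℝ → ℝ := fun a r => 1 - Real.log (d a r) / (2 * l) with hw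
  have hw1 : ∀ a ≥ 0, ∀ r, max (w a r) 0 ≤ 1 := fun a ha r => by
    have : 0 ≤ Real.log (d a r) / (2 * l) :=
      div_nonneg (Real.log_nonneg (hd1 a ha r)) (by positivity)
    exact max_le (by simp only [hw]; linarith) zero_le_one
  have hwn : ∀ a r, A ^ 2 ≤ d a r → max (w a r) 0 = 0 := fun a r h => by
    refine max_eq_right ?_
    have h1 : 2 * l ≤ Real.log (d a r) := by
      have := Real.log_le_log (by positivity) h
      rwa [Real.log_pow] at this
    have h2 := (le_div_iff₀ (show 0 < 2 * l by positivity)).2 (by linarith : 1 * (2 * l) ≤ _)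
    simp only [hw]; linarith
  have dwa : ∀ a ≥ 0, ∀ r, HasDerivAt (fun a => w a r) (-((1 + a) / d a r / l)) a := by
    intro a ha r
    have h0 : d a r ≠ 0 := by linarith [hd1 a ha r]
    have h1 : HasDerivAt (fun a => d a r) (2 * (1 + a)) a := by
      refine ((((hasDerivAt_id a).const_add 1).pow 2).add_const ((r - b) ^ 2)).congr_deriv ?_
      simp
    refine (((h1.log h0).div_const (2 * l)).const_sub 1).congr_deriv ?_
    field_simp
  have dwr : ∀ a ≥ 0, ∀ r, HasDerivAt (fun r => w a r) (-((r - b) / d a r / l)) r := by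
    intro a ha r
    have h0 : d a r ≠ 0 := by linarith [hd1 a ha r]
    have h1 : HasDerivAt (fun r => d a r) (2 * (r - b)) r := by
      refine ((((hasDerivAt_id r).sub_const b).pow 2).const_add ((1 + a) ^ 2)).congr_deriv ?_
      simp
    refine (((h1.log h0).div_const (2 * l)).const_sub 1).congr_deriv ?_
    field_simp
  set Φa : ℝ → ℝ → ℝ := fun a r => 2 * max (w a r) 0 * (-((1 + a) / d a r / l)) with hΦa
  set Φr : ℝ → ℝ → ℝ := fun a r => 2 * max (w a r) 0 * (-((r - b) / d a r / l)) with hΦr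
  set G : ℝ → ℝ → ℝ := fun a r => 1 / l ^ 2 * (d a r)⁻¹ with hG
  have hG0 : ∀ a r, 0 ≤ G a r := fun a r => by positivity
  have hgrad : ∀ a > 0, ∀ r, Φa a r ^ 2 + Φr a r ^ 2 = 4 * max (w a r) 0 ^ 2 * G a r := by
    intro a ha r
    have h0 : 0 < d a r := by linarith [hd1 a ha.le r]
    have h2 : (1 + a) ^ 2 + (r - b) ^ 2 = d a r := rfl
    have : Φa a r ^ 2 + Φr a r ^ 2 =
        4 * max (w a r) 0 ^ 2 * (((1 + a) ^ 2 + (r - b) ^ 2) / (d a r) ^ 2 / l ^ 2) := by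
      simp only [hΦa, hΦr]; field_simp; ring
    rw [this, h2]
    simp only [hG]
    field_simp
  have hGle : ∀ a > 0, ∀ r, G a r ≤ 1 / l ^ 2 := fun a ha r =>
    mul_le_of_le_one_right (by positivity) (inv_le_one_of_one_le₀ (hd1 a ha.le r))
  have hgle : ∀ a > 0, ∀ r, Φa a r ^ 2 + Φr a r ^ 2 ≤ (2 / l) ^ 2 := by
    intro a ha r
    rw [hgrad a ha r]
    have h1 : max (w a r) 0 ^ 2 ≤ 1 := pow_le_one₀ (le_max_right _ _) (hw1 a ha.le r)
    have h2 := mul_le_mul h1 (hGle a ha r) (hG0 a r) zero_le_one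
    calc _ = 4 * (max (w a r) 0 ^ 2 * G a r) := by ring
      _ ≤ 4 * (1 * (1 / l ^ 2)) := by linarith
      _ = _ := by ring
  have cd : Continuous fun z : ℝ × ℝ => d z.1 z.2 := by simp only [hd]; fun_prop
  have cd0 : ∀ z ∈ strip b A, d z.1 z.2 ≠ 0 := fun z hz => by
    linarith [hd1 z.1 (le_of_lt hz.1) z.2]
  have cw : ContinuousOn (fun z : ℝ × ℝ => max (w z.1 z.2) 0) (strip b A) :=
    ContinuousOn.sup (continuousOn_const.sub ((cd.continuousOn.log cd0).div_const _))
      continuousOn_const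
  have bw : BddContOn (fun z : ℝ × ℝ => max (w z.1 z.2) 0) (strip b A) :=
    .of_bound cw fun z hz => by
      rw [abs_of_nonneg (le_max_right _ _)]; exact hw1 _ (le_of_lt hz.1) _
  have c0 : Continuous fun r => max (w 0 r) 0 :=
    Continuous.sup (continuous_const.sub (Continuous.div_const (Continuous.log
      (cd.comp (by fun_prop : Continuous fun r : ℝ => ((0:ℝ), r)))
      fun r => by show d 0 r ≠ 0; linarith [hd1 0 le_rfl r]) _)) continuous_const
  refine ⟨fun a r => max (w a r) 0 ^ 2, Φa, Φr, G, ?_, fun a r => sq_nonneg _,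
    fun a ha r => pow_le_one₀ (le_max_right _ _) (hw1 a ha r), c0.pow 2, fun r hr => ?_, hG0,
    fun a ha r => (hgrad a ha r).le, ?_, ?_⟩
  · exact
    { da := fun a ha r _ => (hasDerivAt_max_pow_comp 0 (dwa a (le_of_lt ha) r)).congr_deriv
        (by simp [hΦa])
      dr := fun a ha r _ => (hasDerivAt_max_pow_comp 0 (dwr a (le_of_lt ha) r)).congr_deriv
        (by simp [hΦr])
      bdd := bw.pow 2
      bdda := .of_bound ((continuousOn_const.mul cw).mul
        (((ContinuousOn.div (by fun_prop) cd.continuousOn cd0).div_const _).neg)) fun z hz =>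
          abs_le_of_sq_le_sq ((le_add_of_nonneg_right (sq_nonneg _)).trans (hgle z.1 hz.1 z.2))
            (by positivity)
      bddr := .of_bound ((continuousOn_const.mul cw).mul
        (((ContinuousOn.div (by fun_prop) cd.continuousOn cd0).div_const _).neg)) fun z hz =>
          abs_le_of_sq_le_sq ((le_add_of_nonneg_left (sq_nonneg _)).trans (hgle z.1 hz.1 z.2))
            (by positivity)
      trace := fun r _ =>
        have h : ContinuousAt (fun a => max (w a r) 0) 0 :=
          ContinuousAt.sup (dwa 0 le_rfl r).continuousAt continuousAt_const
        (h.pow 2).continuousWithinAt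
      top := fun r _ => by
        rw [hwn A r (by simp only [hd]; nlinarith [sq_nonneg (r - b)])]; norm_num
      left := fun a ha => by
        rw [hwn a (b - A) (by simp only [hd]; nlinarith [sq_nonneg (1 + a)])]; norm_num
      right := fun a ha => by
        rw [hwn a (b + A) (by simp only [hd]; nlinarith [sq_nonneg (1 + a)])]; norm_num }
  · have h1 : d 0 r ≤ 2 := by
      have := (sq_le_one_iff_abs_le_one (r - b)).2 hr
      simp only [hd]; linarith
    have h2 : Real.log (d 0 r) ≤ l :=
      (Real.log_le_log (by linarith [hd1 0 le_rfl r]) h1).trans hlA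
    have h3 : Real.log (d 0 r) / (2 * l) ≤ 1 / 2 := by
      rw [div_le_iff₀ (by positivity)]; linarith
    have h4 : 1 / 2 ≤ max (w 0 r) 0 := le_max_of_le_left (by simp only [hw]; linarith)
    have : (1 / 2 : ℝ) ^ 2 ≤ max (w 0 r) 0 ^ 2 := pow_le_pow_left₀ (by norm_num) h4 2
    norm_num at this ⊢
    linarith
  · refine .of_bound (C := 1 / l ^ 2) (continuousOn_const.mul (cd.continuousOn.inv₀ cd0))
      fun z hz => ?_
    rw [abs_of_nonneg (hG0 _ _)]
    exact hGle _ hz.1 _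
  · simp only [hG, hd]
    rw [integral_const_mul]
    have h1 := setIntegral_rect_inv_sq_le (b := b) (show 0 ≤ A by linarith)
    have h2 : Real.log (1 + A) ≤ 2 * l := by
      have := Real.log_le_log (by linarith) (show 1 + A ≤ A ^ 2 by nlinarith)
      rwa [Real.log_pow] at this
    have h3 : Real.pi * Real.log (1 + A) ≤ Real.pi * (2 * l) := by gcongr
    calc _ ≤ 1 / l ^ 2 * (Real.pi * (2 * l)) := by gcongr; exact h1.trans h3
      _ = _ := by field_simp

theorem log_test_pointwise {V Ua Ur Φ Φa Φr G U ρ s ε : ℝ} (hU : 0 < U) (hΦ : 0 ≤ Φ)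
    (hG : 0 ≤ G) (hgrad : Φa ^ 2 + Φr ^ 2 ≤ 4 * Φ * G) (hε : 0 < ε) (hρ : ρ ^ 2 ≤ s) :
    (V - ρ * Ur) * ((1 + U)⁻¹ * Φ) + (Ua * (-Ua * ((1 + U)⁻¹) ^ 2 * Φ + (1 + U)⁻¹ * Φa) +
      Ur * (-Ur * ((1 + U)⁻¹) ^ 2 * Φ + (1 + U)⁻¹ * Φr)) ≤
    ε * Φ + 1 / (4 * ε) * (V ^ 2 * Φ) + 1 / 2 * s * Φ + 2 * G := by
  set y := (1 + U)⁻¹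
  have hy0 : 0 ≤ y := by positivity
  have hy1 : y ≤ 1 := inv_le_one_of_one_le₀ (by linarith)
  set xa := Ua * y
  set xr := Ur * y
  have h1 : xa * Φa + xr * Φr ≤ 1 / 2 * (xa ^ 2 + xr ^ 2) * Φ + 2 * G := by
    refine le_of_abs_le (abs_le_of_sq_le_sq ?_ (by positivity))
    have h2 : (xa * Φa + xr * Φr) ^ 2 ≤ (xa ^ 2 + xr ^ 2) * (Φa ^ 2 + Φr ^ 2) := by
      nlinarith [sq_nonneg (xa * Φr - xr * Φa)]
    have h3 := mul_le_mul_of_nonneg_left hgrad (show 0 ≤ xa ^ 2 + xr ^ 2 by positivity)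
    nlinarith [sq_nonneg (1 / 2 * (xa ^ 2 + xr ^ 2) * Φ - 2 * G)]
  have h2 : -(ρ * xr) * Φ ≤ (1 / 2 * xr ^ 2 + 1 / 2 * s) * Φ :=
    mul_le_mul_of_nonneg_right (by nlinarith [sq_nonneg (ρ + xr)]) hΦ
  have h3 : V * y ≤ ε + 1 / (4 * ε) * V ^ 2 := by
    have h4 : V * y ≤ |V| := (le_abs_self _).trans (by
      rw [abs_mul, abs_of_nonneg hy0]; exact mul_le_of_le_one_right (abs_nonneg _) hy1)
    have h5 : ε + 1 / (4 * ε) * V ^ 2 - |V| = 1 / (4 * ε) * (2 * ε - |V|) ^ 2 := by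
      rw [← sq_abs V]; field_simp; ring
    have h6 : 0 ≤ 1 / (4 * ε) * (2 * ε - |V|) ^ 2 := by positivity
    linarith
  have h4 := mul_le_mul_of_nonneg_right h3 hΦ
  have h5 : 0 ≤ xa ^ 2 * Φ := by positivity
  have e : (V - ρ * Ur) * (y * Φ) + (Ua * (-Ua * y ^ 2 * Φ + y * Φa) +
      Ur * (-Ur * y ^ 2 * Φ + y * Φr)) =
      V * y * Φ + -(ρ * xr) * Φ + (xa * Φa + xr * Φr) - (xa ^ 2 + xr ^ 2) * Φ := by
    simp only [xa, xr]; ring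
  rw [e]
  linarith

namespace USol
variable {q p N : ℝ} {U Ua Ur Uaa Urr V Va Vr : ℝ → ℝ → ℝ → ℝ} {g : ℝ → ℝ → ℝ} {L b k K : ℝ}
  {ξ ξ₁ ξ₂ χ χ₁ χ₂ : ℝ → ℝ}

theorem c1_inv (H : USol q p N U Ua Ur Uaa Urr V Va Vr g) (t : ℝ) :
    C1Fn b k (fun a r => (1 + U a r t)⁻¹) (fun a r => -Ua a r t * ((1 + U a r t)⁻¹) ^ 2)
      (fun a r => -Ur a r t * ((1 + U a r t)⁻¹) ^ 2) := by
  have hpos : ∀ a r, 0 < 1 + U a r t := fun a r => by linarith [H.pos a r t]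
  have hc : Continuous fun z : ℝ × ℝ => (1 + U z.1 z.2 t)⁻¹ :=
    (continuous_const.add (H.U_cont t)).inv₀ fun z => (hpos z.1 z.2).ne'
  have hB : BddContOn (fun z : ℝ × ℝ => (1 + U z.1 z.2 t)⁻¹) (strip b k) :=
    .of_bound (C := 1) hc.continuousOn fun z _ => by
      rw [abs_of_pos (inv_pos.2 (hpos z.1 z.2))]
      exact inv_le_one_of_one_le₀ (by linarith [H.pos z.1 z.2 t])
  exact
  { da := fun a ha r _ => (((H.hasUa a r t ha).const_add 1).inv (hpos a r).ne').congr_deriv (by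
      rw [inv_pow, div_eq_mul_inv])
    dr := fun a ha r _ => (((H.hasUr a r t ha).const_add 1).inv (hpos a r).ne').congr_deriv (by
      rw [inv_pow, div_eq_mul_inv])
    bdd := hB
    bdda := (H.bUa t).neg.mul (hB.pow 2)
    bddr := (H.bUr t).neg.mul (hB.pow 2)
    trace := fun r _ => (hc.comp (by fun_prop : Continuous fun a : ℝ => (a, r))).continuousWithinAt }

/-- The flux through a boundary segment is controlled by the `L²` norm of the time derivative. -/
theorem flux_le_of_time_deriv (H : USol q p N U Ua Ur Uaa Urr V Va Vr g)
    (X : Cut p k b L K ξ ξ₁ ξ₂ χ χ₁ χ₂) (hq : 1 < q) {A c δ C₁ ε Y t : ℝ} (hA : 2 ≤ A)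
    (hAk : 2 * A ≤ k) (hb : 2 * k ≤ b) (hL : A ≤ L) (hc : 0 < c)
    (hX : ∀ a ∈ Icc 0 A, ∀ r ∈ Icc (b - A) (b + A), c ≤ ξ a * χ r) (hδ : 0 < δ) (hδ1 : δ ≤ 1)
    (hu : ∀ r, |r - b| ≤ δ → 1 / 4 ≤ U 0 r t) (hC : ∀ r, |r - b| ≤ δ → U 0 r t ≤ C₁) (hε : 0 < ε)
    (hY : ∫ z in rect L b k, V z.1 z.2 t ^ 2 * (ξ z.1 * χ z.2) ^ 4 ≤ Y) :
    2 * δ * ((1 / 4) ^ q / (4 * (1 + C₁))) ≤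
      4 * Real.pi / Real.log A + 2 * A ^ 2 * ε + A ^ 2 * p ^ 2 / k ^ 2 +
        1 / (4 * ε * c ^ 4) * Y := by
  obtain ⟨Φ, Φa, Φr, G, T, hΦ0, hΦ1, cΦ, hΦl, hG0, hgrad, bG, iG⟩ := exists_log_cutoff b hA
  have hA0 : 0 < A := by linarith
  have hk0 : 0 < k := by linarith
  have hbA : 2 * A ≤ b := by linarith
  have hm : MeasurableSet (rect A b A) := measurableSet_rect
  have hv : volume (rect A b A) ≠ ⊤ := volume_rect_ne_top
  have hsub := rect_subset_strip A b A
  have hRR : rect A b A ⊆ rect L b k :=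
    prod_mono (Ioc_subset_Ioc_right hL) (Icc_subset_Icc (by linarith) (by linarith))
  have hgr := H.green hA0 hA0 hbA t (TestFn.mul (H.c1_inv t) T)
  have hpos : ∀ r, 0 < 1 + U 0 r t := fun r => by linarith [H.pos 0 r t]
  have hg0 : ∀ r, 0 ≤ g r t := fun r => (Real.rpow_nonneg (H.pos 0 r t).le q).trans (H.jensen r t)
  have hC1 : 0 < 1 + C₁ := by linarith [H.pos 0 b t, hC b (by simpa using hδ.le)]
  have hlow : 2 * δ * ((1 / 4) ^ q / (4 * (1 + C₁))) ≤
      ∫ r in Icc (b - A) (b + A), g r t * ((1 + U 0 r t)⁻¹ * Φ 0 r) := by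
    have hcont : Continuous fun r => g r t * ((1 + U 0 r t)⁻¹ * Φ 0 r) :=
      (H.g_cont t).mul ((Continuous.inv₀ (continuous_const.add ((H.U_cont t).comp
        (by fun_prop : Continuous fun r : ℝ => ((0:ℝ), r)))) fun r => (hpos r).ne').mul cΦ)
    have h1 : ∫ r in Icc (b - δ) (b + δ), (1 / 4 : ℝ) ^ q / (4 * (1 + C₁)) ≤
        ∫ r in Icc (b - δ) (b + δ), g r t * ((1 + U 0 r t)⁻¹ * Φ 0 r) := by
      refine setIntegral_mono_on (integrableOn_const (by simp)) hcont.integrableOn_Icc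
        measurableSet_Icc fun r hr => ?_
      have hr' : |r - b| ≤ δ := abs_le.2 ⟨by linarith [hr.1], by linarith [hr.2]⟩
      have e1 : (1 / 4 : ℝ) ^ q ≤ g r t :=
        (Real.rpow_le_rpow (by norm_num) (hu r hr') (by linarith)).trans (H.jensen r t)
      have e2 : (1 + C₁)⁻¹ ≤ (1 + U 0 r t)⁻¹ := inv_anti₀ (hpos r) (by linarith [hC r hr'])
      have e3 := mul_le_mul e2 (hΦl r (hr'.trans hδ1)) (by norm_num) (inv_pos.2 (hpos r)).le
      have e4 := mul_le_mul e1 e3 (by positivity) (hg0 r)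
      refine le_trans (le_of_eq ?_) e4
      field_simp
    rw [setIntegral_const] at h1
    have h2 : ∫ r in Icc (b - δ) (b + δ), g r t * ((1 + U 0 r t)⁻¹ * Φ 0 r) ≤
        ∫ r in Icc (b - A) (b + A), g r t * ((1 + U 0 r t)⁻¹ * Φ 0 r) :=
      setIntegral_mono_set hcont.integrableOn_Icc
        (Eventually.of_forall fun r => mul_nonneg (hg0 r)
          (mul_nonneg (inv_pos.2 (hpos r)).le (hΦ0 0 r)))
        (Icc_subset_Icc (by linarith) (by linarith)).eventuallyLE
    refine le_trans (le_of_eq ?_) (h1.trans h2)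
    rw [Real.volume_real_Icc_of_le (by linarith), smul_eq_mul]
    ring
  rw [← hgr] at hlow
  refine hlow.trans ?_
  have bΦ := T.bdd.mono hsub
  have bV : BddContOn (fun z : ℝ × ℝ => V z.1 z.2 t) (rect L b k) :=
    (H.bV t).mono (rect_subset_strip L b k)
  have bφ : BddContOn (fun z : ℝ × ℝ => ξ z.1 * χ z.2) (rect L b k) :=
    X.testFn.bdd.mono (rect_subset_strip L b k)
  have bV4 := (bV.pow 2).mul (bφ.pow 4)
  have bR : BddContOn (fun z : ℝ × ℝ => (ε + 1 / 2 * (p ^ 2 / k ^ 2)) +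
      1 / (4 * ε * c ^ 4) * (V z.1 z.2 t ^ 2 * (ξ z.1 * χ z.2) ^ 4)) (rect A b A) :=
    (BddContOn.const _).add ((bV4.mono hRR).const_mul _)
  have hup : ∫ z in rect A b A, ((V z.1 z.2 t - p / z.2 * Ur z.1 z.2 t) *
      ((1 + U z.1 z.2 t)⁻¹ * Φ z.1 z.2) +
      (Ua z.1 z.2 t * (-Ua z.1 z.2 t * ((1 + U z.1 z.2 t)⁻¹) ^ 2 * Φ z.1 z.2 +
        (1 + U z.1 z.2 t)⁻¹ * Φa z.1 z.2) +
      Ur z.1 z.2 t * (-Ur z.1 z.2 t * ((1 + U z.1 z.2 t)⁻¹) ^ 2 * Φ z.1 z.2 +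
        (1 + U z.1 z.2 t)⁻¹ * Φr z.1 z.2))) ≤
      ∫ z in rect A b A, (((ε + 1 / 2 * (p ^ 2 / k ^ 2)) +
      1 / (4 * ε * c ^ 4) * (V z.1 z.2 t ^ 2 * (ξ z.1 * χ z.2) ^ 4)) + 2 * G z.1 z.2) := by
    have T' := TestFn.mul (H.c1_inv (b := b) (k := A) t) T
    refine BddContOn.integral_mono (BddContOn.mono ((((H.bV t).sub
      ((bddContOn_inv_snd hA0 hbA).mul (H.bUr t))).mul T'.bdd).add
      (((H.bUa t).mul T'.bdda).add ((H.bUr t).mul T'.bddr))) hsub)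
      (bR.add ((bG.mono hsub).const_mul 2)) hm hv fun z hz => ?_
    have hr : k ≤ z.2 := by linarith [hz.2.1]
    have hρ : (p / z.2) ^ 2 ≤ p ^ 2 / k ^ 2 := by rw [div_pow]; gcongr
    refine (log_test_pointwise (H.pos z.1 z.2 t) (hΦ0 _ _) (hG0 z.1 z.2) (hgrad z.1 hz.1.1 z.2) hε
      hρ).trans ?_
    have hΦ := hΦ1 z.1 hz.1.1.le z.2
    have e1 : ε * Φ z.1 z.2 ≤ ε := mul_le_of_le_one_right hε.le hΦ
    have e2 : 1 / 2 * (p ^ 2 / k ^ 2) * Φ z.1 z.2 ≤ 1 / 2 * (p ^ 2 / k ^ 2) :=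
      mul_le_of_le_one_right (by positivity) hΦ
    have e3 : c ^ 4 * Φ z.1 z.2 ≤ (ξ z.1 * χ z.2) ^ 4 :=
      (mul_le_of_le_one_right (by positivity) hΦ).trans
        (pow_le_pow_left₀ hc.le (hX z.1 ⟨hz.1.1.le, hz.1.2⟩ z.2 hz.2) 4)
    have e4 : 1 / (4 * ε) * (V z.1 z.2 t ^ 2 * Φ z.1 z.2) ≤
        1 / (4 * ε * c ^ 4) * (V z.1 z.2 t ^ 2 * (ξ z.1 * χ z.2) ^ 4) := by
      calc _ = 1 / (4 * ε * c ^ 4) * (V z.1 z.2 t ^ 2 * (c ^ 4 * Φ z.1 z.2)) := by field_simp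
        _ ≤ _ := by gcongr
    linarith
  refine hup.trans ?_
  rw [BddContOn.integral_add bR ((bG.mono hsub).const_mul 2) hm hv,
    BddContOn.integral_add (.const _) ((bV4.mono hRR).const_mul _) hm hv, integral_const_mul,
    integral_const_mul, setIntegral_const]
  have hvol : volume.real (rect A b A) = 2 * A ^ 2 := by
    rw [Measure.volume_eq_prod, measureReal_prod_prod, Real.volume_real_Ioc_of_le hA0.le,
      Real.volume_real_Icc_of_le (by linarith)]
    ring
  have hsmall : ∫ z in rect A b A, V z.1 z.2 t ^ 2 * (ξ z.1 * χ z.2) ^ 4 ≤ Y :=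
    (setIntegral_mono_set (bV4.integrableOn measurableSet_rect volume_rect_ne_top)
      (Eventually.of_forall fun z => mul_nonneg (sq_nonneg _)
        (pow_nonneg (mul_nonneg (X.ξ_nonneg _) (X.χ_nonneg _)) 4)) hRR.eventuallyLE).trans hY
  have e5 := mul_le_mul_of_nonneg_left hsmall (show 0 ≤ 1 / (4 * ε * c ^ 4) by positivity)
  rw [hvol, smul_eq_mul]
  calc _ ≤ 2 * A ^ 2 * (ε + 1 / 2 * (p ^ 2 / k ^ 2)) + 1 / (4 * ε * c ^ 4) * Y +
        2 * (2 * Real.pi / Real.log A) := by linarith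
    _ = _ := by ring

end USol

namespace Sol2
variable {q p M C : ℝ} {v va vr vaa vrr : ℝ → ℝ → ℝ → ℝ}

theorem boundary_lipschitz (S : Sol2 q p M C v va vr vaa vrr) {b c K t r : ℝ} (hc : 0 < c)
    (h : ∀ a ∈ Ioc 0 1, ∀ r, |r - b| ≤ c → |vr a r t| ≤ K) (hr : |r - b| ≤ c) :
    |v 0 r t - v 0 b t| ≤ K * |r - b| := by
  have hmem : ∀ s, |s - b| ≤ c ↔ s ∈ Icc (b - c) (b + c) := fun s => by
    rw [_root_.abs_le, mem_Icc]; constructor <;> rintro ⟨h1, h2⟩ <;> constructor <;> linarith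
  have h1 : ∀ a ∈ Ioc (0:ℝ) 1, |v a r t - v a b t| ≤ K * |r - b| := fun a ha =>
    Convex.norm_image_sub_le_of_norm_hasDerivWithin_le (s := Icc (b - c) (b + c))
      (f := fun s => v a s t) (fun s _ => (S.hasR a s t ha.1).hasDerivWithinAt)
      (fun s hs => h a ha s ((hmem s).2 hs)) (convex_Icc _ _)
      ((hmem b).1 (by simpa using hc.le)) ((hmem r).1 hr)
  have hcont : ∀ r, Tendsto (fun a => v a r t) (𝓝[>] 0) (𝓝 (v 0 r t)) := fun r =>
    ((S.cont.comp (by fun_prop : Continuous fun a : ℝ => (a, r, t))).tendsto 0).mono_left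
      nhdsWithin_le_nhds
  refine le_of_tendsto ((hcont r).sub (hcont b)).abs ?_
  filter_upwards [Ioc_mem_nhdsGT (zero_lt_one' ℝ)] with a ha using h1 a ha

set_option maxHeartbeats 1000000 in
/-- A solution of the meridional problem which is bounded on a large half-disc, with controlled
derivatives near its centre, is small at the centre. -/
theorem exists_radius (hq : 1 < q) (hp : 0 ≤ p) {C₁ C₂ C₃ : ℝ} (h₁ : 0 ≤ C₁) (h₂ : 0 ≤ C₂)
    (h₃ : 0 ≤ C₃) : ∃ R ≥ 1, ∀ {M C : ℝ} {v va vr vaa vrr : ℝ → ℝ → ℝ → ℝ},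
      Sol2 q p M C v va vr vaa vrr → ∀ {k b : ℝ}, R ≤ k → 2 * k ≤ b →
      (∀ a ∈ Icc 0 k, ∀ r ∈ Icc (b - k) (b + k), ∀ t, v a r t ≤ C₁) →
      (∀ a ∈ Ioc 0 1, ∀ r, |r - b| ≤ 1 → ∀ t, |va a r t| ≤ C₂ ∧ |vr a r t| ≤ C₂ ∧
        |vaa a r t + vrr a r t + p / r * vr a r t| ≤ C₃ / a) → v 0 b 0 < 1 / 2 := by
  obtain ⟨K, hK, c, hc, hcut⟩ := exists_cut hp one_pos
  set γ := 1 / (q - 1)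
  have hγ : 0 < γ := by have : 0 < q - 1 := by linarith
                        positivity
  set δ : ℝ := 1 / (8 * (C₂ + 1)) with hδ
  set e : ℝ := 1 / (8 * (2 * C₂ + C₃ + 1)) with he
  have hδ0 : 0 < δ := by positivity
  have he0 : 0 < e := by positivity
  have hδ1 : δ ≤ 1 := by rw [hδ, div_le_one (by positivity)]; linarith
  have he1 : e ≤ 1 := by rw [he, div_le_one (by positivity)]; linarith
  have hCδ : C₂ * δ ≤ 1 / 8 := by rw [hδ]; field_simp; linarith
  have hCe : (2 * C₂ + C₃) * e ≤ 1 / 8 := by rw [he]; field_simp; linarith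
  set τ : ℝ := e ^ 2 / 2 with hτ
  have hτ0 : 0 < τ := by positivity
  have hτ1 : 2 * τ ≤ 1 := by rw [hτ]; nlinarith
  set δ₀ := 2 * δ * ((1 / 4) ^ q / (4 * (1 + C₁))) with hδ₀
  have hδ₀0 : 0 < δ₀ := by positivity
  set A := max 2 (Real.exp (32 * Real.pi / δ₀)) with hA
  have hA2 : 2 ≤ A := le_max_left _ _
  have hA0 : 0 < A := by linarith
  have hlog : 32 * Real.pi / δ₀ ≤ Real.log A := by
    rw [Real.le_log_iff_exp_le hA0]; exact le_max_right _ _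
  have hpi := Real.pi_pos
  have hlog0 : 0 < Real.log A := lt_of_lt_of_le (by positivity) hlog
  have hπ : 4 * Real.pi / Real.log A ≤ δ₀ / 8 := by
    rw [div_le_iff₀ hlog0]
    rw [div_le_iff₀ hδ₀0] at hlog
    linarith
  set ε := δ₀ / (16 * A ^ 2) with hε
  have hε0 : 0 < ε := by positivity
  have hAε : 2 * A ^ 2 * ε = δ₀ / 8 := by rw [hε]; field_simp; ring
  set Q := C₁ * (2 * (p ^ 2 + 8 * K ^ 2) + 17) + 2 * (p ^ 2 + 32 * K ^ 2) * C₁ +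
        16 * (p ^ 2 + 32 * K ^ 2) * C₁ * (2 + (p ^ 2 + 8 * K ^ 2)) + 6
  set B := 1 / (4 * ε * c ^ 4) * (Q * (2 * K * (2 * K) ^ γ + 1) / τ) with hB
  have hlim : Tendsto (fun k : ℝ => B * k ^ (-γ)) atTop (𝓝 0) := by
    simpa using (tendsto_rpow_neg_atTop hγ).const_mul B
  obtain ⟨R₁, hR₁⟩ := eventually_atTop.1 (hlim.eventually (eventually_le_nhds
    (show (0:ℝ) < δ₀ / 8 by positivity)))
  refine ⟨max (max 1 R₁) (max (2 * A) (8 * A ^ 2 * p ^ 2 / δ₀)),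
    le_max_of_le_left (le_max_left _ _), ?_⟩
  intro M C v va vr vaa vrr S k b hk hb hC hloc
  have hk1 : 1 ≤ k := ((le_max_left _ _).trans (le_max_left _ _)).trans hk
  have hkR : R₁ ≤ k := ((le_max_right _ _).trans (le_max_left _ _)).trans hk
  have hkA : 2 * A ≤ k := ((le_max_left _ _).trans (le_max_right _ _)).trans hk
  have hkp : 8 * A ^ 2 * p ^ 2 / δ₀ ≤ k := ((le_max_right _ _).trans (le_max_right _ _)).trans hk
  have hk0 : 0 < k := by linarith
  have hpk : A ^ 2 * p ^ 2 / k ^ 2 ≤ δ₀ / 8 := by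
    rw [div_le_iff₀ hδ₀0] at hkp
    rw [div_le_iff₀ (by positivity)]
    have := mul_le_mul_of_nonneg_left hk1 (mul_pos hδ₀0 hk0).le
    nlinarith
  by_contra! hv
  have hpos : ∀ r, |r - b| ≤ 1 → 0 < r := fun r hr => by linarith [(_root_.abs_le.1 hr).1]
  have hvl : ∀ r, |r - b| ≤ δ → ∀ s ∈ Icc 0 (2 * τ), 1 / 4 ≤ v 0 r s := by
    intro r hr s hs
    have hr1 := hr.trans hδ1
    have h1 := S.boundary_lipschitz one_pos (fun a ha r hr => (hloc a ha r hr 0).2.1) hr1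
    have h2 : |v 0 r 0 - v 0 b 0| ≤ 1 / 8 := h1.trans
      ((mul_le_mul_of_nonneg_left hr h₂).trans hCδ)
    rcases hs.1.eq_or_lt with h0 | h0
    · rw [← h0]; linarith [(_root_.abs_le.1 h2).1]
    have hale : ∀ a : ℝ, 0 < a → a ^ 2 ≤ s - 0 → a ∈ Ioc (0:ℝ) 1 := fun a ha h =>
      ⟨ha, by nlinarith [hs.2]⟩
    have h3 := S.boundary_holder (hpos r hr1) h0
      (fun a ha h t _ => (hloc a (hale a ha h) r hr1 t).1)
      (fun a ha h t _ => (hloc a (hale a ha h.le) r hr1 t).2.2)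
    have h4 : √(s - 0) ≤ e := Real.sqrt_le_iff.2 ⟨he0.le, by linarith [hs.2]⟩
    have h5 := h3.trans ((mul_le_mul_of_nonneg_left h4 (by positivity)).trans hCe)
    linarith [(_root_.abs_le.1 h2).1, (_root_.abs_le.1 h5).1]
  obtain ⟨ξ, ξ₁, ξ₂, χ, χ₁, χ₂, X, hX⟩ := hcut k b hk0 hb
  rw [one_mul] at X
  set η := k ^ (-γ) / (2 * k ^ 3) with hη
  have hkγ : 0 < k ^ (-γ) := Real.rpow_pos_of_pos hk0 _
  have hη0 : 0 < η := by positivity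
  obtain ⟨h₀, hh₀, hcomm⟩ := S.commutator_small hq hp hk0 hη0
  set h := min (h₀ / 2) τ
  have hh : 0 < h := lt_min (by positivity) hτ0
  have hhτ : h ≤ τ := min_le_right _ _
  have hhh : h < h₀ := (min_le_left _ _).trans_lt (by linarith)
  have H := S.uSol hq hh
  have ct : ∀ a r, Continuous (v a r) := fun a r =>
    S.cont.comp (by fun_prop : Continuous fun t : ℝ => (a, r, t))
  have hUC : ∀ a ∈ Icc 0 k, ∀ r ∈ Icc (b - k) (b + k), ∀ t, stek h (v a r) t ≤ C₁ := by
    intro a ha r hr t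
    have := stek_mono hh ((ct a r).intervalIntegrable t (t + h))
      ((continuous_const (y := C₁)).intervalIntegrable t (t + h)) fun s _ => hC a ha r hr s
    rwa [stek_const hh] at this
  obtain ⟨t, ht, hY⟩ := H.exists_small_time_deriv X hq hk0 hk1 hb (by linarith) hτ0
    (by linarith) hUC fun r hr t => hcomm h hh hhh r (by linarith [hr.1]) t
  have hfin := H.flux_le_of_time_deriv X hq hA2 hkA hb (by linarith) hc (A := A) (δ := δ)
    (C₁ := C₁) (ε := ε)
    (fun a ha r hr => hX a ⟨ha.1, by linarith [ha.2]⟩ r ⟨by linarith [hr.1], by linarith [hr.2]⟩)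
    hδ0 hδ1 (fun r hr => by
      have := stek_mono hh ((continuous_const (y := (1 / 4 : ℝ))).intervalIntegrable t (t + h))
        ((ct 0 r).intervalIntegrable t (t + h)) fun s hs =>
          hvl r hr s ⟨by linarith [hs.1, ht.1], by linarith [hs.2, ht.2]⟩
      rwa [stek_const hh] at this)
    (fun r hr => hUC 0 ⟨le_rfl, hk0.le⟩ r ⟨by linarith [(_root_.abs_le.1 hr).1],
      by linarith [(_root_.abs_le.1 hr).2]⟩ t) hε0 hY
  have hη2 : k ^ 2 * (2 * k * η) = k ^ (-γ) := by rw [hη]; field_simp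
  have hlast := hR₁ k hkR
  rw [← hδ₀, hη2] at hfin
  have heq : 1 / (4 * ε * c ^ 4) * (Q * (2 * K * (2 * K) ^ γ * k ^ (-γ) + k ^ (-γ)) / τ) =
      B * k ^ (-γ) := by rw [hB]; ring
  rw [heq] at hfin
  linarith

end Sol2

namespace Sol2

/-- Scale-invariant bound for the mass of a solution in a box. -/
theorem exists_mass_bound {q p l : ℝ} (hq : 1 < q) (hp : 0 ≤ p) (hl : 0 < l) :
    ∃ Q ≥ 0, ∀ {M C : ℝ} {v va vr vaa vrr : ℝ → ℝ → ℝ → ℝ},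
      Sol2 q p M C v va vr vaa vrr → ∀ {k b m a₁ a₂ r₁ r₂ t : ℝ}, 0 < k → 2 * k ≤ b → 0 < m →
      0 ≤ a₁ → a₁ ≤ a₂ → a₂ ≤ l * k / 2 → b - k / 2 ≤ r₁ → r₁ ≤ r₂ → r₂ ≤ b + k / 2 →
      (∀ a ∈ Icc a₁ a₂, ∀ r ∈ Icc r₁ r₂, m ≤ v a r t) →
      m * ((a₂ - a₁) * (r₂ - r₁)) ≤ Q * (k ^ 2 * k ^ (-(1 / (q - 1)))) := by
  obtain ⟨K, hK, c, hc, hcut⟩ := exists_cut hp hl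
  refine ⟨2 / c * (2 * K * (2 * K) ^ (1 / (q - 1))), ?_, ?_⟩
  · have : (0:ℝ) ≤ K := by linarith
    positivity
  intro M C v va vr vaa vrr S k b m a₁ a₂ r₁ r₂ t hk hb hm ha₁ ha ha₂ hr₁ hr hr₂ hv
  obtain ⟨ξ, ξ₁, ξ₂, χ, χ₁, χ₂, X, hX⟩ := hcut k b hk hb
  have cv : Continuous fun x : (ℝ × ℝ) × ℝ => v x.1.1 x.1.2 x.2 :=
    S.cont.comp (by fun_prop : Continuous fun x : (ℝ × ℝ) × ℝ => (x.1.1, x.1.2, x.2))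
  obtain ⟨O, I, _, hI, hO, htI, hOI⟩ := generalized_tube_lemma
    (s := Icc a₁ a₂ ×ˢ Icc r₁ r₂) (isCompact_Icc.prod isCompact_Icc) (t := {t})
    isCompact_singleton (isOpen_lt (continuous_const (y := m / 2)) cv) (by
      rintro ⟨⟨a, r⟩, s⟩ ⟨⟨h1, h2⟩, h3⟩
      have h3 : s = t := h3
      have := hv a h1 r h2
      show m / 2 < v a r s
      rw [h3]; linarith)
  obtain ⟨ε, hε, hball⟩ := Metric.isOpen_iff.1 hI t (htI rfl)
  set h := ε / 2 with hh_def
  have hh : 0 < h := by positivity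
  have hU : ∀ a ∈ Icc a₁ a₂, ∀ r ∈ Icc r₁ r₂, m / 2 ≤ stek h (v a r) t := by
    intro a ha r hr
    have ct : Continuous (v a r) :=
      S.cont.comp (by fun_prop : Continuous fun t : ℝ => (a, r, t))
    have := stek_mono hh ((continuous_const (y := m / 2)).intervalIntegrable t (t + h))
      (ct.intervalIntegrable t (t + h)) fun s hs => by
        have hs' : s ∈ I := hball (by
          rw [Metric.mem_ball, Real.dist_eq, abs_lt]
          constructor <;> linarith [hs.1, hs.2])
        exact (hOI (mk_mem_prod (hO (mk_mem_prod ha hr)) hs')).le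
    rwa [stek_const hh] at this
  have H := S.uSol hq hh
  have hL : 0 < l * k := by positivity
  have hmass := H.mass_le X hq hL hk hb (by linarith) t
  have hsub : Ioc a₁ a₂ ×ˢ Icc r₁ r₂ ⊆ rect (l * k) b k :=
    prod_mono (Ioc_subset_Ioc ha₁ (by linarith)) (Icc_subset_Icc (by linarith) (by linarith))
  have bU : BddContOn (fun z : ℝ × ℝ => stek h (v z.1 z.2) t * (ξ z.1 * χ z.2))
      (rect (l * k) b k) :=
    ((H.bU t).mul X.testFn.bdd).mono (rect_subset_strip _ _ _)
  have hvol : volume (Ioc a₁ a₂ ×ˢ Icc r₁ r₂) ≠ ⊤ :=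
    ne_top_of_le_ne_top volume_rect_ne_top (measure_mono hsub)
  have h1 : ∫ z in Ioc a₁ a₂ ×ˢ Icc r₁ r₂, m / 2 * c ≤
      ∫ z in rect (l * k) b k, stek h (v z.1 z.2) t * (ξ z.1 * χ z.2) := by
    refine (BddContOn.integral_mono (.const _) (bU.mono hsub)
      (measurableSet_Ioc.prod measurableSet_Icc) hvol fun z hz => ?_).trans
      (setIntegral_mono_set (bU.integrableOn measurableSet_rect volume_rect_ne_top)
        (Eventually.of_forall fun z => mul_nonneg (H.pos _ _ _).le
          (mul_nonneg (X.ξ_nonneg _) (X.χ_nonneg _))) hsub.eventuallyLE)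
    exact mul_le_mul (hU z.1 ⟨hz.1.1.le, hz.1.2⟩ z.2 hz.2)
      (hX z.1 ⟨ha₁.trans hz.1.1.le, hz.1.2.trans ha₂⟩ z.2 ⟨hr₁.trans hz.2.1, hz.2.2.trans hr₂⟩)
      hc.le (H.pos _ _ _).le
  rw [setIntegral_const, Measure.volume_eq_prod, measureReal_prod_prod,
    Real.volume_real_Ioc_of_le ha, Real.volume_real_Icc_of_le hr, smul_eq_mul] at h1
  have h2 := h1.trans hmass
  calc m * ((a₂ - a₁) * (r₂ - r₁)) = 2 / c * ((a₂ - a₁) * (r₂ - r₁) * (m / 2 * c)) := by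
        field_simp
    _ ≤ 2 / c * _ := mul_le_mul_of_nonneg_left h2 (by positivity)
    _ = _ := by ring

end Sol2

/-- A point where a weighted supremum is almost attained, with a comparison bound nearby. -/
theorem exists_near_max {α : Type*} {e f : α → ℝ} {γ M K : ℝ} (hγ : 0 < γ) (he : ∀ x, 0 ≤ e x)
    (hf : ∀ x, 0 ≤ f x) (hM : ∀ x, f x ≤ M) (hun : ∀ C, ∃ x, C < e x ^ γ * f x) (hK : 0 < K) :
    ∃ x, 0 < e x ∧ K ≤ e x ^ γ * f x ∧
      ∀ y, e x / 2 ≤ e y → e y ≤ 2 * e x → f y ≤ 2 * 2 ^ γ * f x := by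
  obtain ⟨x₁, hx₁⟩ := hun (2 * K)
  set L := e x₁ with hL
  have hL0 : 0 < L := (he x₁).lt_of_ne fun h => by
    rw [show L = 0 from h.symm, Real.zero_rpow hγ.ne', zero_mul] at hx₁
    linarith
  set w : ℝ → ℝ := fun s => min (s ^ γ) (L ^ γ * L ^ γ * (s ^ γ)⁻¹) with hw
  have hLγ : 0 < L ^ γ := Real.rpow_pos_of_pos hL0 γ
  have hwL : w L = L ^ γ := by
    simp only [hw]
    rw [mul_inv_cancel_right₀ hLγ.ne', min_self]
  have hw0 : ∀ s, 0 ≤ s → 0 ≤ w s := fun s hs =>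
    le_min (Real.rpow_nonneg hs γ)
      (mul_nonneg (mul_nonneg hLγ.le hLγ.le) (inv_nonneg.2 (Real.rpow_nonneg hs γ)))
  have hwpos : ∀ s, 0 < s → 0 < w s := fun s hs => by
    have := Real.rpow_pos_of_pos hs γ
    exact lt_min this (by positivity)
  have hwle : ∀ s, 0 ≤ s → w s ≤ L ^ γ := fun s hs => by
    have hsγ : 0 ≤ s ^ γ := Real.rpow_nonneg hs γ
    rcases le_total (s ^ γ) (L ^ γ) with h | h
    · exact (min_le_left _ _).trans h
    · refine (min_le_right _ _).trans ?_
      rw [← div_eq_mul_inv, div_le_iff₀ (hLγ.trans_le h)]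
      gcongr
  have hwcomp : ∀ s s', 0 < s → s / 2 ≤ s' → s' ≤ 2 * s → w s ≤ 2 ^ γ * w s' := by
    intro s s' hs h1 h2
    have hs' : 0 < s' := by linarith
    have hsγ := Real.rpow_pos_of_pos hs γ
    have hsγ' := Real.rpow_pos_of_pos hs' γ
    have h2γ : (0:ℝ) < 2 ^ γ := by positivity
    have e1 : s ^ γ ≤ 2 ^ γ * s' ^ γ := by
      rw [← Real.mul_rpow zero_le_two hs'.le]
      exact Real.rpow_le_rpow hs.le (by linarith) hγ.le
    have e2 : s' ^ γ ≤ 2 ^ γ * s ^ γ := by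
      rw [← Real.mul_rpow zero_le_two hs.le]
      exact Real.rpow_le_rpow hs'.le h2 hγ.le
    simp only [hw]
    rw [mul_min_of_nonneg _ _ h2γ.le]
    refine min_le_min e1 ?_
    have e3 : (s ^ γ)⁻¹ ≤ 2 ^ γ * (s' ^ γ)⁻¹ := by
      rw [← div_eq_mul_inv, le_div_iff₀ hsγ', inv_mul_le_iff₀ hsγ]
      linarith
    calc _ ≤ L ^ γ * L ^ γ * (2 ^ γ * (s' ^ γ)⁻¹) := by gcongr
      _ = _ := by ring
  have hM0 : 0 ≤ M := (hf x₁).trans (hM x₁)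
  have hbdd : BddAbove (range fun x => w (e x) * f x) := by
    refine ⟨L ^ γ * M, ?_⟩
    rintro _ ⟨x, rfl⟩
    exact mul_le_mul (hwle _ (he x)) (hM x) (hf x) hLγ.le
  set σ := ⨆ x, w (e x) * f x with hσ
  have hσ1 : 2 * K < σ := by
    refine hx₁.trans_le ?_
    rw [← hwL]
    exact le_ciSup hbdd x₁
  have : Nonempty α := ⟨x₁⟩
  obtain ⟨x, hx⟩ := exists_lt_of_lt_ciSup (show σ / 2 < ⨆ x, w (e x) * f x by linarith)
  have hwx : w (e x) * f x ≤ e x ^ γ * f x := mul_le_mul_of_nonneg_right (min_le_left _ _) (hf x)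
  have hex : 0 < e x := (he x).lt_of_ne fun h => by
    have h2 : e x ^ γ * f x = 0 := by rw [← h, Real.zero_rpow hγ.ne', zero_mul]
    linarith
  refine ⟨x, hex, by linarith, fun y h1 h2 => ?_⟩
  have h3 := hwcomp _ _ hex h1 h2
  have h4 : w (e y) * f y ≤ σ := le_ciSup hbdd y
  have h5 := mul_le_mul_of_nonneg_right h3 (hf x)
  have h6 : w (e y) * f y ≤ w (e y) * (2 * 2 ^ γ * f x) := by
    calc _ ≤ 2 * (2 ^ γ * w (e y) * f x) := by linarith
      _ = _ := by ring
  exact le_of_mul_le_mul_left h6 (hwpos _ (by linarith))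

namespace PSol
variable {n : ℕ} {o : Fin n} {q M : ℝ} {W : (Fin n → ℝ) → ℝ → ℝ}
  {D D2 : Fin n → (Fin n → ℝ) → ℝ → ℝ} {j : Fin n}

/-- A relative maximum far from the boundary satisfies the scale-invariant bound. -/
theorem exists_interior_peak_bound (P : PSol o q M W D D2) (hq : 1 < q) (hn : 2 ≤ n) (hj : j ≠ o)
    (hs : ∀ x y : Fin n → ℝ, x o = y o → (∑ i ∈ Finset.univ.erase o, x i ^ 2)
      = (∑ i ∈ Finset.univ.erase o, y i ^ 2) → ∀ t, W x t = W y t) {S δ : ℝ} (hS : 1 ≤ S)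
    (hδ : 0 < δ) (hδ1 : δ ≤ 1) : ∃ C ≥ 0, ∀ {σ d r t : ℝ}, 0 < σ → δ * σ ≤ d → d ≤ 2 * n * σ →
      0 ≤ r → (∀ x : Fin n → ℝ, 0 ≤ x o → (∀ i, |x i - meridian o j d r i| ≤ σ) → ∀ s,
        W x s ≤ S * W (meridian o j d r) t) →
      W (meridian o j d r) t ≤ C * σ ^ (-(1 / (q - 1))) := by
  set G : ℝ := 8 * n + 18 with hG
  have hG1 : 1 ≤ G := by have : (0:ℝ) ≤ n := n.cast_nonneg
                         linarith
  set c : ℝ := δ / (48 * G * S) with hc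
  have hc0 : 0 < c := by positivity
  obtain ⟨Q, hQ, hmass⟩ := Sol2.exists_mass_bound (p := (n:ℝ) - 2) (l := 2 * (2 * n + c) / c) hq
    (sub_nonneg.2 (by exact_mod_cast hn)) (by positivity)
  refine ⟨2 * Q * c ^ (-(1 / (q - 1))), by positivity, ?_⟩
  intro σ d r t hσ hd hdn hr hb
  have hd0 : 0 < d := (mul_pos hδ hσ).trans_le hd
  set x₀ := meridian o j d r with hx₀
  have hx₀o : x₀ o = d := by rw [hx₀, meridian_o hj, max_eq_left hd0.le]
  have hx₀j : x₀ j = r := meridian_j d r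
  set u := W x₀ t with hu
  have hu0 : 0 < u := P.pos _ _ (by rw [hx₀o]; exact hd0.le)
  set s := δ * σ / 4 with hs'
  have hs0 : 0 < s := by positivity
  have hsσ : 2 * s ≤ σ := by rw [hs']; nlinarith
  set k := c * σ with hk
  have hk0 : 0 < k := by positivity
  have hkG : G * (S * u) / s * (3 * k) ≤ u / 4 := by
    rw [hk, hc, hs']; field_simp; norm_num
  have hks : 3 * k ≤ s := by
    have h1 : G * (S * u) / s * (3 * k) * s ≤ u / 4 * s := mul_le_mul_of_nonneg_right hkG hs0.le
    have h2 : G * (S * u) / s * (3 * k) * s = G * S * (u * (3 * k)) := by field_simp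
    have h3 : 1 * (u * (3 * k)) ≤ G * S * (u * (3 * k)) := by
      gcongr; nlinarith
    have h4 : u * (3 * k) ≤ u * s := by nlinarith
    exact le_of_mul_le_mul_left h4 hu0
  have hgrad : ∀ x : Fin n → ℝ, (∀ i, |x i - x₀ i| ≤ s) → ∀ i, |D i x t| ≤ G * (S * u) / s := by
    intro x hx i
    have hxo : s < x o := by
      have := (abs_le.1 (hx o)).1
      rw [hx₀o] at this
      nlinarith
    refine P.interior_grad hs0 (by positivity) hxo (fun y hy τ _ => hb y hy.2 (fun i => ?_) τ) i
    have := abs_add_le (y i - x i) (x i - x₀ i)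
    rw [sub_add_sub_cancel] at this
    linarith [hy.1 i, hx i]
  have hstep : ∀ i a, |a - d| ≤ s → |i - r| ≤ s → ∀ l, |meridian o j a i l - x₀ l| ≤ s := by
    intro i a ha hi l
    have ha0 : 0 < a := by have := (abs_le.1 ha).1; nlinarith
    by_cases hlo : l = o
    · rw [hlo, hx₀o, meridian_o hj, max_eq_left ha0.le]; exact ha
    by_cases hlj : l = j
    · rw [hlj, hx₀j, meridian_j]; exact hi
    rw [hx₀, meridian_of_ne hlo hlj, meridian_of_ne hlo hlj, sub_zero, abs_zero]
    exact hs0.le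
  have hlow : ∀ a ∈ Icc d (d + k), ∀ r' ∈ Icc (r + 2 * k - k / 2) (r + 2 * k + k / 2),
      u / 2 ≤ W (meridian o j a r') t := by
    intro a ha r' hr'
    have h1 := P.mvt (i := o) (x := x₀) (t := t) ha.1
      (fun s hs => by rw [update_self]; linarith [hs.1]) (fun s hs => Or.inr (by linarith [hs.1]))
      (C := G * (S * u) / s) fun l hl => by
        rw [hx₀, update_meridian_o hj _ _ _ (by linarith [hl.1])]
        exact hgrad _ (hstep _ _ (abs_le.2 ⟨by linarith [hl.1], by linarith [hl.2, ha.2]⟩)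
          (by simpa using hs0.le)) o
    have hrr : r ≤ r' := by linarith [hr'.1]
    have h2 := P.mvt (i := j) (x := meridian o j a r) (t := t) hrr
      (fun s hs => by rw [update_meridian_j, meridian_o hj]; exact le_max_right _ _)
      (fun s hs => Or.inl hj) (C := G * (S * u) / s) fun l hl => by
        rw [update_meridian_j]
        exact hgrad _ (hstep _ _ (abs_le.2 ⟨by linarith [ha.1], by linarith [ha.2]⟩)
          (abs_le.2 ⟨by linarith [hl.1], by linarith [hl.2, hr'.2]⟩)) j
    rw [hx₀, update_meridian_o hj _ _ _ (by linarith [ha.1]), update_meridian_o hj _ _ _ hd0.le]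
      at h1
    rw [update_meridian_j, update_meridian_j] at h2
    have hB : 0 ≤ G * (S * u) / s := by positivity
    have h3 := mul_le_mul_of_nonneg_left (show a - d ≤ 3 * k by linarith [ha.2]) hB
    have h4 := mul_le_mul_of_nonneg_left (show r' - r ≤ 3 * k by linarith [hr'.2]) hB
    have hu' : W (meridian o j d r) t = u := rfl
    rw [hu'] at h1
    linarith [(abs_le.1 h1).1, (abs_le.1 h2).1]
  have hm := hmass (P.sol2 hj hs) hk0 (show 2 * k ≤ r + 2 * k by linarith) (half_pos hu0) hd0.le
    (show d ≤ d + k by linarith) (by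
      have : 2 * (2 * n + c) / c * k / 2 = (2 * n + c) * σ := by rw [hk]; field_simp
      rw [this, hk]; linarith) le_rfl (by linarith) le_rfl hlow
  have hkγ : k ^ (-(1 / (q - 1))) = c ^ (-(1 / (q - 1))) * σ ^ (-(1 / (q - 1))) :=
    Real.mul_rpow hc0.le hσ.le
  rw [hkγ] at hm
  have hm' : u * k ^ 2 ≤ 2 * Q * c ^ (-(1 / (q - 1))) * σ ^ (-(1 / (q - 1))) * k ^ 2 := by
    linarith
  exact le_of_mul_le_mul_right hm' (by positivity)

theorem smul_meridian (hj : j ≠ o) {l : ℝ} (hl : 0 ≤ l) (a r : ℝ) :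
    (fun i => l * meridian o j a r i) = meridian o j (l * a) (l * r) := by
  funext i
  by_cases hio : i = o
  · rw [hio, meridian_o hj, meridian_o hj, mul_max_of_nonneg _ _ hl, mul_zero]
  by_cases hij : i = j
  · rw [hij, meridian_j, meridian_j]
  · rw [meridian_of_ne hio hij, meridian_of_ne hio hij, mul_zero]

/-- A relative maximum near the boundary satisfies the scale-invariant bound. -/
theorem exists_boundary_peak_bound (P : PSol o q M W D D2) (hq : 1 < q) (hn : 2 ≤ n) (hj : j ≠ o)
    (hs : ∀ x y : Fin n → ℝ, x o = y o → (∑ i ∈ Finset.univ.erase o, x i ^ 2)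
      = (∑ i ∈ Finset.univ.erase o, y i ^ 2) → ∀ t, W x t = W y t) {S : ℝ} (hS : 1 ≤ S) :
    ∃ C ≥ 0, ∀ {σ r t u : ℝ}, 0 < σ → σ ≤ r → 0 < u → u / 2 ≤ W (meridian o j 0 r) t →
      (∀ x : Fin n → ℝ, 0 ≤ x o → (∀ i, |x i - meridian o j 0 r i| ≤ σ) → ∀ s, W x s ≤ S * u) →
      σ * u ^ (q - 1) ≤ C := by
  set γ := 1 / (q - 1) with hγ
  have hq1 : 0 < q - 1 := by linarith
  set G : ℝ := 8 * n + 18 with hG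
  have hG1 : 0 < G := by positivity
  have hp : (0:ℝ) ≤ n - 2 := sub_nonneg.2 (by exact_mod_cast hn)
  have hS0 : 0 < S := by linarith
  set C₂ := 16 * q * G * (S / 1 + S ^ q) with hC₂
  have hC₂0 : 0 < C₂ := by have : 0 < q := by linarith
                           positivity
  set C₃ := 8 * G * C₂ + (n - 2) * C₂ with hC₃
  have hC₃0 : 0 ≤ C₃ := by positivity
  obtain ⟨R, hR1, hR⟩ := Sol2.exists_radius hq hp hS0.le hC₂0.le hC₃0
  refine ⟨2 * max R 2, by positivity, ?_⟩
  intro σ r t u hσ hσr hu hW hb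
  by_contra! hlt
  set l := (u ^ (q - 1))⁻¹ with hl
  have huq : 0 < u ^ (q - 1) := Real.rpow_pos_of_pos hu _
  have hl0 : 0 < l := inv_pos.2 huq
  have hlγ : l ^ γ = u⁻¹ := by
    rw [hl, Real.inv_rpow huq.le, ← Real.rpow_mul hu.le, hγ, mul_one_div_cancel hq1.ne',
      Real.rpow_one]
  set k := σ / (2 * l) with hk
  have hkl : l * (2 * k) = σ := by rw [hk]; field_simp
  have hkmax : max R 2 ≤ k := by
    have : σ * u ^ (q - 1) = 2 * k := by rw [hk, hl]; field_simp
    linarith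
  have hkR : R ≤ k := (le_max_left _ _).trans hkmax
  have hk2 : 2 ≤ k := (le_max_right _ _).trans hkmax
  set b := r / l with hbdef
  have hlb : l * b = r := by rw [hbdef]; field_simp
  have hkb : 2 * k ≤ b := by
    refine le_of_mul_le_mul_left ?_ hl0
    rw [hkl, hlb]; exact hσr
  have P' := P.scale hq hl0 t
  rw [← hγ] at P'
  have hs' : ∀ x y : Fin n → ℝ, x o = y o → (∑ i ∈ Finset.univ.erase o, x i ^ 2)
      = (∑ i ∈ Finset.univ.erase o, y i ^ 2) → ∀ τ,
      l ^ γ * W (fun j => l * x j) (t + l ^ 2 * τ) = l ^ γ * W (fun j => l * y j) (t + l ^ 2 * τ) := by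
    intro x y h1 h2 τ
    rw [hs (fun j => l * x j) (fun j => l * y j) (by simp only [h1])
      (by simp only [mul_pow]; rw [← Finset.mul_sum, ← Finset.mul_sum, h2])]
  have S2 := P'.sol2 hj hs'
  set z₀ := meridian o j 0 b with hz₀
  have hz₀o : z₀ o = 0 := by rw [hz₀, meridian_o hj, max_self]
  have hbound : ∀ x : Fin n → ℝ, 0 ≤ x o → (∀ i, |x i - z₀ i| ≤ 2 * k) → ∀ τ,
      l ^ γ * W (fun j => l * x j) (t + l ^ 2 * τ) ≤ S := by
    intro x hx hxz τ
    have h1 := hb (fun j => l * x j) (mul_nonneg hl0.le hx) (fun i => ?_) (t + l ^ 2 * τ)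
    · rw [hlγ, inv_mul_le_iff₀ hu]; linarith
    · have h2 : meridian o j 0 r i = l * z₀ i := by
        have := congrFun (smul_meridian hj hl0.le 0 b) i
        rw [mul_zero, hlb] at this
        exact this.symm
      rw [h2, ← mul_sub, abs_mul, abs_of_pos hl0, ← hkl]
      exact mul_le_mul_of_nonneg_left (hxz i) hl0.le
  have hgrad : ∀ x : Fin n → ℝ, 0 ≤ x o → (∀ i, |x i - z₀ i| ≤ 2) → ∀ i τ,
      |l ^ γ * l * D i (fun j => l * x j) (t + l ^ 2 * τ)| ≤ C₂ := by
    intro x hx hxz i τ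
    refine P'.local_grad hq one_pos hS0 hx (fun y hy τ => hbound y hy.2 (fun i => ?_) τ) i τ
    have := abs_add_le (y i - x i) (x i - z₀ i)
    rw [sub_add_sub_cancel] at this
    linarith [hy.1 i, hxz i]
  have hdist : ∀ {a r' m : ℝ}, 0 ≤ a → a ≤ m → |r' - b| ≤ m → ∀ i,
      |meridian o j a r' i - z₀ i| ≤ m := by
    intro a r' m ha ham hr i
    by_cases hio : i = o
    · rw [hio, hz₀o, meridian_o hj, max_eq_left ha, sub_zero, abs_of_nonneg ha]; exact ham
    by_cases hij : i = j
    · rw [hij, hz₀, meridian_j, meridian_j]; exact hr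
    · rw [hz₀, meridian_of_ne hio hij, meridian_of_ne hio hij, sub_zero, abs_zero]
      exact ha.trans ham
  have hmo : ∀ {a r' : ℝ}, 0 ≤ a → meridian o j a r' o = a := fun ha => by
    rw [meridian_o hj, max_eq_left ha]
  have hfin := hR S2 hkR hkb (fun a ha r' hr' τ =>
    hbound _ (by rw [hmo ha.1]; exact ha.1) (hdist ha.1 (by linarith [ha.2])
      (abs_le.2 ⟨by linarith [hr'.1], by linarith [hr'.2]⟩)) τ) fun a ha r' hr' τ => by
    have ha0 : 0 < a := ha.1
    have hd := hdist ha0.le ha.2 hr'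
    have hg := fun i => hgrad (meridian o j a r') (by rw [hmo ha0.le]; exact ha0.le)
      (fun i => (hd i).trans one_le_two) i τ
    have h2 : ∀ i, |l ^ γ * l ^ 2 * D2 i (fun m => l * meridian o j a r' m) (t + l ^ 2 * τ)| ≤
        4 * G * C₂ / a := fun i => by
      have := P'.second_bound (x₀ := meridian o j a r') (ρ := a / 4) (t₀ := τ) (by positivity)
        hC₂0 (by rw [hmo ha0.le]; linarith) i fun x hx τ _ => ?_
      · refine this.trans (le_of_eq ?_)
        rw [← hG]; field_simp
      · refine hgrad x ?_ (fun m => ?_) i τ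
        · have := (abs_le.1 (hx o)).1
          rw [hmo ha0.le] at this
          linarith
        · have := abs_add_le (x m - meridian o j a r' m) (meridian o j a r' m - z₀ m)
          rw [sub_add_sub_cancel] at this
          linarith [hx m, hd m, ha.2]
    refine ⟨hg o, hg j, ?_⟩
    have hr1 : 1 ≤ r' := by linarith [(abs_le.1 hr').1]
    have h3 : |((n:ℝ) - 2) / r' * (l ^ γ * l * D j (fun m => l * meridian o j a r' m)
        (t + l ^ 2 * τ))| ≤ (n - 2) * C₂ / a := by
      rw [abs_mul, abs_of_nonneg (by positivity)]
      calc _ ≤ ((n:ℝ) - 2) / 1 * C₂ := by gcongr; exact hg j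
        _ = (n - 2) * C₂ / 1 := by ring
        _ ≤ _ := by gcongr; exact ha.2
    refine (abs_add_three _ _ _).trans ?_
    calc _ ≤ 4 * G * C₂ / a + 4 * G * C₂ / a + (n - 2) * C₂ / a := by
          gcongr
          · exact h2 o
          · exact h2 j
      _ = _ := by rw [hC₃]; ring
  have h0 : l ^ γ * W (fun m => l * meridian o j 0 b m) (t + l ^ 2 * 0) < 1 / 2 := hfin
  rw [smul_meridian hj hl0.le, mul_zero, hlb, mul_zero, add_zero, hlγ, inv_mul_lt_iff₀ hu] at h0
  linarith

end PSol

theorem norm_toLp_sub_le {n : ℕ} {x y : Fin n → ℝ} {σ : ℝ} (hσ : 0 ≤ σ)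
    (h : ∀ i, |x i - y i| ≤ σ) : ‖WithLp.toLp 2 x - WithLp.toLp 2 y‖ ≤ n * σ := by
  rw [EuclideanSpace.norm_eq, Real.sqrt_le_left (by positivity)]
  calc ∑ i, ‖(WithLp.toLp 2 x - WithLp.toLp 2 y) i‖ ^ 2 ≤ ∑ _i : Fin n, σ ^ 2 :=
        Finset.sum_le_sum fun i _ => pow_le_pow_left₀ (norm_nonneg _) (h i) 2
    _ = n * σ ^ 2 := by simp
    _ ≤ (n * σ) ^ 2 := by
        have : (n : ℝ) ≤ n ^ 2 := by exact_mod_cast Nat.le_self_pow two_ne_zero n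
        rw [mul_pow]
        gcongr

theorem norm_toLp_sq {n : ℕ} (o : Fin n) (x : Fin n → ℝ) :
    ‖WithLp.toLp 2 x‖ ^ 2 = x o ^ 2 + ∑ i ∈ Finset.univ.erase o, x i ^ 2 := by
  rw [EuclideanSpace.real_norm_sq_eq]
  exact (Finset.add_sum_erase _ (fun i => x i ^ 2) (Finset.mem_univ o)).symm

theorem sum_erase_meridian {n : ℕ} {o j : Fin n} (hj : j ≠ o) (a r : ℝ) :
    ∑ i ∈ Finset.univ.erase o, meridian o j a r i ^ 2 = r ^ 2 := by
  rw [Finset.sum_eq_single j, meridian_j]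
  · intro i hi hij
    rw [meridian_of_ne (Finset.ne_of_mem_erase hi) hij]
    simp
  · intro h
    exact (h (Finset.mem_erase.2 ⟨hj, Finset.mem_univ j⟩)).elim

namespace PSol
variable {n : ℕ} {o : Fin n} {q M : ℝ} {W : (Fin n → ℝ) → ℝ → ℝ}
  {D D2 : Fin n → (Fin n → ℝ) → ℝ → ℝ} {j : Fin n}

/-- The value of a solution does not drop much between a point near the boundary and the
boundary. -/
theorem half_le_boundary (P : PSol o q M W D D2) (hj : j ≠ o) {S d σ r t : ℝ} (hS : 1 ≤ S)
    (hσ : 0 < σ) (hd : 0 ≤ d) (hdσ : 4 * (8 * n + 18) * S * d ≤ σ)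
    (hb : ∀ x : Fin n → ℝ, 0 ≤ x o → (∀ i, |x i - meridian o j d r i| ≤ σ) → ∀ s,
      W x s ≤ S * W (meridian o j d r) t) :
    W (meridian o j d r) t / 2 ≤ W (meridian o j 0 r) t := by
  set G : ℝ := 8 * n + 18 with hG
  have hG1 : 1 ≤ G := by have : (0:ℝ) ≤ n := n.cast_nonneg
                         linarith
  have hmo : ∀ s, 0 ≤ s → meridian o j s r o = s := fun s hs => by
    rw [meridian_o hj, max_eq_left hs]
  set u := W (meridian o j d r) t with hu
  have hu0 : 0 < u := P.pos _ _ (by rw [hmo d hd]; exact hd)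
  have hGS : 1 ≤ G * S := by nlinarith
  have hd2 : d ≤ σ / 2 := by nlinarith
  have hslope : ∀ s ∈ Icc 0 d, D o (meridian o j s r) t ≤ G * (S * u) / (σ / 2) := by
    intro s hs
    refine P.normal_le (by positivity) (by positivity) (by rw [hmo s hs.1]; exact hs.1)
      fun x hx τ _ => hb x hx.2 (fun i => ?_) τ
    have h1 := hx.1 i
    have h2 : |meridian o j s r i - meridian o j d r i| ≤ σ / 2 := by
      by_cases hio : i = o
      · rw [hio, hmo s hs.1, hmo d hd, _root_.abs_le]
        constructor <;> linarith [hs.1, hs.2]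
      · rw [← update_meridian_o hj d r s hs.1, update_of_ne hio, sub_self, abs_zero]
        positivity
    have h3 := abs_sub_le (x i) (meridian o j s r i) (meridian o j d r i)
    linarith
  have hcont : ContinuousOn (fun s => W (meridian o j s r) t) (Icc 0 d) := by
    refine P.cont.comp (f := fun s : ℝ => (meridian o j s r, t)) ?_ fun s hs => ?_
    · exact ((continuous_meridian.comp (by fun_prop :
        Continuous fun s : ℝ => (s, r))).prodMk continuous_const).continuousOn
    · show 0 ≤ meridian o j s r o
      rw [hmo s hs.1]; exact hs.1
  have hder : ∀ s ∈ interior (Icc 0 d), HasDerivAt (fun s => W (meridian o j s r) t)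
      (D o (meridian o j s r) t) s := by
    intro s hs
    rw [interior_Icc] at hs
    have h := P.hasD o (meridian o j s r) t (by rw [hmo s hs.1.le]; exact hs.1.le)
      (Or.inr (by rw [hmo s hs.1.le]; exact hs.1))
    rw [hmo s hs.1.le] at h
    refine h.congr_of_eventuallyEq ?_
    filter_upwards [Ioi_mem_nhds hs.1] with s' hs'
    rw [update_meridian_o hj s r s' (le_of_lt hs')]
  have := (convex_Icc 0 d).image_sub_le_mul_sub_of_deriv_le hcont
    (fun s hs => (hder s hs).differentiableAt.differentiableWithinAt)
    (C := G * (S * u) / (σ / 2)) (fun s hs => by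
      rw [(hder s hs).deriv]; exact hslope s (interior_subset hs))
    0 ⟨le_rfl, hd⟩ d ⟨hd, le_rfl⟩ hd
  have h2 : G * (S * u) / (σ / 2) * (d - 0) ≤ u / 2 := by
    rw [sub_zero, div_mul_eq_mul_div, div_le_iff₀ (by positivity)]
    nlinarith
  simp only [← hu] at this
  linarith

set_option maxHeartbeats 600000 in
/-- The solution decays at the rate dictated by scaling. -/
theorem exists_decay (P : PSol o q M W D D2) (hq : 1 < q) (hn : 2 ≤ n) (hj : j ≠ o)
    (hs : ∀ x y : Fin n → ℝ, x o = y o → (∑ i ∈ Finset.univ.erase o, x i ^ 2)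
      = (∑ i ∈ Finset.univ.erase o, y i ^ 2) → ∀ t, W x t = W y t) :
    ∃ C > 0, ∀ x t, 0 ≤ x o → ‖WithLp.toLp 2 x‖ ^ (1 / (q - 1)) * W x t ≤ C := by
  set γ := 1 / (q - 1) with hγ
  have hq1 : 0 < q - 1 := by linarith
  have hγ0 : 0 < γ := by positivity
  by_contra! hcon
  set S : ℝ := 2 * 2 ^ γ with hS
  have hS1 : 1 ≤ S := by
    have := Real.one_le_rpow one_le_two hγ0.le
    linarith
  set G : ℝ := 8 * n + 18 with hG
  have hn2 : (2:ℝ) ≤ n := by exact_mod_cast hn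
  have hG1 : 1 ≤ G := by linarith
  set δ := 1 / (4 * G * S) with hδ
  have hGS : 1 ≤ G * S := by nlinarith
  have hδ0 : 0 < δ := by positivity
  have hδ1 : δ ≤ 1 := by
    rw [hδ, div_le_one (by positivity)]
    linarith
  obtain ⟨C₁, hC₁, h₁⟩ := P.exists_interior_peak_bound hq hn hj hs hS1 hδ0 hδ1
  obtain ⟨C₂, hC₂, h₂⟩ := P.exists_boundary_peak_bound hq hn hj hs hS1
  set K := C₁ * (2 * n) ^ γ + (4 * n * C₂) ^ γ + 1 with hK
  have hK0 : 0 < K := by positivity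
  obtain ⟨⟨⟨x₀, t₀⟩, hx₀⟩, hρ, hKρ, hmax⟩ := exists_near_max
    (α := {p : (Fin n → ℝ) × ℝ // 0 ≤ p.1 o}) (e := fun p => ‖WithLp.toLp 2 p.1.1‖)
    (f := fun p => W p.1.1 p.1.2) hγ0 (fun _ => norm_nonneg _) (fun p => (P.pos _ _ p.2).le)
    (fun p => P.le _ _ p.2) (fun C => by
      obtain ⟨x, t, hx, h⟩ := hcon (max C 1) (by positivity)
      exact ⟨⟨(x, t), hx⟩, (le_max_left _ _).trans_lt h⟩) hK0
  simp only at hρ hKρ hmax hx₀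
  set ρ := ‖WithLp.toLp 2 x₀‖ with hρdef
  set d := x₀ o with hd
  set r := √(∑ i ∈ Finset.univ.erase o, x₀ i ^ 2) with hr
  have hr2 : r ^ 2 = ∑ i ∈ Finset.univ.erase o, x₀ i ^ 2 :=
    Real.sq_sqrt (Finset.sum_nonneg fun i _ => sq_nonneg _)
  have hr0 : 0 ≤ r := Real.sqrt_nonneg _
  have hmo : meridian o j d r o = d := by rw [meridian_o hj, max_eq_left hx₀]
  have hWm : ∀ t, W x₀ t = W (meridian o j d r) t :=
    hs _ _ hmo.symm (by rw [sum_erase_meridian hj, hr2])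
  have hρ2 : ρ ^ 2 = d ^ 2 + r ^ 2 := by rw [hρdef, norm_toLp_sq o, hr2]
  have hnm : ‖WithLp.toLp 2 (meridian o j d r)‖ = ρ := by
    rw [← sq_eq_sq₀ (norm_nonneg _) hρ.le, norm_toLp_sq o, hmo, sum_erase_meridian hj, hρ2]
  rw [hWm] at hKρ
  simp only [hWm] at hmax
  set u := W (meridian o j d r) t₀ with hu
  have hu0 : 0 < u := P.pos _ _ (by rw [hmo]; exact hx₀)
  set σ := ρ / (2 * n) with hσ
  have hσ0 : 0 < σ := by positivity
  have hσρ : ρ = 2 * n * σ := by rw [hσ]; field_simp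
  have hbox : ∀ x : Fin n → ℝ, 0 ≤ x o → (∀ i, |x i - meridian o j d r i| ≤ σ) → ∀ s,
      W x s ≤ S * u := by
    intro x hx hxi s
    have h1 := norm_toLp_sub_le hσ0.le hxi
    have h2 := abs_norm_sub_norm_le (WithLp.toLp 2 x) (WithLp.toLp 2 (meridian o j d r))
    rw [hnm] at h2
    have h3 := _root_.abs_le.1 (h2.trans h1)
    exact hmax ⟨(x, s), hx⟩ (by linarith [h3.1]) (by linarith [h3.2])
  have hdρ : d ≤ ρ := by nlinarith
  rcases le_or_gt (δ * σ) d with h | h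
  · have h3 := h₁ hσ0 h (by rw [← hσρ]; exact hdρ) hr0 hbox
    have h4 : ρ ^ γ * u ≤ C₁ * (2 * n) ^ γ := by
      calc ρ ^ γ * u ≤ ρ ^ γ * (C₁ * σ ^ (-γ)) := by gcongr
        _ = _ := by
          rw [hσρ, Real.mul_rpow (by positivity) hσ0.le, Real.rpow_neg hσ0.le]
          have := Real.rpow_pos_of_pos hσ0 γ
          field_simp
    have : 0 ≤ (4 * n * C₂) ^ γ := by positivity
    linarith
  · have hdσ : 4 * G * S * d ≤ σ := by
      rw [hδ, div_mul_eq_mul_div, one_mul, lt_div_iff₀ (by positivity)] at h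
      linarith
    have hhalf := P.half_le_boundary hj hS1 hσ0 hx₀ hdσ hbox
    have hd2 : d ≤ σ / 2 := by nlinarith
    have hσr : σ / 2 ≤ r := by
      by_contra! hlt
      have e1 : d ^ 2 ≤ (σ / 2) ^ 2 := pow_le_pow_left₀ hx₀ hd2 2
      have e2 : r ^ 2 ≤ (σ / 2) ^ 2 := pow_le_pow_left₀ hr0 hlt.le 2
      have e3 : (4 * σ) ^ 2 ≤ ρ ^ 2 := pow_le_pow_left₀ (by positivity) (by nlinarith) 2
      nlinarith
    have hnear : ∀ i, |meridian o j 0 r i - meridian o j d r i| ≤ σ / 2 := fun i => by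
      by_cases hio : i = o
      · rw [hio, hmo, meridian_o hj, max_self, zero_sub, abs_neg, abs_of_nonneg hx₀]
        exact hd2
      · rw [← update_meridian_o hj d r 0 le_rfl, update_of_ne hio, sub_self, abs_zero]
        positivity
    have h3 : σ / 2 * u ^ (q - 1) ≤ C₂ := h₂ (half_pos hσ0) hσr hu0 hhalf
      fun x hx hxi s => hbox x hx (fun i => (abs_sub_le _ _ _).trans
        ((add_le_add (hxi i) (hnear i)).trans_eq (add_halves σ))) s
    have h4 : ρ * u ^ (q - 1) ≤ 4 * n * C₂ := by
      calc ρ * u ^ (q - 1) = 4 * n * (σ / 2 * u ^ (q - 1)) := by rw [hσρ]; ring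
        _ ≤ _ := by gcongr
    have h5 : ρ ^ γ * u ≤ (4 * n * C₂) ^ γ := by
      have h6 := Real.rpow_le_rpow (by positivity) h4 hγ0.le
      rwa [Real.mul_rpow hρ.le (by positivity), ← Real.rpow_mul hu0.le, hγ,
        mul_one_div_cancel hq1.ne', Real.rpow_one] at h6
    have : 0 ≤ C₁ * (2 * n) ^ γ := by positivity
    linarith

end PSol

/-- A functional on Euclidean space is bounded by its values on the coordinate vectors. -/
theorem norm_le_sum_apply_single {n : ℕ} (L : EuclideanSpace ℝ (Fin n) →L[ℝ] ℝ) :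
    ‖L‖ ≤ ∑ i, |L (EuclideanSpace.single i 1)| := by
  refine L.opNorm_le_bound (Finset.sum_nonneg fun i _ => abs_nonneg _) fun x => ?_
  have hx : L x = ∑ i, x i * L (EuclideanSpace.single i 1) := by
    conv_lhs => rw [← (EuclideanSpace.basisFun (Fin n) ℝ).sum_repr x]
    simp
  rw [hx, Finset.sum_mul]
  refine (norm_sum_le _ _).trans (Finset.sum_le_sum fun i _ => ?_)
  rw [norm_mul, mul_comm, ← Real.norm_eq_abs (L _)]
  exact mul_le_mul_of_nonneg_left (PiLp.norm_apply_le x i) (norm_nonneg _)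

theorem axisymmetric_halfspace_solution_gradient_decay
    (n : ℕ) (hn3 : 3 ≤ n) (hn : 0 < n) (q : ℝ) (hq : 1 < q)
    (hqn : 1 / (q - 1) < (n : ℝ) - 1)
    (u : EuclideanSpace ℝ (Fin n) × ℝ → ℝ)
    (hsol : IsHalfSpaceSol n hn q u)
    (hsym : AxiallySymmetric n hn u)
    (hbdd : ∃ M : ℝ, ∀ x ∈ closedHalf n hn, ∀ t : ℝ,
      u (x, t) ≤ M ∧
      ‖fderivWithin ℝ (fun y => u (y, t)) (closedHalf n hn) x‖ ≤ M) :
    ∃ C > 0, ∀ x ∈ closedHalf n hn, x ≠ 0 → ∀ t : ℝ,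
      ‖fderivWithin ℝ (fun y => u (y, t)) (closedHalf n hn) x‖
        ≤ C * ‖x‖ ^ (-(q / (q - 1))) := by
  obtain ⟨M, hM⟩ := hbdd
  have P := hsol.pSol hM
  have hj : (⟨1, by omega⟩ : Fin n) ≠ ⟨0, hn⟩ := by simp
  have hs : ∀ x y : Fin n → ℝ, x ⟨0, hn⟩ = y ⟨0, hn⟩ →
      (∑ i ∈ Finset.univ.erase ⟨0, hn⟩, x i ^ 2) = (∑ i ∈ Finset.univ.erase ⟨0, hn⟩, y i ^ 2) →
      ∀ t, u (WithLp.toLp 2 x, t) = u (WithLp.toLp 2 y, t) :=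
    fun x y h1 h2 t => hsym _ _ h1 h2 t
  obtain ⟨C, hC, hdecay⟩ := P.exists_decay hq (by omega) hj hs
  have hq1 : 0 < q - 1 := by linarith
  have hn1 : (0:ℝ) < n := by exact_mod_cast hn
  set γ := 1 / (q - 1) with hγ
  have hγ0 : 0 < γ := by positivity
  have hexp : q / (q - 1) = γ + 1 := by rw [hγ]; field_simp; ring
  have hγq : γ * q = γ + 1 := by rw [hγ]; field_simp; ring
  set C₀ := C * 2 ^ γ with hC₀
  have hC₀0 : 0 < C₀ := by positivity
  refine ⟨n * (16 * q * (8 * n + 18) * (2 * n * C₀ + C₀ ^ q)), ?_, fun x hx hx0 t => ?_⟩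
  · have : 0 < q := by linarith
    positivity
  have hρ : 0 < ‖x‖ := norm_pos_iff.2 hx0
  set ρ := ‖x‖ with hρd
  have hbox : ∀ y ∈ hbox ⟨0, hn⟩ x.ofLp (ρ / (2 * n)), ∀ s,
      u (WithLp.toLp 2 y, s) ≤ C₀ * ρ ^ (-γ) := by
    intro y hy s
    have h1 := norm_toLp_sub_le (by positivity) hy.1
    have h2 := abs_norm_sub_norm_le (WithLp.toLp 2 y) (WithLp.toLp 2 x.ofLp)
    have h3 : ‖WithLp.toLp 2 x.ofLp‖ = ρ := rfl
    have h4 : n * (ρ / (2 * n)) = ρ / 2 := by field_simp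
    rw [h4] at h1
    rw [h3] at h2
    have h5 : ρ / 2 ≤ ‖WithLp.toLp 2 y‖ := by
      have := (abs_le.1 (h2.trans h1)).1
      linarith
    have h6 := hdecay y s hy.2
    have h7 : (ρ / 2) ^ γ ≤ ‖WithLp.toLp 2 y‖ ^ γ := Real.rpow_le_rpow (by positivity) h5 hγ0.le
    have h8 : (ρ / 2) ^ γ * u (WithLp.toLp 2 y, s) ≤ C :=
      (mul_le_mul_of_nonneg_right h7 (P.pos y s hy.2).le).trans h6
    rw [Real.div_rpow hρ.le zero_le_two] at h8
    have h9 := Real.rpow_pos_of_pos hρ γ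
    have h10 : (0:ℝ) < 2 ^ γ := by positivity
    rw [hC₀, Real.rpow_neg hρ.le, ← div_eq_mul_inv, le_div_iff₀ h9]
    rw [div_mul_eq_mul_div, div_le_iff₀ h10] at h8
    linarith
  have hργ : 0 < ρ ^ (-γ) := Real.rpow_pos_of_pos hρ _
  have hgrad := fun i => P.local_grad hq (x₀ := x.ofLp) (ρ := ρ / (2 * n)) (by positivity)
    (by positivity) hx hbox i t
  have hval : C₀ * ρ ^ (-γ) / (ρ / (2 * n)) + (C₀ * ρ ^ (-γ)) ^ q
      = (2 * n * C₀ + C₀ ^ q) * ρ ^ (-(q / (q - 1))) := by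
    have e1 : ρ ^ (-(q / (q - 1))) = ρ ^ (-γ) / ρ := by
      rw [hexp, neg_add, ← sub_eq_add_neg, Real.rpow_sub_one hρ.ne']
    have e2 : (ρ ^ (-γ)) ^ q = ρ ^ (-(q / (q - 1))) := by
      rw [← Real.rpow_mul hρ.le, neg_mul, hγq, hexp]
    rw [Real.mul_rpow hC₀0.le hργ.le, e2, e1]
    field_simp
  rw [hval] at hgrad
  calc _ ≤ ∑ i, |fderivWithin ℝ (fun y => u (y, t)) (closedHalf n hn) x
          (EuclideanSpace.single i 1)| := norm_le_sum_apply_single _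
    _ ≤ ∑ _i : Fin n, 16 * q * (8 * n + 18) *
          ((2 * n * C₀ + C₀ ^ q) * ρ ^ (-(q / (q - 1)))) := Finset.sum_le_sum fun i _ => hgrad i
    _ = _ := by
      rw [Finset.sum_const, Finset.card_univ, Fintype.card_fin, nsmul_eq_mul]
      ring
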